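/- Fix ε > 0 and set m = ⌈(1+ε)n⌉. Let M̃ = (M_0,…,M_{n²m}) be a uniformly random (n,n,m)-array process. Then with probability tending to 1 as n → ∞, the hitting time of the property 'has no empty shaft' equals the hitting time of the property 'supports a Latin box'; that is, w.h.p. the first array in the process with no empty shaft already supports a Latin box. -/

import Mathlib

attribute [local instance] Classical.propDecidable

noncomputable section

/-- The number of ones in an `m × n × k` 0-1 array. -/
def numOnes {m n k : ℕ} (M : Fin m → Fin n → Fin k → Bool) : ℕ :=
  (Finset.univ.filter (fun x : Fin m × Fin n × Fin k => M x.1 x.2.1 x.2.2 = true)).card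

/-- An `m × n × k` 0-1 array is a Latin box if it has exactly `m * n` ones and
every line (fixing two coordinates, varying the third) has at most one `1`. -/
def IsLatinBox {m n k : ℕ} (M : Fin m → Fin n → Fin k → Bool) : Prop :=
  numOnes M = m * n ∧
  (∀ i j, (Finset.univ.filter (fun c => M i j c = true)).card ≤ 1) ∧
  (∀ i c, (Finset.univ.filter (fun j => M i j c = true)).card ≤ 1) ∧
  (∀ j c, (Finset.univ.filter (fun i => M i j c = true)).card ≤ 1)

/-- `M` contains (supports) a Latin box. -/
def ContainsLatinBox {m n k : ℕ} (M : Fin m → Fin n → Fin k → Bool) : Prop :=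
  ∃ L : Fin m → Fin n → Fin k → Bool, IsLatinBox L ∧ ∀ i j c, L i j c = true → M i j c = true

/-- The probability that a random `m × n × k` 0-1 array, whose entries are
independently `1` with probability `p`, satisfies the property `P`. -/
def arrProb (m n k : ℕ) (p : ℝ) (P : (Fin m → Fin n → Fin k → Bool) → Prop) : ℝ :=
  ∑ M : Fin m → Fin n → Fin k → Bool,
    if P M then ∏ i, ∏ j, ∏ c, (if M i j c = true then p else 1 - p) else 0

/-- The array at time `t` of the `(n,n,m)`-array process determined by the order `σ`
in which the `n·n·m` positions are switched from `0` to `1`. -/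
def procArr (n m : ℕ) (σ : Fin (n * n * m) ≃ (Fin n × Fin n × Fin m)) (t : ℕ) :
    Fin n → Fin n → Fin m → Bool :=
  fun i j c => decide (∃ s : Fin (n * n * m), (s : ℕ) < t ∧ σ s = (i, j, c))

/-- The hitting time of a property `Q` in the array process determined by `σ`. -/
def hittingTime (n m : ℕ) (σ : Fin (n * n * m) ≃ (Fin n × Fin n × Fin m))
    (Q : (Fin n → Fin n → Fin m → Bool) → Prop) : ℕ :=
  sInf {t : ℕ | Q (procArr n m σ t)}

/-- No shaft `(r,c,·)` of the `n × n × m` array is empty. -/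
def NoEmptyShaft {n m : ℕ} (M : Fin n → Fin n → Fin m → Bool) : Prop :=
  ∀ r c, ∃ v, M r c v = true

/-- The expectation of `f` under the weights `μ` on a finite type. -/
def wExp {X : Type*} [Fintype X] (μ f : X → ℝ) : ℝ := ∑ x, μ x * f x

/-- The probability of `Q` under the weights `μ` on a finite type. -/
def wPr {X : Type*} [Fintype X] (μ : X → ℝ) (Q : X → Prop) : ℝ :=
  wExp μ (fun x => if Q x then 1 else 0)

/-- `μ` is a probability weight function. -/
def IsWeight {X : Type*} [Fintype X] (μ : X → ℝ) : Prop := (∀ x, 0 ≤ μ x) ∧ ∑ x, μ x = 1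

/-- The product weights on functions `ι → X`. -/
def powWeight (ι : Type*) [Fintype ι] {X : Type*} (μ : X → ℝ) : (ι → X) → ℝ :=
  fun ω => ∏ i, μ (ω i)

/-- The Bernoulli weights. -/
def bern (p : ℝ) : Bool → ℝ := fun b => if b = true then p else 1 - p

section WeightedExpectation

variable {X Y ι : Type*} [Fintype X] [Fintype Y] [Fintype ι] [DecidableEq ι] {μ : X → ℝ} {ν : Y → ℝ}

theorem wExp_mono (hμ : IsWeight μ) {f g : X → ℝ} (h : ∀ x, f x ≤ g x) :
    wExp μ f ≤ wExp μ g :=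
  Finset.sum_le_sum fun x _ => mul_le_mul_of_nonneg_left (h x) (hμ.1 x)

theorem wExp_const (hμ : IsWeight μ) (c : ℝ) : wExp μ (fun _ => c) = c := by
  simp [wExp, ← Finset.sum_mul, hμ.2]

theorem wExp_nonneg (hμ : IsWeight μ) {f : X → ℝ} (h : ∀ x, 0 ≤ f x) : 0 ≤ wExp μ f :=
  Finset.sum_nonneg fun x _ => mul_nonneg (hμ.1 x) (h x)

theorem wExp_const_mul (c : ℝ) (f : X → ℝ) : wExp μ (fun x => c * f x) = c * wExp μ f := by
  simp only [wExp, Finset.mul_sum]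
  exact Finset.sum_congr rfl fun x _ => by ring

theorem wExp_mul_const (c : ℝ) (f : X → ℝ) : wExp μ (fun x => f x * c) = wExp μ f * c := by
  simp only [wExp, Finset.sum_mul]
  exact Finset.sum_congr rfl fun x _ => by ring

theorem wExp_add (f g : X → ℝ) : wExp μ (fun x => f x + g x) = wExp μ f + wExp μ g := by
  simp only [wExp, ← Finset.sum_add_distrib, mul_add]

theorem wExp_sub (f g : X → ℝ) : wExp μ (fun x => f x - g x) = wExp μ f - wExp μ g := by
  simp only [wExp, ← Finset.sum_sub_distrib, mul_sub]

theorem wExp_sum {κ : Type*} (s : Finset κ) (f : κ → X → ℝ) :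
    wExp μ (fun x => ∑ i ∈ s, f i x) = ∑ i ∈ s, wExp μ (f i) := by
  simp only [wExp, Finset.mul_sum]
  exact Finset.sum_comm

theorem wExp_comm (f : X → Y → ℝ) :
    wExp μ (fun x => wExp ν (f x)) = wExp ν (fun y => wExp μ (fun x => f x y)) := by
  simp only [wExp, Finset.mul_sum]
  rw [Finset.sum_comm]
  exact Finset.sum_congr rfl fun y _ => Finset.sum_congr rfl fun x _ => by ring

theorem wPr_nonneg (hμ : IsWeight μ) (Q : X → Prop) : 0 ≤ wPr μ Q :=
  wExp_nonneg hμ fun x => by positivity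

theorem wPr_le_wExp (hμ : IsWeight μ) {Q : X → Prop} {f : X → ℝ} (h0 : ∀ x, 0 ≤ f x)
    (h1 : ∀ x, Q x → 1 ≤ f x) : wPr μ Q ≤ wExp μ f :=
  wExp_mono hμ fun x => by
    split_ifs with h
    · exact h1 x h
    · exact h0 x

theorem wPr_mono (hμ : IsWeight μ) {Q R : X → Prop} (h : ∀ x, Q x → R x) :
    wPr μ Q ≤ wPr μ R :=
  wPr_le_wExp hμ (fun x => by positivity) fun x hx => by simp [h x hx]

theorem wPr_le_one (hμ : IsWeight μ) (Q : X → Prop) : wPr μ Q ≤ 1 :=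
  (wPr_le_wExp hμ (f := fun _ => 1) (fun _ => zero_le_one) fun _ _ => le_rfl).trans
    (wExp_const hμ 1).le

theorem wPr_not (hμ : IsWeight μ) (Q : X → Prop) : wPr μ (fun x => ¬ Q x) = 1 - wPr μ Q := by
  have h := wExp_const hμ 1
  rw [← h, wPr, wPr, ← wExp_sub]
  congr 1
  ext x
  by_cases hx : Q x <;> simp [hx]

theorem wPr_or_le (hμ : IsWeight μ) (Q R : X → Prop) :
    wPr μ (fun x => Q x ∨ R x) ≤ wPr μ Q + wPr μ R := by
  rw [wPr, wPr, wPr, ← wExp_add]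
  refine wExp_mono hμ fun x => ?_
  by_cases h1 : Q x <;> by_cases h2 : R x <;> simp [h1, h2]

theorem wPr_exists_le (hμ : IsWeight μ) {κ : Type*} [Fintype κ] (Q : κ → X → Prop) :
    wPr μ (fun x => ∃ i, Q i x) ≤ ∑ i, wPr μ (Q i) := by
  simp only [wPr]
  rw [← wExp_sum]
  refine wExp_mono hμ fun x => ?_
  split_ifs with h
  · obtain ⟨i, hi⟩ := h
    refine le_trans (by simp [hi]) (Finset.single_le_sum (f := fun i => if Q i x then (1 : ℝ) else 0)
      (fun j _ => by positivity) (Finset.mem_univ i))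
  · exact Finset.sum_nonneg fun j _ => by positivity

theorem IsWeight.powWeight (hμ : IsWeight μ) : IsWeight (powWeight ι μ) := by
  refine ⟨fun ω => Finset.prod_nonneg fun i _ => hμ.1 _, ?_⟩
  have := Fintype.prod_sum (fun (_ : ι) (x : X) => μ x)
  simp only [hμ.2, Finset.prod_const_one] at this
  exact this.symm

theorem wExp_powWeight_prod (g : ι → X → ℝ) :
    wExp (powWeight ι μ) (fun ω => ∏ i, g i (ω i)) = ∏ i, wExp μ (g i) := by
  have := Fintype.prod_sum (fun (i : ι) (x : X) => μ x * g i x)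
  simp only [wExp, powWeight]
  rw [this]
  exact Finset.sum_congr rfl fun x _ => by rw [Finset.prod_mul_distrib]

theorem wExp_powWeight_prod_finset (hμ : IsWeight μ) (T : Finset ι) (g : ι → X → ℝ) :
    wExp (powWeight ι μ) (fun ω => ∏ i ∈ T, g i (ω i)) = ∏ i ∈ T, wExp μ (g i) := by
  have h := wExp_powWeight_prod (μ := μ) (fun i x => if i ∈ T then g i x else 1)
  have e : ∀ i, wExp μ (fun x => if i ∈ T then g i x else 1)
      = if i ∈ T then wExp μ (g i) else 1 := fun i => by
    split_ifs
    · rfl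
    · exact wExp_const hμ 1
  simp only [e] at h
  simpa [Finset.prod_ite_mem] using h

theorem wExp_powWeight_single (hμ : IsWeight μ) (i : ι) (g : X → ℝ) :
    wExp (powWeight ι μ) (fun ω => g (ω i)) = wExp μ g := by
  simpa using wExp_powWeight_prod_finset hμ {i} (fun _ => g)

theorem isWeight_bern {p : ℝ} (h0 : 0 ≤ p) (h1 : p ≤ 1) : IsWeight (bern p) := by
  refine ⟨fun b => ?_, by simp [bern]⟩
  cases b <;> simp [bern, h0, h1]

theorem wExp_bern (p : ℝ) (f : Bool → ℝ) :
    wExp (bern p) f = p * f true + (1 - p) * f false := by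
  simp [wExp, bern]

theorem pow_card_filter_eq_prod {κ : Type*} (T : Finset κ) (Q : κ → Prop) [DecidablePred Q] (y : ℝ) :
    y ^ (T.filter Q).card = ∏ i ∈ T, if Q i then y else 1 := by
  rw [Finset.prod_ite]; simp

theorem wExp_ite_const (hμ : IsWeight μ) (Q : X → Prop) (y : ℝ) :
    wExp μ (fun x => if Q x then y else 1) = 1 + wPr μ Q * (y - 1) := by
  have : (fun x => if Q x then y else 1)
      = fun x => 1 + (if Q x then 1 else 0) * (y - 1) := by
    ext x; split_ifs <;> ring
  rw [this, wExp_add, wExp_const hμ, wExp_mul_const]; rfl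

theorem wExp_pow_card_filter_le (hμ : IsWeight μ) (T : Finset ι) (Q : ι → X → Prop) {q y : ℝ}
    (hq : ∀ i ∈ T, wPr μ (Q i) ≤ q) (hy : 1 ≤ y) :
    wExp (powWeight ι μ) (fun ω => y ^ (T.filter fun i => Q i (ω i)).card)
      ≤ Real.exp (q * (y - 1) * T.card) := by
  simp only [pow_card_filter_eq_prod]
  rw [wExp_powWeight_prod_finset hμ T (fun i x => if Q i x then y else 1)]
  have : Real.exp (q * (y - 1) * T.card) = ∏ _i ∈ T, Real.exp (q * (y - 1)) := by
    rw [Finset.prod_const, ← Real.exp_nat_mul]; ring_nf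
  rw [this]
  refine Finset.prod_le_prod (fun i _ => wExp_nonneg hμ fun x => ?_) fun i hi => ?_
  · split_ifs <;> linarith
  · rw [wExp_ite_const hμ]
    have h1 := mul_le_mul_of_nonneg_right (hq i hi) (sub_nonneg.2 hy)
    linarith [Real.add_one_le_exp (q * (y - 1))]

theorem one_le_exp_mul_pow {s u : ℝ} {k : ℕ} (hu : 0 ≤ u) (h : s ≤ k) :
    1 ≤ Real.exp (-(s * u)) * Real.exp u ^ k := by
  rw [← Real.exp_nat_mul, ← Real.exp_add]
  exact Real.one_le_exp (by nlinarith)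

/-- Chernoff's upper tail bound for the number of successes among independent trials. -/
theorem wPr_lt_card_filter_le (hμ : IsWeight μ) (T : Finset ι) (Q : ι → X → Prop) {q u s N : ℝ}
    (hq : ∀ i ∈ T, wPr μ (Q i) ≤ q) (hq0 : 0 ≤ q) (hu : 0 ≤ u) (hN : (T.card : ℝ) ≤ N) :
    wPr (powWeight ι μ) (fun ω => s < ((T.filter fun i => Q i (ω i)).card : ℝ))
      ≤ Real.exp (q * Real.exp u * N - s * u) := by
  have h1 : 1 ≤ Real.exp u := Real.one_le_exp hu
  calc _ ≤ wExp (powWeight ι μ) (fun ω => Real.exp (-(s * u)) *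
          Real.exp u ^ (T.filter fun i => Q i (ω i)).card) :=
        wPr_le_wExp hμ.powWeight (fun ω => by positivity)
          fun ω hω => one_le_exp_mul_pow hu hω.le
    _ ≤ Real.exp (-(s * u)) * Real.exp (q * (Real.exp u - 1) * T.card) := by
        rw [wExp_const_mul]
        gcongr
        exact wExp_pow_card_filter_le hμ T Q hq h1
    _ ≤ _ := by
        rw [← Real.exp_add, Real.exp_le_exp]
        have : q * (Real.exp u - 1) * T.card ≤ q * Real.exp u * N := by
          have h0 : (0 : ℝ) ≤ T.card := by positivity
          have : q * (Real.exp u - 1) ≤ q * Real.exp u := by nlinarith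
          have h2 : 0 ≤ q * Real.exp u := by positivity
          nlinarith
        linarith

theorem wExp_pow_card_true {p : ℝ} (hp0 : 0 ≤ p) (hp1 : p ≤ 1) {y : ℝ} (hy : 0 ≤ y) :
    wExp (powWeight ι (bern p)) (fun ω => y ^ (Finset.univ.filter fun i => ω i = true).card)
      ≤ Real.exp (-(p * (1 - y) * Fintype.card ι)) := by
  simp only [pow_card_filter_eq_prod]
  rw [wExp_powWeight_prod_finset (isWeight_bern hp0 hp1) Finset.univ
    (fun _ x => if x = true then y else 1)]
  simp only [wExp_bern, Finset.prod_const, Finset.card_univ]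
  have h : p * y + (1 - p) * 1 ≤ Real.exp (-(p * (1 - y))) := by
    linarith [Real.add_one_le_exp (-(p * (1 - y)))]
  calc _ ≤ (Real.exp (-(p * (1 - y)))) ^ Fintype.card ι := by
        have : 0 ≤ p * y + (1 - p) * 1 := by nlinarith
        simpa using pow_le_pow_left₀ this h _
    _ = _ := by rw [← Real.exp_nat_mul]; ring_nf

end WeightedExpectation

section ListColoring

variable {V C : Type*} [Fintype V]

/-- The proper colourings from the lists `L` of the graph `adj` induced on `S`, extended
by the colour `d` outside `S`. -/
def listColorings (adj : V → V → Prop) (L : V → Finset C) (d : C) (S : Finset V) :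
    Finset (V → C) :=
  (Fintype.piFinset fun v => if v ∈ S then L v else {d}).filter
    fun f => ∀ u ∈ S, ∀ v ∈ S, adj u v → f u ≠ f v

variable {adj : V → V → Prop} {L : V → Finset C} {d : C} {S : Finset V} {f : V → C}

theorem mem_listColorings : f ∈ listColorings adj L d S ↔
    (∀ v ∈ S, f v ∈ L v) ∧ (∀ v ∉ S, f v = d) ∧ ∀ u ∈ S, ∀ v ∈ S, adj u v → f u ≠ f v := by
  simp only [listColorings, Finset.mem_filter, Fintype.mem_piFinset, ← and_assoc]
  refine and_congr_left fun _ => ⟨fun h => ⟨fun v hv => by simpa [hv] using h v,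
    fun v hv => by simpa [hv] using h v⟩, fun h v => ?_⟩
  by_cases hv : v ∈ S
  · simpa [hv] using h.1 v hv
  · simpa [hv] using h.2 v hv

theorem card_listColorings_filter_le (u : V) (c : C) :
    ((listColorings adj L d S).filter fun f => f u = c).card
      ≤ (listColorings adj L d (S.erase u)).card := by
  refine Finset.card_le_card_of_injOn (fun f => Function.update f u d) (fun f hf => ?_) ?_
  · simp only [Finset.coe_filter, Set.mem_ofPred_eq, mem_listColorings] at hf
    obtain ⟨⟨h1, h2, h3⟩, -⟩ := hf
    simp only [Finset.mem_coe, mem_listColorings, Finset.mem_erase]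
    refine ⟨fun v hv => ?_, fun v hv => ?_, fun x hx y hy hxy => ?_⟩
    · simpa [hv.1] using h1 v hv.2
    · by_cases hvu : v = u
      · simp [hvu]
      · simpa [hvu] using h2 v fun h => hv ⟨hvu, h⟩
    · simpa [hx.1, hy.1] using h3 x hx.2 y hy.2 hxy
  · intro f hf g hg hfg
    simp only [Finset.coe_filter, Set.mem_ofPred_eq] at hf hg
    ext v
    by_cases hvu : v = u
    · rw [hvu, hf.2, hg.2]
    · simpa [hvu] using congrFun hfg v

theorem card_filter_conflictFree_le {v : V} (hv : v ∈ S) (hsymm : ∀ u v, adj u v → adj v u)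
    (hirr : ∀ v, ¬ adj v v) :
    (((listColorings adj L d (S.erase v)) ×ˢ L v).filter
        fun x => ∀ u ∈ S.erase v, adj v u → x.1 u ≠ x.2).card
      ≤ (listColorings adj L d S).card := by
  refine Finset.card_le_card_of_injOn (fun x => Function.update x.1 v x.2) (fun x hx => ?_) ?_
  · simp only [Finset.coe_filter, Set.mem_ofPred_eq, Finset.mem_product, mem_listColorings,
      Finset.mem_erase] at hx
    obtain ⟨⟨⟨h1, h2, h3⟩, h4⟩, h5⟩ := hx
    simp only [Finset.mem_coe, mem_listColorings]
    refine ⟨fun w hw => ?_, fun w hw => ?_, fun a ha b hb hab => ?_⟩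
    · by_cases hwv : w = v
      · subst hwv; simpa using h4
      · simpa [hwv] using h1 w ⟨hwv, hw⟩
    · have hwv : w ≠ v := fun h => hw (h ▸ hv)
      simpa [hwv] using h2 w fun h => hw h.2
    · by_cases hav : a = v
      · have hbv : b ≠ v := fun h => hirr v (by rw [hav, h] at hab; exact hab)
        subst hav
        simpa [hbv] using (h5 b ⟨hbv, hb⟩ hab).symm
      · by_cases hbv : b = v
        · subst hbv
          simpa [hav] using h5 a ⟨hav, ha⟩ (hsymm _ _ hab)
        · simpa [hav, hbv] using h3 a ⟨hav, ha⟩ b ⟨hbv, hb⟩ hab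
  · rintro ⟨f, c⟩ hf ⟨g, e⟩ hg hfg
    simp only [Finset.coe_filter, Set.mem_ofPred_eq, Finset.mem_product, mem_listColorings,
      Finset.mem_erase] at hf hg
    have h1 : c = e := by simpa using congrFun hfg v
    refine Prod.ext (funext fun w => ?_) h1
    by_cases hwv : w = v
    · subst hwv
      exact (hf.1.1.2.1 w (by simp)).trans (hg.1.1.2.1 w (by simp)).symm
    · simpa [hwv] using congrFun hfg w

theorem card_product_listColorings_le {v : V} :
    (listColorings adj L d (S.erase v)).card * (L v).card
      ≤ (((listColorings adj L d (S.erase v)) ×ˢ L v).filter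
          fun x => ∀ u ∈ S.erase v, adj v u → x.1 u ≠ x.2).card
        + ∑ c ∈ L v, ∑ u ∈ (S.erase v).filter (fun u => adj v u ∧ c ∈ L u),
            ((listColorings adj L d (S.erase v)).filter fun f => f u = c).card := by
  rw [← Finset.card_product, ← Finset.card_filter_add_card_filter_not
    (s := (listColorings adj L d (S.erase v)) ×ˢ L v)
    (fun x => ∀ u ∈ S.erase v, adj v u → x.1 u ≠ x.2)]
  gcongr
  simp only [← Finset.card_sigma]
  refine Finset.card_le_card_of_surjOn (fun x => (x.2.2, x.1)) fun ⟨f, c⟩ hf => ?_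
  simp only [Finset.coe_filter, Finset.mem_product, Set.mem_ofPred_eq, not_forall] at hf
  obtain ⟨⟨h1, h2⟩, u, hu, huv, hc⟩ := hf
  push Not at hc
  refine ⟨⟨c, u, f⟩, ?_, rfl⟩
  simp only [Finset.coe_sigma, Set.mem_sigma_iff, Finset.mem_coe, Finset.mem_filter]
  exact ⟨h2, ⟨hu, huv, hc ▸ (mem_listColorings.1 h1).1 u hu⟩, h1, hc⟩

theorem half_mul_card_listColorings_erase_le (hsymm : ∀ u v, adj u v → adj v u)
    (hirr : ∀ v, ¬ adj v v) {ℓ D : ℝ} (hℓ : 0 < ℓ) (hD : 4 * D ≤ ℓ)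
    (hL : ∀ v ∈ S, ℓ ≤ (L v).card)
    (hdeg : ∀ v ∈ S, ∀ c ∈ L v, ((S.filter fun u => adj v u ∧ c ∈ L u).card : ℝ) ≤ D) :
    ∀ v ∈ S, ℓ / 2 * (listColorings adj L d (S.erase v)).card
      ≤ (listColorings adj L d S).card := by
  induction S using Finset.strongInduction with
  | H S ih =>
  intro v hv
  set R := S.erase v with hR
  have hRS : R ⊂ S := Finset.erase_ssubset hv
  have ihR := ih R hRS (fun w hw => hL w (hRS.1 hw)) fun w hw c hc =>
    le_trans (by gcongr) (hdeg w (hRS.1 hw) c hc)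
  set N : ℝ := (((listColorings adj L d R).card : ℕ) : ℝ) with hN
  have hN0 : 0 ≤ N := by positivity
  have h1 : N * (L v).card ≤ (listColorings adj L d S).card
      + ∑ c ∈ L v, ∑ u ∈ R.filter (fun u => adj v u ∧ c ∈ L u),
            (((listColorings adj L d R).filter fun f => f u = c).card : ℝ) := by
    have h := (card_product_listColorings_le (adj := adj) (L := L) (d := d) (S := S) (v := v)).trans
      (Nat.add_le_add_right (card_filter_conflictFree_le hv hsymm hirr) _)
    rw [hN]
    exact_mod_cast h
  have h2 : ∑ c ∈ L v, ∑ u ∈ R.filter (fun u => adj v u ∧ c ∈ L u),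
            (((listColorings adj L d R).filter fun f => f u = c).card : ℝ)
      ≤ ∑ c ∈ L v, N / 2 := by
    refine Finset.sum_le_sum fun c hc => ?_
    calc _ ≤ ∑ u ∈ R.filter (fun u => adj v u ∧ c ∈ L u), 2 / ℓ * N := by
          refine Finset.sum_le_sum fun u hu => ?_
          have hu' := (Finset.mem_filter.1 hu).1
          have h3 := ihR u hu'
          have h4 : (((listColorings adj L d R).filter fun f => f u = c).card : ℝ)
              ≤ (listColorings adj L d (R.erase u)).card := by
            exact_mod_cast card_listColorings_filter_le u c
          rw [div_mul_eq_mul_div, le_div_iff₀ hℓ]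
          nlinarith
      _ ≤ D * (2 / ℓ * N) := by
          rw [Finset.sum_const, nsmul_eq_mul]
          gcongr
          exact le_trans (by gcongr) (hdeg v hv c hc)
      _ ≤ N / 2 := by
          have : D * (2 / ℓ * N) = (4 * D) / ℓ * (N / 2) := by field_simp; ring
          rw [this]
          have h5 : 4 * D / ℓ ≤ 1 := (div_le_one hℓ).2 hD
          nlinarith
  rw [Finset.sum_const, nsmul_eq_mul] at h2
  nlinarith [hL v hv]

/-- A graph has a proper colouring from its lists when each list is at least four times as
long as the number of neighbours of a vertex sharing any given colour with it. -/
theorem exists_list_coloring [Nonempty C] (hsymm : ∀ u v, adj u v → adj v u)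
    (hirr : ∀ v, ¬ adj v v) {ℓ D : ℝ} (hℓ : 0 < ℓ) (hD : 4 * D ≤ ℓ)
    (hL : ∀ v ∈ S, ℓ ≤ (L v).card)
    (hdeg : ∀ v ∈ S, ∀ c ∈ L v, ((S.filter fun u => adj v u ∧ c ∈ L u).card : ℝ) ≤ D) :
    ∃ f : V → C, (∀ v ∈ S, f v ∈ L v) ∧ ∀ u ∈ S, ∀ v ∈ S, adj u v → f u ≠ f v := by
  obtain ⟨d⟩ := ‹Nonempty C›
  suffices h : ∀ R ⊆ S, 0 < (listColorings adj L d R).card by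
    obtain ⟨f, hf⟩ := Finset.card_pos.1 (h S subset_rfl)
    exact ⟨f, (mem_listColorings.1 hf).1, (mem_listColorings.1 hf).2.2⟩
  intro R
  induction R using Finset.induction_on with
  | empty =>
    exact fun _ => Finset.card_pos.2 ⟨fun _ => d, mem_listColorings.2 (by simp)⟩
  | insert v R hv ih =>
    intro hR
    have h1 := ih ((Finset.subset_insert _ _).trans hR)
    have h2 := half_mul_card_listColorings_erase_le (S := insert v R) (d := d) hsymm hirr hℓ hD
      (fun w hw => hL w (hR hw)) (fun w hw c hc =>
        le_trans (by gcongr) (hdeg w (hR hw) c hc)) v (by simp)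
    rw [Finset.erase_insert hv] at h2
    have h3 : (0 : ℝ) < (listColorings adj L d R).card := by exact_mod_cast h1
    have h4 : (0 : ℝ) < (listColorings adj L d (insert v R)).card :=
      lt_of_lt_of_le (by positivity) h2
    exact_mod_cast h4

end ListColoring

/-- A nonnegative matrix with row and column sums at most one is dominated, in total weight
with respect to nonnegative weights `a`, by some permutation matrix. -/
theorem exists_perm_sum_le {n : ℕ} {x a : Fin n → Fin n → ℝ} (hx : ∀ i j, 0 ≤ x i j)
    (ha : ∀ i j, 0 ≤ a i j) (hrow : ∀ i, ∑ j, x i j ≤ 1) (hcol : ∀ j, ∑ i, x i j ≤ 1) :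
    ∃ σ : Equiv.Perm (Fin n), ∑ i, ∑ j, x i j * a i j ≤ ∑ i, a i (σ i) := by
  set S : ℝ := ∑ i, (1 - ∑ j, x i j) with hS
  have hS' : S = ∑ j, (1 - ∑ i, x i j) := by
    rw [hS, Finset.sum_sub_distrib, Finset.sum_sub_distrib, Finset.sum_comm]
  have hS0 : 0 ≤ S := Finset.sum_nonneg fun i _ => sub_nonneg.2 (hrow i)
  let Y : Matrix (Fin n) (Fin n) ℝ :=
    fun i j => x i j + (1 - ∑ j, x i j) * (1 - ∑ i, x i j) / S
  have hr0 : S = 0 → ∀ i, 1 - ∑ j, x i j = 0 := fun h i => by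
    rw [hS] at h
    exact (Finset.sum_eq_zero_iff_of_nonneg fun i _ => sub_nonneg.2 (hrow i)).1 h i
      (Finset.mem_univ i)
  have hc0 : S = 0 → ∀ j, 1 - ∑ i, x i j = 0 := fun h i => by
    rw [hS'] at h
    exact (Finset.sum_eq_zero_iff_of_nonneg fun i _ => sub_nonneg.2 (hcol i)).1 h i
      (Finset.mem_univ i)
  have hxY : ∀ i j, x i j ≤ Y i j := fun i j => by
    have := div_nonneg (mul_nonneg (sub_nonneg.2 (hrow i)) (sub_nonneg.2 (hcol j))) hS0
    simpa [Y] using this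
  have hY : Y ∈ doublyStochastic ℝ (Fin n) := by
    rw [mem_doublyStochastic_iff_sum]
    refine ⟨fun i j => (hx i j).trans (hxY i j), fun i => ?_, fun j => ?_⟩
    · simp only [Y]
      rw [Finset.sum_add_distrib, ← Finset.sum_div, ← Finset.mul_sum, ← hS']
      by_cases h : S = 0
      · have := hr0 h i
        simp [h]; linarith
      · field_simp; ring
    · simp only [Y]
      rw [Finset.sum_add_distrib, ← Finset.sum_div, ← Finset.sum_mul, ← hS]
      by_cases h : S = 0
      · have := hc0 h j
        simp [h]; linarith
      · field_simp; ring
  obtain ⟨w, hw0, hw1, hwY⟩ := exists_eq_sum_perm_of_mem_doublyStochastic hY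
  have hle : ∑ i, ∑ j, x i j * a i j ≤ ∑ i, ∑ j, Y i j * a i j :=
    Finset.sum_le_sum fun i _ => Finset.sum_le_sum fun j _ =>
      mul_le_mul_of_nonneg_right (hxY i j) (ha i j)
  have hYs : ∑ i, ∑ j, Y i j * a i j = ∑ σ, w σ * ∑ i, a i (σ i) := by
    rw [← hwY]
    simp only [Matrix.sum_apply, Matrix.smul_apply, Finset.sum_mul, smul_eq_mul]
    rw [Finset.sum_congr rfl fun i _ => Finset.sum_comm, Finset.sum_comm]
    refine Finset.sum_congr rfl fun σ _ => ?_
    rw [Finset.mul_sum]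
    refine Finset.sum_congr rfl fun i _ => ?_
    simp [Equiv.Perm.permMatrix, PEquiv.toMatrix_apply, Equiv.toPEquiv_apply]
  by_contra! hcon
  obtain ⟨σ₀, hσ₀⟩ : ∃ σ, 0 < w σ := by
    by_contra! h
    have := Finset.sum_nonpos fun σ (_ : σ ∈ Finset.univ) => h σ
    linarith
  have : ∑ σ, w σ * ∑ i, a i (σ i) < ∑ σ, w σ * ∑ i, ∑ j, x i j * a i j :=
    Finset.sum_lt_sum (fun σ _ => mul_le_mul_of_nonneg_left (hcon σ).le (hw0 σ))
      ⟨σ₀, Finset.mem_univ _, mul_lt_mul_of_pos_left (hcon σ₀) hσ₀⟩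
  rw [← Finset.sum_mul, hw1, one_mul] at this
  linarith

/-- The cell `e` of an `n × n` grid lies on the line `l`, where `inl r` is the row `r` and
`inr c` is the column `c`. -/
def OnLine {n : ℕ} (e : Fin n × Fin n) (l : Fin n ⊕ Fin n) : Prop :=
  l = Sum.inl e.1 ∨ l = Sum.inr e.2

/-- The number of cells of `G` on the line `l`. -/
def lineDeg {n : ℕ} (G : Finset (Fin n × Fin n)) (l : Fin n ⊕ Fin n) : ℕ :=
  (G.filter fun e => OnLine e l).card

/-- No two cells of `M` share a line. -/
def LineFree {n : ℕ} (M : Finset (Fin n × Fin n)) : Prop :=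
  ∀ e ∈ M, ∀ f ∈ M, ∀ l, OnLine e l → OnLine f l → e = f

section Grid

variable {n : ℕ}

@[simp] theorem onLine_inl {e : Fin n × Fin n} {r : Fin n} : OnLine e (Sum.inl r) ↔ e.1 = r := by
  simp [OnLine, eq_comm]

@[simp] theorem onLine_inr {e : Fin n × Fin n} {c : Fin n} : OnLine e (Sum.inr c) ↔ e.2 = c := by
  simp [OnLine, eq_comm]

theorem sum_filter_inl (r : Fin n) (g : Fin n × Fin n → ℝ) :
    ∑ e ∈ Finset.univ.filter (fun e => OnLine e (Sum.inl r)), g e = ∑ c, g (r, c) := by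
  simp only [onLine_inl, Finset.sum_filter, Fintype.sum_prod_type]
  rw [Finset.sum_eq_single r (fun b _ hb => by simp [hb]) (by simp)]
  simp

theorem sum_filter_inr (c : Fin n) (g : Fin n × Fin n → ℝ) :
    ∑ e ∈ Finset.univ.filter (fun e => OnLine e (Sum.inr c)), g e = ∑ r, g (r, c) := by
  simp only [onLine_inr, Finset.sum_filter, Fintype.sum_prod_type]
  refine Finset.sum_congr rfl fun r _ => ?_
  rw [Finset.sum_eq_single c (fun b _ hb => by simp [hb]) (by simp)]
  simp

/-- The weight given to the cell `e` by the canonical fractional matching of `G ∩ H`, in which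
lines with more than `t` cells are ignored. -/
def fracMatching (G : Finset (Fin n × Fin n)) (t : ℝ) (H : Fin n × Fin n → Bool)
    (e : Fin n × Fin n) : ℝ :=
  if (e ∈ G ∧ H e = true) ∧ ∀ l, OnLine e l → (lineDeg (G.filter fun f => H f = true) l : ℝ) ≤ t
  then 1 / t else 0

theorem fracMatching_nonneg {G : Finset (Fin n × Fin n)} {t : ℝ} (ht : 0 < t)
    (H : Fin n × Fin n → Bool) (e : Fin n × Fin n) : 0 ≤ fracMatching G t H e := by
  rw [fracMatching]; positivity

theorem sum_fracMatching_le_one {G : Finset (Fin n × Fin n)} {t : ℝ} (ht : 0 < t)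
    (H : Fin n × Fin n → Bool) (l : Fin n ⊕ Fin n) :
    ∑ e ∈ Finset.univ.filter (fun e => OnLine e l), fracMatching G t H e ≤ 1 := by
  by_cases h : (lineDeg (G.filter fun f => H f = true) l : ℝ) ≤ t
  · calc _ ≤ ∑ e ∈ Finset.univ.filter (fun e => OnLine e l),
          if e ∈ G ∧ H e = true then 1 / t else 0 := by
          refine Finset.sum_le_sum fun e _ => ?_
          rw [fracMatching]
          by_cases h1 : e ∈ G ∧ H e = true
          · simp only [h1, and_self, true_and, if_true]
            split_ifs
            · exact le_rfl
            · positivity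
          · simp [h1]
      _ = (lineDeg (G.filter fun f => H f = true) l) * (1 / t) := by
          rw [← Finset.sum_filter, Finset.sum_const, nsmul_eq_mul, lineDeg]
          congr 3
          ext e
          simp only [Finset.mem_filter, Finset.mem_univ, true_and]
          tauto
      _ ≤ 1 := by rw [mul_one_div]; exact (div_le_one ht).2 h
  · refine le_trans (Finset.sum_nonpos fun e he => ?_) zero_le_one
    rw [fracMatching, if_neg]
    exact fun h' => h (h'.2 l (Finset.mem_filter.1 he).2)

theorem exists_matching_ge_fracMatching {G : Finset (Fin n × Fin n)} {t : ℝ} (ht : 0 < t)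
    (H : Fin n × Fin n → Bool) {a : Fin n × Fin n → ℝ} (ha : ∀ e, 0 ≤ a e) :
    ∃ M : Finset (Fin n × Fin n), LineFree M ∧ M ⊆ G ∧ (∀ e ∈ M, H e = true) ∧
      ∑ e ∈ G, fracMatching G t H e * a e ≤ ∑ e ∈ M, a e := by
  obtain ⟨σ, hσ⟩ := exists_perm_sum_le (n := n) (x := fun i j => fracMatching G t H (i, j))
    (a := fun i j => if (i, j) ∈ G ∧ H (i, j) = true then a (i, j) else 0)
    (fun i j => fracMatching_nonneg ht _ _) (fun i j => by split_ifs <;> simp [ha])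
    (fun i => by
      rw [← sum_filter_inl i (fracMatching G t H)]; exact sum_fracMatching_le_one ht H _)
    (fun j => by
      rw [← sum_filter_inr j (fracMatching G t H)]; exact sum_fracMatching_le_one ht H _)
  refine ⟨(G.filter fun e => H e = true).filter fun e => σ e.1 = e.2, ?_, ?_, ?_, ?_⟩
  · rintro ⟨e1, e2⟩ he ⟨f1, f2⟩ hf l hel hfl
    simp only [Finset.mem_filter] at he hf
    rcases l with r | c
    · simp only [onLine_inl] at hel hfl
      rw [← he.2, ← hf.2]; simp [hel, hfl]
    · simp only [onLine_inr] at hel hfl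
      have : e1 = f1 := σ.injective (by rw [he.2, hf.2, hel, hfl])
      rw [hel, hfl, this]
  · exact (Finset.filter_subset _ _).trans (Finset.filter_subset _ _)
  · exact fun e he => (Finset.mem_filter.1 (Finset.mem_filter.1 he).1).2
  · calc _ = ∑ i, ∑ j, fracMatching G t H (i, j) *
          (if (i, j) ∈ G ∧ H (i, j) = true then a (i, j) else 0) := by
          rw [← Fintype.sum_prod_type' (f := fun i j => fracMatching G t H (i, j) *
            (if (i, j) ∈ G ∧ H (i, j) = true then a (i, j) else 0)),
            ← Finset.sum_subset (Finset.subset_univ G)]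
          · refine Finset.sum_congr rfl fun e he => ?_
            by_cases h : H e = true
            · simp [he, h]
            · simp [fracMatching, h]
          · intro e _ he
            simp [he]
      _ ≤ _ := hσ
      _ = _ := by
          have h1 : (G.filter fun e => H e = true).filter (fun e => σ e.1 = e.2)
              = Finset.univ.filter fun e => σ e.1 = e.2 ∧ e ∈ G ∧ H e = true := by
            ext e; simp only [Finset.mem_filter, Finset.mem_univ, true_and]; tauto
          rw [h1, Finset.sum_filter, Fintype.sum_prod_type]
          refine Finset.sum_congr rfl fun i _ => ?_
          rw [Finset.sum_eq_single (σ i) (fun b _ hb => by simp [hb.symm]) (by simp)]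
          simp

/-- In expectation, a line with at most `D` cells of `G` is not likely to have many more than
`D * p` cells of the random set `H`, even when conditioning on a cell of that line. -/
theorem wExp_mul_pow_lineDeg_le {G : Finset (Fin n × Fin n)} {p D y : ℝ} (hp0 : 0 ≤ p)
    (hp1 : p ≤ 1) (hy : 1 ≤ y) {e : Fin n × Fin n} (he : e ∈ G) {l : Fin n ⊕ Fin n}
    (hel : OnLine e l) (hdeg : (lineDeg G l : ℝ) ≤ D) :
    wExp (powWeight (Fin n × Fin n) (bern p)) (fun H => (if H e = true then 1 else 0) *
        y ^ lineDeg (G.filter fun f => H f = true) l)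
      ≤ p * y * Real.exp (p * (y - 1) * D) := by
  have hw := isWeight_bern hp0 hp1
  set T := G.filter fun f => OnLine f l with hT
  have heT : e ∈ T := Finset.mem_filter.2 ⟨he, hel⟩
  have h1 : ∀ H : Fin n × Fin n → Bool, (if H e = true then 1 else 0) *
        y ^ lineDeg (G.filter fun f => H f = true) l
      = ∏ f ∈ T, (if f = e then (if H f = true then y else 0) else if H f = true then y else 1) := by
    intro H
    have : lineDeg (G.filter fun f => H f = true) l = (T.filter fun f => H f = true).card := by
      rw [lineDeg, hT, Finset.filter_filter, Finset.filter_filter]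
      simp only [and_comm]
    rw [this, pow_card_filter_eq_prod, ← Finset.mul_prod_erase T _ heT,
      ← Finset.mul_prod_erase T _ heT, ← mul_assoc]
    congr 1
    · by_cases h : H e = true <;> simp [h]
    · exact Finset.prod_congr rfl fun f hf => by simp [Finset.ne_of_mem_erase hf]
  simp only [h1]
  rw [wExp_powWeight_prod_finset hw T (fun f b => if f = e then (if b = true then y else 0)
    else if b = true then y else 1), ← Finset.mul_prod_erase T _ heT]
  have h2 : ∀ f ∈ T.erase e, wExp (bern p) (fun b => if f = e then (if b = true then y else 0)
      else if b = true then y else 1) = 1 + p * (y - 1) := fun f hf => by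
    simp only [Finset.ne_of_mem_erase hf, if_false, wExp_bern]
    simp; ring
  rw [Finset.prod_congr rfl h2, Finset.prod_const]
  have h3 : wExp (bern p) (fun b => if e = e then (if b = true then y else 0)
      else if b = true then y else 1) = p * y := by
    simp [wExp_bern]
  rw [h3]
  refine mul_le_mul_of_nonneg_left ?_ (by positivity)
  have h4 : (((T.erase e).card : ℕ) : ℝ) ≤ D := le_trans (by
    exact_mod_cast Finset.card_erase_le) hdeg
  have h5 : 0 ≤ p * (y - 1) := mul_nonneg hp0 (by linarith)
  calc (1 + p * (y - 1)) ^ (T.erase e).card ≤ Real.exp (p * (y - 1)) ^ (T.erase e).card := by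
        gcongr
        linarith [Real.add_one_le_exp (p * (y - 1))]
    _ ≤ _ := by
        rw [← Real.exp_nat_mul, Real.exp_le_exp]
        nlinarith

theorem fracMatching_ge {G : Finset (Fin n × Fin n)} {t y : ℝ} (ht : 0 < t) (hy : 1 ≤ y)
    (H : Fin n × Fin n → Bool) {e : Fin n × Fin n} (he : e ∈ G) :
    1 / t * ((if H e = true then 1 else 0)
      - y ^ (-t) * ((if H e = true then 1 else 0) *
          y ^ lineDeg (G.filter fun f => H f = true) (Sum.inl e.1))
      - y ^ (-t) * ((if H e = true then 1 else 0) *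
          y ^ lineDeg (G.filter fun f => H f = true) (Sum.inr e.2)))
      ≤ fracMatching G t H e := by
  have hy0 : 0 < y := by linarith
  by_cases hH : H e = true
  · have key : ∀ l, ¬ (lineDeg (G.filter fun f => H f = true) l : ℝ) ≤ t →
        1 ≤ y ^ (-t) * y ^ lineDeg (G.filter fun f => H f = true) l := fun l hl => by
      rw [← Real.rpow_natCast, ← Real.rpow_add hy0]
      exact Real.one_le_rpow hy (by linarith)
    have pos : ∀ l, 0 ≤ y ^ (-t) * y ^ lineDeg (G.filter fun f => H f = true) l :=
      fun l => by positivity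
    have ht' : 0 < 1 / t := by positivity
    rw [fracMatching]
    simp only [hH, if_true, one_mul]
    have p1 := pos (Sum.inl e.1)
    have p2 := pos (Sum.inr e.2)
    split_ifs with h
    · nlinarith
    · simp only [he, true_and, not_forall] at h
      obtain ⟨l, hl, hlt⟩ := h
      have h1 := key l hlt
      refine mul_nonpos_of_nonneg_of_nonpos ht'.le ?_
      rcases hl with rfl | rfl <;> linarith
  · simpa [hH] using fracMatching_nonneg ht H e

theorem wExp_fracMatching_ge {G : Finset (Fin n × Fin n)} {p D η : ℝ} (hp0 : 0 < p)
    (hp1 : p ≤ 1) (hη0 : 0 < η) (hD : 0 < D)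
    (hbig : 2 * (1 + η) * Real.exp (-(D * p * (η ^ 2 / (η + 2)))) ≤ η)
    (hdeg : ∀ l, (lineDeg G l : ℝ) ≤ D) {e : Fin n × Fin n} (he : e ∈ G) :
    (1 - 2 * η) / D ≤ wExp (powWeight (Fin n × Fin n) (bern p))
      (fun H => fracMatching G ((1 + η) * (D * p)) H e) := by
  have hw := isWeight_bern hp0.le hp1
  set t := (1 + η) * (D * p) with ht_def
  set y := 1 + η with hy_def
  have hy1 : 1 ≤ y := by linarith
  have hy0 : 0 < y := by linarith
  have ht : 0 < t := by positivity
  have hsingle : wExp (powWeight (Fin n × Fin n) (bern p))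
      (fun H => if H e = true then (1 : ℝ) else 0) = p := by
    rw [wExp_powWeight_single hw e (fun b => if b = true then (1 : ℝ) else 0), wExp_bern]
    simp
  have htail : y ^ (-t) * (p * y * Real.exp (p * (y - 1) * D))
      ≤ p * (1 + η) * Real.exp (-(D * p * (η ^ 2 / (η + 2)))) := by
    have hlog : 2 * η / (η + 2) ≤ Real.log y := Real.le_log_one_add_of_nonneg hη0.le
    have h : Real.log y * (-t) + p * (y - 1) * D ≤ -(D * p * (η ^ 2 / (η + 2))) := by
      have h1 : 2 * η / (η + 2) * t ≤ Real.log y * t := by gcongr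
      have h2 : 2 * η / (η + 2) * t = D * p * (η ^ 2 / (η + 2)) + p * η * D := by
        rw [ht_def, hy_def]; field_simp; ring
      have h3 : y - 1 = η := by rw [hy_def]; ring
      rw [h3]; linarith
    rw [Real.rpow_def_of_pos hy0]
    calc _ = p * y * Real.exp (Real.log y * (-t) + p * (y - 1) * D) := by
          rw [Real.exp_add]; ring
      _ ≤ _ := by gcongr
  have h1 := wExp_mono hw.powWeight fun H => fracMatching_ge (G := G) ht hy1 H he
  refine le_trans ?_ h1
  rw [wExp_const_mul, wExp_sub, wExp_sub, wExp_const_mul, wExp_const_mul, hsingle]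
  have a1 := mul_le_mul_of_nonneg_left
    (wExp_mul_pow_lineDeg_le hp0.le hp1 hy1 he (l := Sum.inl e.1) (Or.inl rfl) (hdeg _))
    (Real.rpow_nonneg hy0.le (-t))
  have a2 := mul_le_mul_of_nonneg_left
    (wExp_mul_pow_lineDeg_le hp0.le hp1 hy1 he (l := Sum.inr e.2) (Or.inr rfl) (hdeg _))
    (Real.rpow_nonneg hy0.le (-t))
  have a3 : p * (1 - η) ≤ p - p * (2 * (1 + η) * Real.exp (-(D * p * (η ^ 2 / (η + 2))))) := by
    nlinarith
  calc (1 - 2 * η) / D ≤ 1 / t * (p * (1 - η)) := by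
        rw [ht_def, hy_def, div_mul_eq_mul_div, one_mul, div_le_div_iff₀ hD (by positivity)]
        have : (1 - 2 * η) * (1 + η) ≤ 1 - η := by nlinarith
        have hDp : 0 < D * p := by positivity
        nlinarith
    _ ≤ _ := by
        refine mul_le_mul_of_nonneg_left ?_ (by positivity)
        linarith

/-- If `G` has at most `D` cells on each line and `D * p` is large, then in a random set `H` of
cells there is, on average, a matching inside `G ∩ H` of weight almost `1 / D` times the weight
of `G`. -/
theorem exists_matching_weight_ge {G : Finset (Fin n × Fin n)} {p D η : ℝ} (hp0 : 0 < p)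
    (hp1 : p ≤ 1) (hη0 : 0 < η) (hD : 0 < D)
    (hbig : 2 * (1 + η) * Real.exp (-(D * p * (η ^ 2 / (η + 2)))) ≤ η)
    (hdeg : ∀ l, (lineDeg G l : ℝ) ≤ D) {a : Fin n × Fin n → ℝ} (ha : ∀ e, 0 ≤ a e) :
    ∃ M : (Fin n × Fin n → Bool) → Finset (Fin n × Fin n),
      (∀ H, LineFree (M H) ∧ M H ⊆ G ∧ ∀ e ∈ M H, H e = true) ∧
      (1 - 2 * η) / D * ∑ e ∈ G, a e
        ≤ wExp (powWeight (Fin n × Fin n) (bern p)) (fun H => ∑ e ∈ M H, a e) := by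
  have hw := isWeight_bern hp0.le hp1
  have ht : 0 < (1 + η) * (D * p) := by positivity
  choose M h1 h2 h3 h4 using fun H => exists_matching_ge_fracMatching (G := G) ht H ha
  refine ⟨M, fun H => ⟨h1 H, h2 H, h3 H⟩, le_trans ?_ (wExp_mono hw.powWeight h4)⟩
  rw [wExp_sum, Finset.mul_sum]
  refine Finset.sum_le_sum fun e he => ?_
  rw [wExp_mul_const]
  exact mul_le_mul_of_nonneg_right
    (wExp_fracMatching_ge hp0 hp1 hη0 hD hbig hdeg he) (ha e)

end Grid

theorem wExp_powWeight_succ {X : Type*} [Fintype X] (μ : X → ℝ) {K : ℕ}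
    (f : (Fin (K + 1) → X) → ℝ) :
    wExp (powWeight (Fin (K + 1)) μ) f
      = wExp μ fun x => wExp (powWeight (Fin K) μ) fun ω => f (Fin.cons x ω) := by
  simp only [wExp, Finset.mul_sum]
  rw [← Fintype.sum_prod_type' (f := fun x ω => μ x * (powWeight (Fin K) μ ω * f (Fin.cons x ω)))]
  symm
  refine Fintype.sum_equiv (Fin.consEquiv fun _ => X) _ _ fun ⟨x, ω⟩ => ?_
  simp [powWeight, Fin.consEquiv, Fin.prod_univ_succ, mul_assoc]

section Grid

variable {n : ℕ}

/-- In the cells of `G`, the colors `k` can be assigned to cells of `β k` so that no line sees a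
color twice or a color it is forbidden to see, and each line has at most `Δ` uncolored cells. -/
def PartiallyColorable {K : ℕ} (G : Finset (Fin n × Fin n))
    (F : Fin K → Finset (Fin n ⊕ Fin n)) (β : Fin K → Fin n × Fin n → Bool) (Δ : ℝ) : Prop :=
  ∃ φ : Fin n × Fin n → Option (Fin K),
    (∀ e k, φ e = some k → e ∈ G ∧ β k e = true ∧ ∀ l ∈ F k, ¬ OnLine e l) ∧
    (∀ e e' l k, φ e = some k → φ e' = some k → OnLine e l → OnLine e' l → e = e') ∧
    ∀ l, ((G.filter fun e => OnLine e l ∧ φ e = none).card : ℝ) ≤ Δ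

theorem PartiallyColorable.cons {K : ℕ} {G M : Finset (Fin n × Fin n)}
    {F : Fin (K + 1) → Finset (Fin n ⊕ Fin n)} {β : Fin K → Fin n × Fin n → Bool} {Δ : ℝ}
    {H : Fin n × Fin n → Bool} (hM : LineFree M) (hMG : M ⊆ G) (hMH : ∀ e ∈ M, H e = true)
    (hMF : ∀ e ∈ M, ∀ l ∈ F 0, ¬ OnLine e l)
    (h : PartiallyColorable (G \ M) (fun k => F k.succ) β Δ) :
    PartiallyColorable G F (Fin.cons H β) Δ := by
  obtain ⟨φ, h1, h2, h3⟩ := h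
  refine ⟨fun e => if e ∈ M then some 0 else (φ e).map Fin.succ, ?_, ?_, ?_⟩
  · intro e k hk
    by_cases he : e ∈ M
    · simp only [he, if_true, Option.some.injEq] at hk
      subst hk
      exact ⟨hMG he, hMH e he, hMF e he⟩
    · simp only [he, if_false, Option.map_eq_some_iff] at hk
      obtain ⟨j, hj, rfl⟩ := hk
      obtain ⟨a, b, c⟩ := h1 e j hj
      exact ⟨(Finset.mem_sdiff.1 a).1, by simpa using b, c⟩
  · intro e e' l k hk hk' hl hl'
    by_cases he : e ∈ M <;> by_cases he' : e' ∈ M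
    · exact hM e he e' he' l hl hl'
    · simp only [he, he', if_true, if_false, Option.some.injEq, Option.map_eq_some_iff] at hk hk'
      obtain ⟨j, -, hj⟩ := hk'
      exact absurd (hj.trans hk.symm) (Fin.succ_ne_zero j)
    · simp only [he, he', if_true, if_false, Option.some.injEq, Option.map_eq_some_iff] at hk hk'
      obtain ⟨j, -, hj⟩ := hk
      exact absurd (hj.trans hk'.symm) (Fin.succ_ne_zero j)
    · simp only [he, he', if_false, Option.map_eq_some_iff] at hk hk'
      obtain ⟨j, hj, rfl⟩ := hk
      obtain ⟨j', hj', hjj⟩ := hk'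
      obtain rfl := Fin.succ_injective _ hjj
      exact h2 e e' l _ hj hj' hl hl'
  · intro l
    refine le_trans ?_ (h3 l)
    refine Nat.cast_le.2 (Finset.card_le_card fun e he => ?_)
    simp only [Finset.mem_filter, Finset.mem_sdiff] at he ⊢
    by_cases hM : e ∈ M
    · simp [hM] at he
    · simpa [hM] using he

/-- The number of cells of `G` on the line `l` plus the number of colors forbidden there. -/
def lineLoad {K : ℕ} (G : Finset (Fin n × Fin n)) (F : Fin K → Finset (Fin n ⊕ Fin n))
    (l : Fin n ⊕ Fin n) : ℝ :=
  lineDeg G l + (Finset.univ.filter fun k => l ∈ F k).card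

theorem sum_sum_onLine (G : Finset (Fin n × Fin n)) (u : Fin n ⊕ Fin n → ℝ) :
    ∑ e ∈ G, (u (Sum.inl e.1) + u (Sum.inr e.2)) = ∑ l, u l * lineDeg G l := by
  have h : ∀ l, u l * lineDeg G l = ∑ e ∈ G, if OnLine e l then u l else 0 := fun l => by
    rw [lineDeg, ← Finset.sum_filter, Finset.sum_const, nsmul_eq_mul, mul_comm]
  simp only [h]
  rw [Finset.sum_comm]
  refine Finset.sum_congr rfl fun e _ => ?_
  simp [Fintype.sum_sum_type]

theorem lineDeg_sdiff {G M : Finset (Fin n × Fin n)} (hMG : M ⊆ G) (l : Fin n ⊕ Fin n) :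
    (lineDeg (G \ M) l : ℝ) = lineDeg G l - lineDeg M l := by
  have h : (G \ M).filter (fun e => OnLine e l)
      = G.filter (fun e => OnLine e l) \ M.filter (fun e => OnLine e l) := by
    ext e; simp only [Finset.mem_filter, Finset.mem_sdiff]; tauto
  have h' := Finset.card_sdiff_of_subset (Finset.filter_subset_filter (fun e => OnLine e l) hMG)
  have h'' := Finset.card_le_card (Finset.filter_subset_filter (fun e => OnLine e l) hMG)
  rw [lineDeg, lineDeg, lineDeg, h, h', Nat.cast_sub h'']

theorem LineFree.lineDeg_le_one {M : Finset (Fin n × Fin n)} (hM : LineFree M)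
    (l : Fin n ⊕ Fin n) : lineDeg M l ≤ 1 := by
  rw [lineDeg, Finset.card_le_one]
  intro a ha b hb
  simp only [Finset.mem_filter] at ha hb
  exact hM a ha.1 b hb.1 l ha.2 hb.2

theorem card_filter_succ {K : ℕ} (F : Fin (K + 1) → Finset (Fin n ⊕ Fin n)) (l : Fin n ⊕ Fin n) :
    ((Finset.univ.filter fun k => l ∈ F k).card : ℝ) = (if l ∈ F 0 then 1 else 0)
      + (Finset.univ.filter fun k : Fin K => l ∈ F k.succ).card := by
  simp only [Finset.card_filter, Fin.sum_univ_succ]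
  push_cast
  rfl

/-- Two cells on the same two lines are equal. -/
theorem eq_of_onLine_of_ne {e e' : Fin n × Fin n} {l l' : Fin n ⊕ Fin n} (h : l' ≠ l)
    (h1 : OnLine e l') (h2 : OnLine e' l') (h3 : OnLine e l) (h4 : OnLine e' l) : e = e' := by
  rcases l with r | c <;> rcases l' with r' | c' <;>
    simp only [onLine_inl, onLine_inr] at h1 h2 h3 h4
  · exact absurd (congrArg Sum.inl (h1.symm.trans h3)) h
  · exact Prod.ext (h3.trans h4.symm) (h1.trans h2.symm)
  · exact Prod.ext (h1.trans h2.symm) (h3.trans h4.symm)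
  · exact absurd (congrArg Sum.inr (h1.symm.trans h3)) h

/-- Removing the cells on the lines of `F` removes at most `#F` cells on any other line. -/
theorem lineDeg_sub_card_le (G : Finset (Fin n × Fin n)) (F : Finset (Fin n ⊕ Fin n))
    {l : Fin n ⊕ Fin n} (hl : l ∉ F) :
    (lineDeg G l : ℝ) - F.card ≤ lineDeg (G.filter fun e => ∀ l ∈ F, ¬ OnLine e l) l := by
  set G' := G.filter fun e => ∀ l ∈ F, ¬ OnLine e l with hG'
  have h1 : lineDeg G l = ((G.filter fun e => OnLine e l) \ (G'.filter fun e => OnLine e l)).card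
      + lineDeg G' l := by
    rw [lineDeg, lineDeg, Finset.card_sdiff_add_card_eq_card]
    exact Finset.filter_subset_filter _ (Finset.filter_subset _ _)
  have h2 : ((G.filter fun e => OnLine e l) \ (G'.filter fun e => OnLine e l)).card ≤ F.card := by
    have h3 : ∀ e ∈ (G.filter fun e => OnLine e l) \ (G'.filter fun e => OnLine e l),
        ∃ l' ∈ F, OnLine e l' := fun e he => by
      simp only [hG', Finset.mem_sdiff, Finset.mem_filter] at he
      by_contra! h
      exact he.2 ⟨⟨he.1.1, h⟩, he.1.2⟩
    have : Nonempty (Fin n ⊕ Fin n) := ⟨l⟩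
    choose! g hg1 hg2 using h3
    refine Finset.card_le_card_of_injOn g hg1 ?_
    intro e he e' he' hee
    have a1 := hg2 e he
    have a2 := hg2 e' he'
    have a3 := hg1 e he
    rw [← hee] at a2
    simp only [Finset.coe_sdiff, Set.mem_sdiff, Finset.mem_coe, Finset.mem_filter] at he he'
    have b1 := he.1.2
    have b2 := he'.1.2
    have b3 : g e ≠ l := fun h => hl (h ▸ a3)
    exact eq_of_onLine_of_ne b3 a1 a2 b1 b2
  have h4 : (lineDeg G l : ℝ) = (((G.filter fun e => OnLine e l) \
      (G'.filter fun e => OnLine e l)).card : ℝ) + lineDeg G' l := by exact_mod_cast h1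
  have h5 : (((G.filter fun e => OnLine e l) \
      (G'.filter fun e => OnLine e l)).card : ℝ) ≤ F.card := by exact_mod_cast h2
  linarith

/-- One step of the potential function: `x` is the relative load of a line before the step. -/
theorem exp_load_step {lam D W b x : ℝ} (hlam : 0 ≤ lam) (hW : 0 < W) (hD : W ≤ D - 1)
    (hb : 0 ≤ b) (hx0 : 0 ≤ x) (hx1 : x ≤ 1) :
    Real.exp (lam * (x * D / (D - 1) - 1)) * (1 - (1 - Real.exp (-(lam / (D - 1)))) * (x - b))
      ≤ Real.exp ((lam / W) ^ 2 + lam / W * b) * Real.exp (lam * (x - 1)) := by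
  have hD0 : 0 < D - 1 := by linarith
  set s := lam / (D - 1) with hs
  have hs0 : 0 ≤ s := by positivity
  have hsW : s ≤ lam / W := by rw [hs]; gcongr
  set q := 1 - Real.exp (-s) with hq
  have hq1 : q ≤ s := by have := Real.add_one_le_exp (-s); rw [hq]; linarith
  have hq2 : s - s ^ 2 ≤ q := by
    have h1 : Real.exp (-s) * (1 + s) ≤ 1 := by
      have := Real.add_one_le_exp s
      calc _ ≤ Real.exp (-s) * Real.exp s := by gcongr; linarith
        _ = 1 := by rw [← Real.exp_add]; simp
    have h2 : (1 - Real.exp (-s)) * (1 + s) ≥ s := by linarith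
    have h3 : (s - s ^ 2) * (1 + s) ≤ q * (1 + s) := by
      rw [hq]; nlinarith [pow_nonneg hs0 3]
    exact le_of_mul_le_mul_right h3 (by linarith)
  have h1 : 1 - q * (x - b) ≤ Real.exp (-(q * (x - b))) := by
    have := Real.add_one_le_exp (-(q * (x - b))); linarith
  have h2 : lam * (x * D / (D - 1) - 1) = lam * (x - 1) + s * x := by
    rw [hs]; field_simp; ring
  calc _ ≤ Real.exp (lam * (x * D / (D - 1) - 1)) * Real.exp (-(q * (x - b))) := by gcongr
    _ = Real.exp (lam * (x - 1) + (s * x - q * (x - b))) := by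
        rw [← Real.exp_add, h2]; ring_nf
    _ ≤ Real.exp ((lam / W) ^ 2 + lam / W * b + lam * (x - 1)) := by
        rw [Real.exp_le_exp]
        have a1 : (s - q) * x ≤ s ^ 2 := by nlinarith
        have a2 : s ^ 2 ≤ (lam / W) ^ 2 := by gcongr
        have a3 : q * b ≤ lam / W * b := by gcongr; linarith
        nlinarith
    _ = _ := by rw [Real.exp_add]

/-- The expected potential after one color class has been chosen. -/
theorem wExp_load_step_le {K : ℕ} {G : Finset (Fin n × Fin n)}
    {F : Fin (K + 1) → Finset (Fin n ⊕ Fin n)} {p D η f W lam : ℝ} (hp0 : 0 < p) (hp1 : p ≤ 1)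
    (hη0 : 0 < η) (hη1 : 2 * η ≤ 1) (hW : 0 < W) (hWD : W ≤ D - 1) (hf : 0 ≤ f) (hlam : 0 ≤ lam)
    (hbig : 2 * (1 + η) * Real.exp (-(W * p * (η ^ 2 / (η + 2)))) ≤ η)
    (hF0 : ((F 0).card : ℝ) ≤ f)
    (hFl : ∀ l, ((Finset.univ.filter fun k => l ∈ F k).card : ℝ) ≤ f)
    (hload : ∀ l, lineLoad G F l ≤ D) :
    ∃ M : (Fin n × Fin n → Bool) → Finset (Fin n × Fin n),
      (∀ H, LineFree (M H) ∧ M H ⊆ G ∧ (∀ e ∈ M H, H e = true) ∧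
        ∀ e ∈ M H, ∀ l ∈ F 0, ¬ OnLine e l) ∧
      wExp (powWeight (Fin n × Fin n) (bern p)) (fun H =>
          ∑ l, Real.exp (lam * (lineLoad (G \ M H) (fun k => F k.succ) l / (D - 1) - 1)))
        ≤ Real.exp ((lam / W) ^ 2 + lam / W * (2 * η + 2 * f / W)) *
          ∑ l, Real.exp (lam * (lineLoad G F l / D - 1)) := by
  have hw := (isWeight_bern hp0.le hp1).powWeight (ι := Fin n × Fin n)
  have hD : 0 < D := by linarith
  have hD1 : 0 < D - 1 := by linarith
  set G' := G.filter fun e => ∀ l ∈ F 0, ¬ OnLine e l with hG'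
  have hdegG : ∀ l, (lineDeg G l : ℝ) ≤ D := fun l => by
    refine le_trans ?_ (hload l)
    rw [lineLoad]; simp
  have hdeg : ∀ l, (lineDeg G' l : ℝ) ≤ D := fun l => le_trans
    (Nat.cast_le.2 (Finset.card_le_card (Finset.filter_subset_filter _
      (Finset.filter_subset _ _)))) (hdegG l)
  set u : Fin n ⊕ Fin n → ℝ := fun l => Real.exp (lam * (lineLoad G F l / (D - 1) - 1)) with hu
  have hu0 : ∀ l, 0 ≤ u l := fun l => (Real.exp_pos _).le
  have hbig' : 2 * (1 + η) * Real.exp (-(D * p * (η ^ 2 / (η + 2)))) ≤ η := by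
    refine le_trans ?_ hbig
    gcongr
    linarith
  obtain ⟨M, hM, hMw⟩ := exists_matching_weight_ge (G := G') hp0 hp1 hη0 hD hbig' hdeg
    (a := fun e => u (Sum.inl e.1) + u (Sum.inr e.2)) fun e => add_nonneg (hu0 _) (hu0 _)
  have hMG : ∀ H, M H ⊆ G := fun H => (hM H).2.1.trans (Finset.filter_subset _ _)
  have hMF : ∀ H, ∀ e ∈ M H, ∀ l ∈ F 0, ¬ OnLine e l := fun H e he =>
    (Finset.mem_filter.1 ((hM H).2.1 he)).2
  refine ⟨M, fun H => ⟨(hM H).1, hMG H, (hM H).2.2, hMF H⟩, ?_⟩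
  simp only [sum_sum_onLine] at hMw
  set q := 1 - Real.exp (-(lam / (D - 1))) with hq
  have hq0 : 0 ≤ q := by
    rw [hq, sub_nonneg, Real.exp_le_one_iff, neg_nonpos]
    positivity
  set I : Fin n ⊕ Fin n → ℝ := fun l => if l ∈ F 0 then 1 else 0 with hI
  have hstep : ∀ H l, Real.exp (lam * (lineLoad (G \ M H) (fun k => F k.succ) l / (D - 1) - 1))
      = u l * (1 - q * I l) - q * (u l * lineDeg (M H) l) := by
    intro H l
    have h1 : lineLoad (G \ M H) (fun k => F k.succ) l
        = lineLoad G F l - (I l + lineDeg (M H) l) := by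
      rw [lineLoad, lineLoad, lineDeg_sdiff (hMG H), card_filter_succ]
      ring
    have h2 : lineDeg (M H) l = 0 ∨ (lineDeg (M H) l = 1 ∧ I l = 0) := by
      rcases Nat.le_one_iff_eq_zero_or_eq_one.1 ((hM H).1.lineDeg_le_one l) with h | h
      · exact Or.inl h
      · refine Or.inr ⟨h, if_neg fun hl => ?_⟩
        obtain ⟨e, he⟩ := Finset.card_pos.1 (h ▸ Nat.one_pos : 0 < lineDeg (M H) l)
        rw [Finset.mem_filter] at he
        exact hMF H e he.1 l hl he.2
    have h3 : Real.exp (lam * ((lineLoad G F l - 1) / (D - 1) - 1)) = u l * (1 - q) := by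
      rw [hu, hq, sub_sub_cancel, ← Real.exp_add]
      congr 1
      field_simp
      ring
    rw [h1]
    rcases h2 with h | ⟨h, h'⟩
    · by_cases hl : l ∈ F 0
      · simp only [h, hI, hl, if_true, Nat.cast_zero, add_zero, mul_one, mul_zero, sub_zero, h3]
      · simp [h, hI, hl, hu]
    · simp only [h, h', Nat.cast_one, zero_add, mul_zero, sub_zero, mul_one, h3]
      ring
  simp only [hstep, Finset.sum_sub_distrib, ← Finset.mul_sum]
  rw [wExp_sub, wExp_const hw, wExp_const_mul, Finset.mul_sum]
  have hlow : ∀ l, u l * (lineLoad G F l / D - (2 * η + 2 * f / W))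
      ≤ u l * I l + (1 - 2 * η) / D * (u l * lineDeg G' l) := by
    intro l
    have hf' : 2 * f / D ≤ 2 * f / W := by gcongr; linarith
    have h0 : 0 ≤ 2 * f / W := by positivity
    have h1 : 0 ≤ (1 - 2 * η) / D := div_nonneg (by linarith) hD.le
    have key : lineLoad G F l / D - (2 * η + 2 * f / W)
        ≤ I l + (1 - 2 * η) / D * lineDeg G' l := by
      by_cases hl : l ∈ F 0
      · have h2 : lineLoad G F l / D ≤ 1 := (div_le_one hD).2 (hload l)
        have h3 : (0 : ℝ) ≤ (1 - 2 * η) / D * lineDeg G' l := by positivity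
        simp only [hI, hl, if_true]
        linarith
      · have h2 := lineDeg_sub_card_le G (F 0) hl
        rw [← hG'] at h2
        have h3 : lineLoad G F l - 2 * f ≤ lineDeg G' l := by
          have := hFl l
          rw [lineLoad]; linarith
        have h4 : (lineDeg G' l : ℝ) / D ≤ 1 := (div_le_one hD).2 (hdeg l)
        have h5 : lineLoad G F l / D - 2 * f / D ≤ lineDeg G' l / D := by
          rw [← sub_div]; gcongr
        have h6 : (1 - 2 * η) / D * lineDeg G' l
            = lineDeg G' l / D - 2 * η * (lineDeg G' l / D) := by ring
        rw [h6]
        simp only [hI, hl, if_false]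
        nlinarith
    have := mul_le_mul_of_nonneg_left key (hu0 l)
    linarith
  have hlow' := Finset.sum_le_sum fun l (_ : l ∈ Finset.univ) => hlow l
  rw [Finset.sum_add_distrib, ← Finset.mul_sum] at hlow'
  have hfin : ∀ l, u l * (1 - q * (lineLoad G F l / D - (2 * η + 2 * f / W)))
      ≤ Real.exp ((lam / W) ^ 2 + lam / W * (2 * η + 2 * f / W)) *
          Real.exp (lam * (lineLoad G F l / D - 1)) := fun l => by
    have h0 : 0 ≤ lineLoad G F l := by rw [lineLoad]; positivity
    have := exp_load_step (x := lineLoad G F l / D) (b := 2 * η + 2 * f / W) hlam hW hWD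
      (by positivity) (by positivity) ((div_le_one hD).2 (hload l))
    rwa [div_mul_cancel₀ _ hD.ne'] at this
  refine le_trans ?_ (Finset.sum_le_sum fun l (_ : l ∈ Finset.univ) => hfin l)
  have e1 : ∑ l, u l * (1 - q * I l) = ∑ l, u l - q * ∑ l, u l * I l := by
    rw [Finset.mul_sum, ← Finset.sum_sub_distrib]
    exact Finset.sum_congr rfl fun l _ => by ring
  have e2 : ∑ l, u l * (1 - q * (lineLoad G F l / D - (2 * η + 2 * f / W)))
      = ∑ l, u l - q * ∑ l, u l * (lineLoad G F l / D - (2 * η + 2 * f / W)) := by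
    rw [Finset.mul_sum, ← Finset.sum_sub_distrib]
    exact Finset.sum_congr rfl fun l _ => by ring
  rw [e1, e2]
  nlinarith [mul_le_mul_of_nonneg_left hlow' hq0, mul_le_mul_of_nonneg_left hMw hq0]

/-- Choosing the color classes one at a time fails to color almost all of `G` with probability
bounded by the initial potential. -/
theorem wPr_not_partiallyColorable_le {p η f W lam : ℝ} (hp0 : 0 < p) (hp1 : p ≤ 1)
    (hη0 : 0 < η) (hη1 : 2 * η ≤ 1) (hW : 0 < W) (hf : 0 ≤ f) (hlam : 0 ≤ lam)
    (hbig : 2 * (1 + η) * Real.exp (-(W * p * (η ^ 2 / (η + 2)))) ≤ η) {K : ℕ} :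
    ∀ {D : ℝ} {G : Finset (Fin n × Fin n)} {F : Fin K → Finset (Fin n ⊕ Fin n)},
    W ≤ D - K → (∀ k, ((F k).card : ℝ) ≤ f) →
    (∀ l, ((Finset.univ.filter fun k => l ∈ F k).card : ℝ) ≤ f) →
    wPr (powWeight (Fin K) (powWeight (Fin n × Fin n) (bern p)))
        (fun β => ¬ PartiallyColorable G F β (D - K))
      ≤ Real.exp ((lam / W) ^ 2 + lam / W * (2 * η + 2 * f / W)) ^ K *
        ∑ l, Real.exp (lam * (lineLoad G F l / D - 1)) := by
  have hw := (isWeight_bern hp0.le hp1).powWeight (ι := Fin n × Fin n)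
  set g := Real.exp ((lam / W) ^ 2 + lam / W * (2 * η + 2 * f / W)) with hg
  have hg1 : 1 ≤ g := Real.one_le_exp (by positivity)
  have hlarge : ∀ {K : ℕ} {D : ℝ} {G : Finset (Fin n × Fin n)}
      {F : Fin K → Finset (Fin n ⊕ Fin n)}, 0 < D → (∃ l, D < lineLoad G F l) →
      wPr (powWeight (Fin K) (powWeight (Fin n × Fin n) (bern p)))
        (fun β => ¬ PartiallyColorable G F β (D - K))
      ≤ g ^ K * ∑ l, Real.exp (lam * (lineLoad G F l / D - 1)) := by
    rintro K D G F hD ⟨l, hl⟩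
    refine (wPr_le_one hw.powWeight _).trans ?_
    have h1 : 1 ≤ Real.exp (lam * (lineLoad G F l / D - 1)) :=
      Real.one_le_exp (mul_nonneg hlam (by rw [sub_nonneg, one_le_div hD]; exact hl.le))
    have h2 := Finset.single_le_sum (f := fun l => Real.exp (lam * (lineLoad G F l / D - 1)))
      (fun l _ => (Real.exp_pos _).le) (Finset.mem_univ l)
    exact one_le_mul_of_one_le_of_one_le (one_le_pow₀ hg1) (h1.trans h2)
  induction K with
  | zero =>
    intro D G F hWD hFc hFl
    have hD : 0 < D := by simp at hWD; linarith
    by_cases hl : ∃ l, D < lineLoad G F l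
    · exact hlarge hD hl
    · push Not at hl
      have : ∀ β, PartiallyColorable G F β (D - (0 : ℕ)) := fun β => by
        refine ⟨fun _ => none, by simp, by simp, fun l => ?_⟩
        simpa [lineLoad, lineDeg] using hl l
      simp only [this, not_true, wPr, if_false, wExp, mul_zero, Finset.sum_const_zero]
      positivity
  | succ K ih =>
    intro D G F hWD hFc hFl
    push_cast at hWD
    have hK : (0 : ℝ) ≤ K := Nat.cast_nonneg K
    have hD : 0 < D := by linarith
    by_cases hl : ∃ l, D < lineLoad G F l
    · exact hlarge hD hl
    push Not at hl
    obtain ⟨M, hM, hMw⟩ := wExp_load_step_le (F := F) hp0 hp1 hη0 hη1 hW (by linarith) hf hlam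
      hbig (hFc 0) hFl hl
    rw [wPr, wExp_powWeight_succ]
    have hrec : ∀ H, wPr (powWeight (Fin K) (powWeight (Fin n × Fin n) (bern p)))
        (fun β => ¬ PartiallyColorable G F (Fin.cons H β) (D - (K + 1 : ℕ)))
        ≤ g ^ K * ∑ l, Real.exp (lam *
            (lineLoad (G \ M H) (fun k => F k.succ) l / (D - 1) - 1)) := fun H => by
      have hWD' : W ≤ D - 1 - K := by linarith
      refine le_trans (wPr_mono hw.powWeight ?_)
        (ih (D := D - 1) (G := G \ M H) (F := fun k => F k.succ) hWD'
          (fun k => hFc k.succ) fun l => ?_)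
      · intro β hβ h
        refine hβ ?_
        have := PartiallyColorable.cons (hM H).1 (hM H).2.1 (hM H).2.2.1 (hM H).2.2.2 h
        convert this using 1
        push_cast; ring
      · refine le_trans ?_ (hFl l)
        rw [card_filter_succ]
        split_ifs <;> simp
    refine (wExp_mono hw hrec).trans ?_
    rw [wExp_const_mul, pow_succ, mul_assoc]
    exact mul_le_mul_of_nonneg_left hMw (by positivity)

end Grid

section Grid

variable {n b : ℕ}

theorem card_filter_shareLine_le {G : Finset (Fin n × Fin n)} {P Q : Fin n × Fin n → Prop}
    {_ : DecidablePred Q} {dP : ∀ l, DecidablePred fun e => OnLine e l ∧ P e} {v : Fin n × Fin n} {B : ℝ}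
    (hQ : ∀ e ∈ G, Q e → ∃ l, OnLine v l ∧ OnLine e l ∧ P e)
    (h : ∀ l, OnLine v l → ((G.filter fun e => OnLine e l ∧ P e).card : ℝ) ≤ B) :
    ((G.filter Q).card : ℝ) ≤ 2 * B := by
  have h1 : G.filter Q ⊆ (G.filter fun e => OnLine e (Sum.inl v.1) ∧ P e) ∪
      G.filter fun e => OnLine e (Sum.inr v.2) ∧ P e := by
    intro e he
    rw [Finset.mem_filter] at he
    obtain ⟨l, hl, hel, hP⟩ := hQ e he.1 he.2
    rw [Finset.mem_union, Finset.mem_filter, Finset.mem_filter]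
    rcases hl with rfl | rfl
    · exact Or.inl ⟨he.1, hel, hP⟩
    · exact Or.inr ⟨he.1, hel, hP⟩
  have h2 : ((G.filter Q).card : ℝ) ≤ (G.filter fun e => OnLine e (Sum.inl v.1) ∧ P e).card +
      (G.filter fun e => OnLine e (Sum.inr v.2) ∧ P e).card := by
    exact_mod_cast (Finset.card_le_card h1).trans (Finset.card_union_le _ _)
  linarith [h _ (Or.inl rfl), h _ (Or.inr rfl)]

/-- Three colors can be reserved for each cell of `Y`, without conflicts. -/
theorem exists_reserved_colors [Nonempty (Fin n)] {Y Z : Finset (Fin n × Fin n)} (hYZ : Y ⊆ Z)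
    {a : Fin n × Fin n → Fin n → Bool} {ℓ d : ℝ} (hℓ : 0 < ℓ) (hd : 24 * d ≤ ℓ)
    (hY : ∀ e ∈ Y, ℓ ≤ (Finset.univ.filter fun k => a e k = true).card)
    (hZ : ∀ l k, ((Z.filter fun e => OnLine e l ∧ a e k = true).card : ℝ) ≤ d) :
    ∃ ψ : Fin n × Fin n → Fin 3 → Fin n, (∀ e ∈ Y, ∀ i, a e (ψ e i) = true) ∧
      ∀ e ∈ Y, ∀ e' ∈ Y, ∀ i j l, OnLine e l → OnLine e' l → ψ e i = ψ e' j →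
        e = e' ∧ i = j := by
  obtain ⟨f, hf1, hf2⟩ := exists_list_coloring (V := (Fin n × Fin n) × Fin 3) (C := Fin n)
    (S := Y ×ˢ Finset.univ)
    (adj := fun x y => x ≠ y ∧ ∃ l, OnLine x.1 l ∧ OnLine y.1 l)
    (L := fun x => Finset.univ.filter fun k => a x.1 k = true)
    (fun u v ⟨h, l, h1, h2⟩ => ⟨h.symm, l, h2, h1⟩) (fun v h => h.1 rfl) hℓ
    (D := 6 * d) (by linarith) (fun v hv => hY v.1 (Finset.mem_product.1 hv).1) (by
      rintro ⟨e, i⟩ hv c hc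
      have h1 : ((Y.filter fun e' => (∃ l, OnLine e l ∧ OnLine e' l) ∧ a e' c = true).card : ℝ)
          ≤ 2 * d := by
        refine card_filter_shareLine_le (v := e) (P := fun e' => a e' c = true) ?_ fun l _ =>
          le_trans (Nat.cast_le.2 (Finset.card_le_card (Finset.filter_subset_filter _ hYZ)))
            (hZ l c)
        rintro e' - ⟨⟨l, h1, h2⟩, h3⟩
        exact ⟨l, h1, h2, h3⟩
      refine le_trans (Nat.cast_le.2 (Finset.card_le_card (t := (Y.filter fun e' =>
        (∃ l, OnLine e l ∧ OnLine e' l) ∧ a e' c = true) ×ˢ Finset.univ) fun u hu => ?_)) ?_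
      · simp only [Finset.mem_filter, Finset.mem_product, Finset.mem_univ, true_and,
          and_true] at hu ⊢
        exact ⟨hu.1, hu.2.1.2, hu.2.2⟩
      rw [Finset.card_product]
      push_cast
      rw [Finset.card_univ, Fintype.card_fin]
      push_cast
      linarith)
  refine ⟨fun e i => f (e, i), fun e he i => ?_, fun e he e' he' i j l h1 h2 h => ?_⟩
  · have := hf1 (e, i) (Finset.mem_product.2 ⟨he, Finset.mem_univ _⟩)
    simpa using this
  · by_contra hne
    refine hf2 (e, i) (Finset.mem_product.2 ⟨he, Finset.mem_univ _⟩) (e', j)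
      (Finset.mem_product.2 ⟨he', Finset.mem_univ _⟩) ⟨?_, l, h1, h2⟩ h
    rw [Ne, Prod.ext_iff]
    exact hne

/-- A proper coloring of the grid in which the cell `e` gets a color allowed by `X`. -/
def HasProperColoring {C : Type*} (X : Fin n × Fin n → C → Bool) : Prop :=
  ∃ χ : Fin n × Fin n → C, (∀ e, X e (χ e) = true) ∧
    ∀ e f l, OnLine e l → OnLine f l → χ e = χ f → e = f

/-- Among three distinct colors, one avoids the colors seen on the two lines of a cell. -/
theorem exists_avoiding {C : Type*} {S : Finset (Fin n × Fin n)} {σ : Fin n × Fin n → C}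
    (hS : ∀ s ∈ S, ∀ s' ∈ S, ∀ l, OnLine s l → OnLine s' l → s = s') {g : Fin 3 → C}
    (hg : Function.Injective g) (e : Fin n × Fin n) :
    ∃ i, ∀ s ∈ S, ∀ l, OnLine e l → OnLine s l → g i ≠ σ s := by
  by_contra! h
  choose s hs l hl hsl hgs using h
  have hpig : ∃ i j, i ≠ j ∧ l i = l j := by
    have hcard : (Finset.univ.image l).card < (Finset.univ : Finset (Fin 3)).card := by
      have : Finset.univ.image l ⊆ {Sum.inl e.1, Sum.inr e.2} := by
        intro x hx
        simp only [Finset.mem_image, Finset.mem_univ, true_and] at hx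
        obtain ⟨i, rfl⟩ := hx
        simpa [OnLine] using hl i
      refine (Finset.card_le_card this).trans_lt ?_
      rw [Finset.card_univ, Fintype.card_fin]
      exact Finset.card_le_two.trans_lt (by norm_num)
    obtain ⟨i, -, j, -, hij, h⟩ := Finset.exists_ne_map_eq_of_card_lt_of_maps_to hcard
      (f := l) (fun i _ => Finset.mem_coe.2 (Finset.mem_image_of_mem l (Finset.mem_univ i)))
    exact ⟨i, j, hij, h⟩
  obtain ⟨i, j, hij, h⟩ := hpig
  refine hij (hg ?_)
  rw [hgs i, hgs j, hS _ (hs i) _ (hs j) (l j) (h ▸ hsl i) (hsl j)]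

/-- The lines on which the color `k` is reserved. -/
def reservedLines (Y : Finset (Fin n × Fin n)) (ψ : Fin n × Fin n → Fin 3 → Fin n) (k : Fin n) :
    Finset (Fin n ⊕ Fin n) :=
  Finset.univ.filter fun l => ∃ e ∈ Y, OnLine e l ∧ ∃ i, ψ e i = k

/-- The cells of `l` outside `Z` that may have to use a color in `Fin b`. -/
def sparseCells (Z S : Finset (Fin n × Fin n)) (φ : Fin n × Fin n → Option (Fin n))
    (l : Fin n ⊕ Fin n) : Finset (Fin n × Fin n) :=
  Finset.univ.filter fun e => e ∉ Z ∧ OnLine e l ∧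
    (φ e = none ∨ ∃ k, k ≠ l ∧ OnLine e k ∧ ∃ s ∈ S, OnLine s k)

/-- The deterministic completion step. -/
theorem hasProperColoring_of_partial [Nonempty (Fin b)] {Z S : Finset (Fin n × Fin n)}
    (hSZ : S ⊆ Z) {X X' : Fin n × Fin n → Fin n ⊕ Fin b → Bool}
    (hXX' : ∀ e c, X e c = true → X' e c = true) (hshaft : ∀ e, ∃ c, X' e c = true)
    {ℓ d : ℝ} (hd : 1 ≤ d) (hℓ : 32 * d ≤ ℓ)
    (hZB : ∀ e ∉ Z, ℓ ≤ (Finset.univ.filter fun k => X e (Sum.inr k) = true).card)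
    (hS : ∀ s ∈ S, ∀ s' ∈ S, ∀ l, OnLine s l → OnLine s' l → s = s')
    {ψ : Fin n × Fin n → Fin 3 → Fin n}
    (hψ : ∀ e ∈ Z \ S, ∀ i, X e (Sum.inl (ψ e i)) = true)
    (hψ' : ∀ e ∈ Z \ S, ∀ e' ∈ Z \ S, ∀ i j l, OnLine e l → OnLine e' l → ψ e i = ψ e' j →
      e = e' ∧ i = j)
    {φ : Fin n × Fin n → Option (Fin n)}
    (hφ : ∀ e k, φ e = some k → e ∈ Zᶜ ∧ X e (Sum.inl k) = true ∧
      ∀ l ∈ reservedLines (Z \ S) ψ k, ¬ OnLine e l)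
    (hφ' : ∀ e e' l k, φ e = some k → φ e' = some k → OnLine e l → OnLine e' l → e = e')
    (hsp : ∀ l k, (((sparseCells Z S φ l).filter fun e => X e (Sum.inr k) = true).card : ℝ) ≤ d) :
    HasProperColoring X' := by
  choose σ hσ using hshaft
  -- cells outside `Z` whose color collides with the color of a cell of `S`
  set U : Finset (Fin n × Fin n) := Finset.univ.filter fun e => e ∉ Z ∧ (φ e = none ∨
    ∃ k, φ e = some k ∧ ∃ s ∈ S, ∃ l, OnLine e l ∧ OnLine s l ∧ σ s = Sum.inl k) with hU
  set L : Fin n × Fin n → Finset (Fin b) := fun e => Finset.univ.filter fun k =>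
    X e (Sum.inr k) = true ∧ ∀ s ∈ S, ∀ l, OnLine e l → OnLine s l → Sum.inr k ≠ σ s with hL
  obtain ⟨ρ, hρ1, hρ2⟩ : ∃ ρ : Fin n × Fin n → Fin b, (∀ e ∈ U, ρ e ∈ L e) ∧
      ∀ e ∈ U, ∀ e' ∈ U, (e ≠ e' ∧ ∃ l, OnLine e l ∧ OnLine e' l) → ρ e ≠ ρ e' := by
    refine exists_list_coloring (S := U) (L := L)
      (adj := fun e e' => e ≠ e' ∧ ∃ l, OnLine e l ∧ OnLine e' l)
      (fun u v ⟨h, l, h1, h2⟩ => ⟨h.symm, l, h2, h1⟩) (fun v h => h.1 rfl)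
      (ℓ := ℓ - 2) (D := 2 * (d + 1)) (by linarith) (by linarith) ?_ ?_
    · intro e he
      have heZ : e ∉ Z := (Finset.mem_filter.1 he).2.1
      set R : Finset (Fin b) := Finset.univ.filter fun k =>
        ∃ s ∈ S, ∃ l, OnLine e l ∧ OnLine s l ∧ Sum.inr k = σ s with hR
      have hR2 : R.card ≤ 2 := by
        by_contra! hcon
        obtain ⟨x, y, z, hx, hy, hz, hxy, hxz, hyz⟩ := Finset.two_lt_card_iff.1 hcon
        obtain ⟨i, hi⟩ := exists_avoiding (σ := σ) hS (g := ![Sum.inr x, Sum.inr y, Sum.inr z])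
          (by
            intro i j
            fin_cases i <;> fin_cases j <;> simp [hxy, hxz, hyz, hxy.symm, hxz.symm, hyz.symm]) e
        simp only [hR, Finset.mem_filter, Finset.mem_univ, true_and] at hx hy hz
        obtain ⟨sx, hsx, lx, hx1, hx2, hx3⟩ := hx
        obtain ⟨sy, hsy, ly, hy1, hy2, hy3⟩ := hy
        obtain ⟨sz, hsz, lz, hz1, hz2, hz3⟩ := hz
        fin_cases i
        · exact hi sx hsx lx hx1 hx2 hx3
        · exact hi sy hsy ly hy1 hy2 hy3
        · exact hi sz hsz lz hz1 hz2 hz3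
      have hsub : (Finset.univ.filter fun k => X e (Sum.inr k) = true) \ R ⊆ L e := by
        intro k hk
        simp only [hR, hL, Finset.mem_sdiff, Finset.mem_filter, Finset.mem_univ, true_and] at hk ⊢
        exact ⟨hk.1, fun s hs l h1 h2 h3 => hk.2 ⟨s, hs, l, h1, h2, h3⟩⟩
      have h1 := Finset.card_le_card hsub
      have h2 := Finset.le_card_sdiff R (Finset.univ.filter fun k => X e (Sum.inr k) = true)
      have h3 := hZB e heZ
      have h4 : ((Finset.univ.filter fun k => X e (Sum.inr k) = true).card : ℝ)
          ≤ (L e).card + 2 := by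
        have : (Finset.univ.filter fun k => X e (Sum.inr k) = true).card ≤ (L e).card + 2 := by
          omega
        exact_mod_cast this
      linarith
    · intro e he c hc
      refine card_filter_shareLine_le (v := e) (P := fun e' => X e' (Sum.inr c) = true)
        (dP := fun _ _ => inferInstance) ?_ ?_
      · rintro e' - ⟨⟨-, l, h1, h2⟩, h3⟩
        exact ⟨l, h1, h2, (Finset.mem_filter.1 h3).2.1⟩
      · intro l _
        -- the cells that are not sparse share the color of the cell of `S` on `l`
        set K : Finset (Fin n × Fin n) := Finset.univ.filter fun e' => OnLine e' l ∧
          ∃ k, φ e' = some k ∧ ∃ s ∈ S, OnLine s l ∧ σ s = Sum.inl k with hK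
        have hK1 : K.card ≤ 1 := by
          rw [Finset.card_le_one]
          intro x hx y hy
          simp only [hK, Finset.mem_filter, Finset.mem_univ, true_and] at hx hy
          obtain ⟨hxl, k, hk, s, hs, hsl, hsk⟩ := hx
          obtain ⟨hyl, k', hk', s', hs', hsl', hsk'⟩ := hy
          obtain rfl := hS s hs s' hs' l hsl hsl'
          rw [hsk, Sum.inl.injEq] at hsk'
          subst hsk'
          exact hφ' x y l k hk hk' hxl hyl
        have hsub : (U.filter fun e' => OnLine e' l ∧ X e' (Sum.inr c) = true) ⊆
            ((sparseCells Z S φ l).filter fun e => X e (Sum.inr c) = true) ∪ K := by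
          intro x hx
          simp only [hU, hK, sparseCells, Finset.mem_union, Finset.mem_filter, Finset.mem_univ,
            true_and] at hx ⊢
          obtain ⟨⟨hxZ, hx⟩, hxl, hxc⟩ := hx
          rcases hx with hx | ⟨k, hk, s, hs, l', h1, h2, h3⟩
          · exact Or.inl ⟨⟨hxZ, hxl, Or.inl hx⟩, hxc⟩
          · by_cases hl : l' = l
            · subst hl
              exact Or.inr ⟨hxl, k, hk, s, hs, h2, h3⟩
            · exact Or.inl ⟨⟨hxZ, hxl, Or.inr ⟨l', hl, h1, s, hs, h2⟩⟩, hxc⟩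
        have h1 := (Finset.card_le_card hsub).trans (Finset.card_union_le _ _)
        have h2 : ((U.filter fun e' => OnLine e' l ∧ X e' (Sum.inr c) = true).card : ℝ) ≤
            ((sparseCells Z S φ l).filter fun e => X e (Sum.inr c) = true).card + 1 := by
          exact_mod_cast h1.trans (Nat.add_le_add_left hK1 _)
        linarith [hsp l c]
  -- the reserved color used by a cell of `Z \ S`
  have hτ : ∀ e ∈ Z \ S, ∃ i, ∀ s ∈ S, ∀ l, OnLine e l → OnLine s l →
      (Sum.inl (ψ e i) : Fin n ⊕ Fin b) ≠ σ s := fun e he =>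
    exists_avoiding hS (g := fun i => Sum.inl (ψ e i))
      (fun i j h => (hψ' e he e he i j _ (Or.inl rfl) (Or.inl rfl) (Sum.inl.inj h)).2) e
  choose! τ hτ using hτ
  have hmain : ∀ e, ∃ c, (e ∈ S ∧ c = σ e) ∨ (e ∈ Z \ S ∧ c = Sum.inl (ψ e (τ e))) ∨
      (e ∉ U ∧ e ∉ Z ∧ ∃ k, φ e = some k ∧ c = Sum.inl k) ∨ (e ∈ U ∧ c = Sum.inr (ρ e)) := by
    intro e
    by_cases h1 : e ∈ S
    · exact ⟨_, Or.inl ⟨h1, rfl⟩⟩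
    by_cases h2 : e ∈ Z
    · exact ⟨_, Or.inr (Or.inl ⟨Finset.mem_sdiff.2 ⟨h2, h1⟩, rfl⟩)⟩
    by_cases h3 : e ∈ U
    · exact ⟨_, Or.inr (Or.inr (Or.inr ⟨h3, rfl⟩))⟩
    · rcases h : φ e with _ | k
      · exact absurd (Finset.mem_filter.2 ⟨Finset.mem_univ _, h2, Or.inl h⟩) h3
      · exact ⟨_, Or.inr (Or.inr (Or.inl ⟨h3, h2, k, rfl, rfl⟩))⟩
  choose χ hχ using hmain
  have hUZ : ∀ e ∈ U, e ∉ Z := fun e he => (Finset.mem_filter.1 he).2.1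
  refine ⟨χ, fun e => ?_, ?_⟩
  · rcases hχ e with ⟨-, h⟩ | ⟨h', h⟩ | ⟨-, -, k, hk, h⟩ | ⟨h', h⟩ <;> rw [h]
    · exact hσ e
    · exact hXX' _ _ (hψ e h' _)
    · exact hXX' _ _ (hφ e k hk).2.1
    · exact hXX' _ _ (Finset.mem_filter.1 (hρ1 e h')).2.1
  · -- a cell of `S` never collides with a cell of another type
    have hSany : ∀ e e' l, OnLine e l → OnLine e' l → χ e = χ e' → e ∈ S → e = e' := by
      intro e e' l hl hl' h he
      have h0 : χ e = σ e := by
        rcases hχ e with ⟨-, h⟩ | ⟨h', h⟩ | ⟨-, hZ, -⟩ | ⟨h', h⟩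
        · exact h
        · exact absurd he (Finset.mem_sdiff.1 h').2
        · exact absurd (hSZ he) hZ
        · exact absurd (hSZ he) (hUZ e h')
      rcases hχ e' with ⟨h', -⟩ | ⟨h', h''⟩ | ⟨hnU, hZ, k, hk, h''⟩ | ⟨h', h''⟩
      · exact hS e he e' h' l hl hl'
      · exact absurd (h''.symm.trans (h.symm.trans h0)) (hτ e' h' e he l hl' hl)
      · refine absurd (Finset.mem_filter.2 ⟨Finset.mem_univ _, hZ, Or.inr ⟨k, hk, e, he, l, hl',
          hl, ?_⟩⟩) hnU
        rw [← h0, h, h'']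
      · exact absurd (h''.symm.trans (h.symm.trans h0))
          ((Finset.mem_filter.1 (hρ1 e' h')).2.2 e he l hl' hl)
    -- a reserved color never collides with a color chosen by `φ`
    have hres : ∀ e e' l k, OnLine e l → OnLine e' l → e ∈ Z \ S → φ e' = some k →
        ψ e (τ e) ≠ k := by
      intro e e' l k hl hl' he hk h
      exact (hφ e' k hk).2.2 l (Finset.mem_filter.2 ⟨Finset.mem_univ _, e, he, hl, _, h⟩) hl'
    intro e e' l hl hl' h
    rcases hχ e with ⟨h1, -⟩ | ⟨h1, h2⟩ | ⟨-, -, k, h1, h2⟩ | ⟨h1, h2⟩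
    · exact hSany e e' l hl hl' h h1
    · rcases hχ e' with ⟨h3, -⟩ | ⟨h3, h4⟩ | ⟨-, -, k', h3, h4⟩ | ⟨h3, h4⟩
      · exact (hSany e' e l hl' hl h.symm h3).symm
      · rw [h2, h4] at h
        exact (hψ' e h1 e' h3 _ _ l hl hl' (Sum.inl.inj h)).1
      · rw [h2, h4] at h
        exact absurd (Sum.inl.inj h) (hres e e' l k' hl hl' h1 h3)
      · rw [h2, h4] at h
        exact absurd h (by simp)
    · rcases hχ e' with ⟨h3, -⟩ | ⟨h3, h4⟩ | ⟨-, -, k', h3, h4⟩ | ⟨h3, h4⟩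
      · exact (hSany e' e l hl' hl h.symm h3).symm
      · rw [h2, h4] at h
        exact absurd (Sum.inl.inj h).symm (hres e' e l k hl' hl h3 h1)
      · rw [h2, h4] at h
        obtain rfl := Sum.inl.inj h
        exact hφ' e e' l k h1 h3 hl hl'
      · rw [h2, h4] at h
        exact absurd h (by simp)
    · rcases hχ e' with ⟨h3, -⟩ | ⟨h3, h4⟩ | ⟨-, -, k', h3, h4⟩ | ⟨h3, h4⟩
      · exact (hSany e' e l hl' hl h.symm h3).symm
      · rw [h2, h4] at h
        exact absurd h (by simp)
      · rw [h2, h4] at h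
        exact absurd h (by simp)
      · rw [h2, h4] at h
        by_contra hne
        exact hρ2 e h1 e' h3 ⟨hne, l, hl, hl'⟩ (Sum.inr.inj h)

end Grid

/-- The product of two weight functions. -/
def prodWeight {X Y : Type*} (μ : X → ℝ) (ν : Y → ℝ) : X × Y → ℝ := fun x => μ x.1 * ν x.2

section ProductWeights

variable {X Y ι : Type*} [Fintype X] [Fintype Y] [Fintype ι] [DecidableEq ι] {μ : X → ℝ} {ν : Y → ℝ}

theorem wExp_prodWeight (f : X × Y → ℝ) :
    wExp (prodWeight μ ν) f = wExp μ fun x => wExp ν fun y => f (x, y) := by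
  simp only [wExp, prodWeight, Fintype.sum_prod_type, Finset.mul_sum, mul_assoc]

theorem wExp_prodWeight' (f : X × Y → ℝ) :
    wExp (prodWeight μ ν) f = wExp ν fun y => wExp μ fun x => f (x, y) := by
  rw [wExp_prodWeight, wExp_comm]

theorem IsWeight.prodWeight (hμ : IsWeight μ) (hν : IsWeight ν) : IsWeight (prodWeight μ ν) := by
  refine ⟨fun x => mul_nonneg (hμ.1 _) (hν.1 _), ?_⟩
  have h := wExp_prodWeight (μ := μ) (ν := ν) (fun _ => 1)
  rw [wExp_const hν, wExp_const hμ] at h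
  simpa [wExp] using h

theorem wPr_prodWeight_le (hμ : IsWeight μ) {Q : X × Y → Prop} {c : ℝ}
    (h : ∀ x, wPr ν (fun y => Q (x, y)) ≤ c) : wPr (prodWeight μ ν) Q ≤ c := by
  rw [wPr, wExp_prodWeight]
  exact (wExp_mono hμ h).trans (wExp_const hμ c).le

theorem wPr_prodWeight_le' (hν : IsWeight ν) {Q : X × Y → Prop} {c : ℝ}
    (h : ∀ y, wPr μ (fun x => Q (x, y)) ≤ c) : wPr (prodWeight μ ν) Q ≤ c := by
  rw [wPr, wExp_prodWeight']
  exact (wExp_mono hν h).trans (wExp_const hν c).le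

theorem wPr_prodWeight_and (Q : X → Prop) (R : Y → Prop) :
    wPr (prodWeight μ ν) (fun x => Q x.1 ∧ R x.2) = wPr μ Q * wPr ν R := by
  rw [wPr, wExp_prodWeight, wPr, wPr, ← wExp_mul_const]
  congr 1
  ext x
  rw [← wExp_const_mul]
  congr 1
  ext y
  by_cases h1 : Q x <;> by_cases h2 : R y <;> simp [h1, h2]

/-- Two coordinates of a product are independent. -/
theorem wPr_powWeight_and (hμ : IsWeight μ) {i j : ι} (hij : i ≠ j) (Q : X → Prop) :
    wPr (powWeight ι μ) (fun ω => Q (ω i) ∧ Q (ω j)) = wPr μ Q ^ 2 := by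
  have h := wExp_powWeight_prod_finset hμ {i, j} (fun _ x => if Q x then 1 else 0)
  simp only [Finset.prod_pair hij] at h
  rw [sq, wPr, wPr, ← h]
  congr 1
  ext ω
  by_cases h1 : Q (ω i) <;> by_cases h2 : Q (ω j) <;> simp [h1, h2]

/-- Resampling the coordinates outside `s` does not change the distribution. -/
theorem wExp_powWeight_piecewise (hμ : IsWeight μ) (s : Finset ι) (f : (ι → X) → ℝ) :
    wExp (powWeight ι μ) f = wExp (powWeight ι μ) fun ω => wExp (powWeight ι μ) fun ω' =>
      f (fun i => if i ∈ s then ω i else ω' i) := by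
  have hf : ∀ ω, f ω = ∑ x : ι → X, f x * ∏ i, if ω i = x i then 1 else 0 := fun ω => by
    have h : ∀ x : ι → X, (∏ i, if ω i = x i then (1 : ℝ) else 0) = if ω = x then 1 else 0 :=
      fun x => by rw [Finset.prod_boole]; simp [funext_iff]
    simp [h]
  have hg : ∀ ω ω' : ι → X, f (fun i => if i ∈ s then ω i else ω' i) = ∑ x : ι → X, f x *
      ((∏ i, if i ∈ s then (if ω i = x i then 1 else 0) else 1) *
        ∏ i, if i ∈ s then 1 else if ω' i = x i then 1 else 0) := fun ω ω' => by
    rw [hf]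
    refine Finset.sum_congr rfl fun x _ => ?_
    rw [← Finset.prod_mul_distrib]
    congr 1
    refine Finset.prod_congr rfl fun i _ => ?_
    by_cases hi : i ∈ s <;> simp [hi]
  have hpt : ∀ x, wExp μ (fun y => if y = x then 1 else 0) = μ x := fun x => by simp [wExp]
  simp only [hg]
  simp only [wExp_sum, wExp_const_mul, wExp_mul_const]
  rw [wExp]
  refine Finset.sum_congr rfl fun x _ => ?_
  rw [wExp_powWeight_prod (fun i y => if i ∈ s then (if y = x i then 1 else 0) else 1),
    wExp_powWeight_prod (fun i y => if i ∈ s then 1 else if y = x i then 1 else 0),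
    ← Finset.prod_mul_distrib, powWeight, mul_comm]
  congr 1
  refine Finset.prod_congr rfl fun i _ => ?_
  by_cases hi : i ∈ s <;> simp [hi, hpt, wExp_const hμ]

/-- Swapping the indices of a doubly indexed family of independent variables. -/
theorem wExp_powWeight_swap {κ : Type*} [Fintype κ] [DecidableEq κ] (f : (ι → κ → X) → ℝ) :
    wExp (powWeight ι (powWeight κ μ)) f
      = wExp (powWeight κ (powWeight ι μ)) fun β => f fun i k => β k i := by
  refine Fintype.sum_equiv (Equiv.piComm fun _ _ => X) _ _ fun ω => ?_
  simp only [powWeight, Equiv.piComm_apply]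
  rw [Finset.prod_comm]

/-- Splitting the inner index set of a doubly indexed family of independent variables. -/
theorem wExp_powWeight_sum {κ κ' : Type*} [Fintype κ] [DecidableEq κ] [Fintype κ'] [DecidableEq κ']
    (f : (ι → κ ⊕ κ' → X) → ℝ) :
    wExp (powWeight ι (powWeight (κ ⊕ κ') μ)) f
      = wExp (powWeight ι (powWeight κ' μ)) fun ω => wExp (powWeight ι (powWeight κ μ)) fun a =>
          f fun i => Sum.elim (a i) (ω i) := by
  rw [← wExp_prodWeight (fun x : (ι → κ' → X) × (ι → κ → X) => f fun i => Sum.elim (x.2 i) (x.1 i))]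
  let E : (ι → κ ⊕ κ' → X) ≃ (ι → κ' → X) × (ι → κ → X) :=
    { toFun := fun w => (fun i k => w i (Sum.inr k), fun i k => w i (Sum.inl k))
      invFun := fun x i => Sum.elim (x.2 i) (x.1 i)
      left_inv := fun w => by ext i (k | k) <;> rfl
      right_inv := fun x => rfl }
  refine Fintype.sum_equiv E _ _ fun w => ?_
  have hw : (fun i => Sum.elim (fun k => w i (Sum.inl k)) fun k => w i (Sum.inr k)) = w := by
    ext i (k | k) <;> rfl
  change _ * _ = prodWeight _ _ _ * f fun i => Sum.elim (fun k => w i (Sum.inl k)) fun k => w i (Sum.inr k)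
  rw [hw]
  congr 1
  simp only [E, prodWeight, powWeight, Fintype.prod_sum_type, Finset.prod_mul_distrib]
  exact mul_comm _ _

/-- A tail bound for the number of successes in a set chosen depending on which
coordinates satisfy `Q`, but disjoint from these coordinates. -/
theorem wPr_lt_card_filter_adaptive_le (hμ : IsWeight μ) {Q : X → Prop} {p : ℝ}
    (hQ : wPr μ Q ≤ 1 / 2) {κ : Type*} [Fintype κ] (R : κ → X → Prop)
    (hR : ∀ k, wPr μ (R k) ≤ p) (hp : 0 ≤ p)
    {T : κ → Finset ι → Finset ι} (hT : ∀ k Z, ∀ i ∈ T k Z, i ∉ Z) {u s N : ℝ} (hu : 0 ≤ u) :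
    wPr (powWeight ι μ) (fun ω => ∃ k, ((T k (Finset.univ.filter fun i => Q (ω i))).card : ℝ) ≤ N ∧
        s < (((T k (Finset.univ.filter fun i => Q (ω i))).filter fun i => R k (ω i)).card : ℝ))
      ≤ Fintype.card κ * Real.exp (2 * p * Real.exp u * N - s * u) := by
  refine (wPr_exists_le hμ.powWeight _).trans ?_
  rw [← nsmul_eq_mul]
  refine Finset.sum_le_card_nsmul _ _ _ fun k _ => ?_
  have hu1 : 1 ≤ Real.exp u := Real.one_le_exp hu
  set q := wPr μ Q with hq
  have hq0 : 0 ≤ q := wPr_nonneg hμ Q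
  let h : Finset ι → ι → X → ℝ := fun Z i x => if i ∈ Z then (if Q x then 1 else 0) else
    (if Q x then 0 else 1) * if i ∈ T k Z ∧ R k x then Real.exp u else 1
  have hh0 : ∀ Z i x, 0 ≤ h Z i x := fun Z i x => by simp only [h]; positivity
  have hE : ∀ Z i, wExp μ (h Z i) ≤ (if i ∈ Z then q else 1 - q) *
      if i ∈ T k Z then Real.exp (2 * p * Real.exp u) else 1 := by
    intro Z i
    have hnQ : wExp μ (fun x => if Q x then (0 : ℝ) else 1) = 1 - q := by
      rw [hq, ← wPr_not hμ, wPr]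
      congr 1; ext x; by_cases hx : Q x <;> simp [hx]
    by_cases hi : i ∈ Z
    · have hi' : i ∉ T k Z := fun h' => hT k Z i h' hi
      simp only [h, hi, hi', if_true, if_false, mul_one]
      rfl
    · by_cases hi' : i ∈ T k Z
      · simp only [h, hi, hi', if_true, if_false, true_and]
        calc _ ≤ wExp μ (fun x => (if Q x then 0 else 1) + (Real.exp u - 1) *
              if R k x then 1 else 0) := wExp_mono hμ fun x => by
                by_cases h1 : Q x <;> by_cases h2 : R k x <;> simp [h1, h2, hu]
          _ = (1 - q) + (Real.exp u - 1) * wPr μ (R k) := by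
                rw [wExp_add, hnQ, wExp_const_mul]; rfl
          _ ≤ (1 - q) + (Real.exp u - 1) * p := by
                have := mul_le_mul_of_nonneg_left (hR k) (sub_nonneg.2 hu1); linarith
          _ ≤ (1 - q) * (2 * p * Real.exp u + 1) := by
                have : 0 ≤ p * Real.exp u := by positivity
                nlinarith
          _ ≤ _ := mul_le_mul_of_nonneg_left (Real.add_one_le_exp _) (by linarith)
      · simp only [h, hi, hi', if_false, false_and, mul_one]
        rw [hnQ]
  calc _ ≤ wExp (powWeight ι μ) (fun ω => ∑ Z : Finset ι, if ((T k Z).card : ℝ) ≤ N then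
          Real.exp (-(s * u)) * ∏ i, h Z i (ω i) else 0) := by
        refine wPr_le_wExp hμ.powWeight
          (fun ω => Finset.sum_nonneg fun Z _ => ?_) fun ω ⟨h1, h2⟩ => ?_
        · have := Finset.prod_nonneg fun i (_ : i ∈ Finset.univ) => hh0 Z i (ω i)
          positivity
        · set Z : Finset ι := Finset.univ.filter fun i => Q (ω i) with hZ
          refine le_trans ?_ (Finset.single_le_sum (f := fun Z : Finset ι =>
            if ((T k Z).card : ℝ) ≤ N then Real.exp (-(s * u)) * ∏ i, h Z i (ω i) else 0)
            (fun Z _ => ?_) (Finset.mem_univ Z))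
          · rw [if_pos h1]
            refine (one_le_exp_mul_pow hu h2.le).trans_eq ?_
            rw [pow_card_filter_eq_prod, ← Finset.univ_inter (T k Z), ← Finset.prod_ite_mem]
            congr 1
            refine Finset.prod_congr rfl fun i _ => ?_
            have hiZ : i ∈ Z ↔ Q (ω i) := by simp [hZ]
            by_cases h3 : Q (ω i)
            · have h4 : i ∉ T k Z := fun h' => hT k Z i h' (hiZ.2 h3)
              simp [h, hiZ, h3, h4]
            · by_cases h4 : i ∈ T k Z <;> simp [h, hiZ, h3, h4]
          · have := Finset.prod_nonneg fun i (_ : i ∈ Finset.univ) => hh0 Z i (ω i)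
            positivity
    _ = ∑ Z : Finset ι, if ((T k Z).card : ℝ) ≤ N then
          Real.exp (-(s * u)) * ∏ i, wExp μ (h Z i) else 0 := by
        rw [wExp_sum]
        refine Finset.sum_congr rfl fun Z _ => ?_
        split_ifs
        · rw [wExp_const_mul, wExp_powWeight_prod]
        · exact wExp_const hμ.powWeight 0
    _ ≤ ∑ Z : Finset ι, Real.exp (2 * p * Real.exp u * N - s * u) *
          ∏ i, (if i ∈ Z then q else 1 - q) := by
        refine Finset.sum_le_sum fun Z _ => ?_
        have hP : 0 ≤ ∏ i, (if i ∈ Z then q else 1 - q) := Finset.prod_nonneg fun i _ => by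
          split_ifs <;> linarith
        split_ifs with hN
        · calc _ ≤ Real.exp (-(s * u)) * ∏ i, ((if i ∈ Z then q else 1 - q) *
                if i ∈ T k Z then Real.exp (2 * p * Real.exp u) else 1) := by
                refine mul_le_mul_of_nonneg_left (Finset.prod_le_prod (fun i _ =>
                  wExp_nonneg hμ (hh0 Z i)) fun i _ => hE Z i) (Real.exp_nonneg _)
            _ = Real.exp (2 * p * Real.exp u * (T k Z).card - s * u) *
                ∏ i, (if i ∈ Z then q else 1 - q) := by
                rw [Finset.prod_mul_distrib, Finset.prod_ite_mem, Finset.univ_inter,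
                  Finset.prod_const, ← Real.exp_nat_mul, mul_comm (∏ i, _), ← mul_assoc,
                  ← Real.exp_add]
                ring_nf
            _ ≤ _ := by
                refine mul_le_mul_of_nonneg_right (Real.exp_le_exp.2 ?_) hP
                gcongr
        · positivity
    _ = _ := by
        rw [← Finset.mul_sum]
        have := Finset.prod_add (fun _ : ι => q) (fun _ => 1 - q) Finset.univ
        simp only [add_sub_cancel, Finset.prod_const_one, Finset.powerset_univ] at this
        rw [Finset.sum_congr rfl fun Z _ => ?_, ← this, mul_one]
        rw [Finset.prod_ite]
        simp [Finset.filter_not]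

end ProductWeights

/-- The vector `v` has fewer than `ℓ` ones. -/
def IsThin {κ : Type*} [Fintype κ] (ℓ : ℝ) (v : κ → Bool) : Prop :=
  ((Finset.univ.filter fun k => v k = true).card : ℝ) < ℓ

/-- The indices of the vectors with fewer than `ℓ` ones. -/
def thinSet {ι κ : Type*} [Fintype ι] [Fintype κ] (ℓ : ℝ) (ω : ι → κ → Bool) : Finset ι :=
  Finset.univ.filter fun e => IsThin ℓ (ω e)

section Counting

variable {n b : ℕ}

theorem card_reservedLines_le {Y : Finset (Fin n × Fin n)} {ψ : Fin n × Fin n → Fin 3 → Fin n}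
    {a : Fin n × Fin n → Fin n → Bool} (hψ : ∀ e ∈ Y, ∀ i, a e (ψ e i) = true) (k : Fin n) :
    (reservedLines Y ψ k).card ≤ 2 * (Y.filter fun e => a e k = true).card := by
  calc _ ≤ ((Y.filter fun e => a e k = true).image (fun e => Sum.inl e.1) ∪
        (Y.filter fun e => a e k = true).image fun e => Sum.inr e.2).card := by
        refine Finset.card_le_card fun l hl => ?_
        simp only [reservedLines, Finset.mem_filter, Finset.mem_univ, true_and] at hl
        obtain ⟨e, he, h, i, hi⟩ := hl
        have := hψ e he i
        rw [hi] at this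
        simp only [Finset.mem_union, Finset.mem_image, Finset.mem_filter]
        rcases h with h | h
        · exact Or.inl ⟨e, ⟨he, this⟩, h.symm⟩
        · exact Or.inr ⟨e, ⟨he, this⟩, h.symm⟩
    _ ≤ _ := by
        refine (Finset.card_union_le _ _).trans ?_
        have h1 := Finset.card_image_le (s := Y.filter fun e => a e k = true)
          (f := fun e => (Sum.inl e.1 : Fin n ⊕ Fin n))
        have h2 := Finset.card_image_le (s := Y.filter fun e => a e k = true)
          (f := fun e => (Sum.inr e.2 : Fin n ⊕ Fin n))
        omega

theorem card_mem_reservedLines_le (Y : Finset (Fin n × Fin n)) (ψ : Fin n × Fin n → Fin 3 → Fin n)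
    (l : Fin n ⊕ Fin n) : (Finset.univ.filter fun k => l ∈ reservedLines Y ψ k).card
      ≤ 3 * (Y.filter fun e => OnLine e l).card := by
  calc _ ≤ (((Y.filter fun e => OnLine e l) ×ˢ Finset.univ).image
        fun x : (Fin n × Fin n) × Fin 3 => ψ x.1 x.2).card := by
        refine Finset.card_le_card fun k hk => ?_
        simp only [reservedLines, Finset.mem_filter, Finset.mem_univ, true_and] at hk
        obtain ⟨e, he, h, i, hi⟩ := hk
        exact Finset.mem_image.2 ⟨(e, i), by simp [he, h], hi⟩
    _ ≤ _ := by
        refine Finset.card_image_le.trans ?_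
        rw [Finset.card_product, Finset.card_univ, Fintype.card_fin, mul_comm]

theorem card_sparseCells_le (Z S : Finset (Fin n × Fin n)) (φ : Fin n × Fin n → Option (Fin n))
    (l : Fin n ⊕ Fin n) : (sparseCells Z S φ l).card
      ≤ (Zᶜ.filter fun e => OnLine e l ∧ φ e = none).card + S.card := by
  let g : Fin n × Fin n → Fin n × Fin n := fun s =>
    Sum.elim (fun r => (r, s.2)) (fun c => (s.1, c)) l
  calc _ ≤ ((Zᶜ.filter fun e => OnLine e l ∧ φ e = none) ∪ S.image g).card := by
        refine Finset.card_le_card fun e he => ?_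
        simp only [sparseCells, Finset.mem_filter, Finset.mem_univ, true_and] at he
        simp only [Finset.mem_union, Finset.mem_filter, Finset.mem_compl, Finset.mem_image]
        obtain ⟨h1, h2, h3 | ⟨l', hl', h3, s, hs, h4⟩⟩ := he
        · exact Or.inl ⟨h1, h2, h3⟩
        · refine Or.inr ⟨s, hs, ?_⟩
          rcases l with r | c <;> rcases l' with r' | c' <;>
            simp only [onLine_inl, onLine_inr] at h2 h3 h4
          · exact absurd (congrArg Sum.inl (h3.symm.trans h2)) hl'
          · exact Prod.ext h2.symm (h4.trans h3.symm)
          · exact Prod.ext (h4.trans h3.symm) h2.symm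
          · exact absurd (congrArg Sum.inr (h3.symm.trans h2)) hl'
    _ ≤ _ := (Finset.card_union_le _ _).trans (by
        have := Finset.card_image_le (s := S) (f := g); omega)

theorem lineDeg_le (G : Finset (Fin n × Fin n)) (l : Fin n ⊕ Fin n) : lineDeg G l ≤ n := by
  have h : lineDeg Finset.univ l = n := by
    rcases l with r | c
    · have := sum_filter_inl r fun _ => (1 : ℝ)
      simp only [Finset.sum_const, nsmul_eq_mul, mul_one, Finset.card_univ, Fintype.card_fin] at this
      exact_mod_cast this
    · have := sum_filter_inr c fun _ => (1 : ℝ)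
      simp only [Finset.sum_const, nsmul_eq_mul, mul_one, Finset.card_univ, Fintype.card_fin] at this
      exact_mod_cast this
  exact (Finset.card_le_card (Finset.filter_subset_filter _ (Finset.subset_univ G))).trans h.le

theorem card_le_of_lineDeg_le {Z : Finset (Fin n × Fin n)} {z : ℝ}
    (h : ∀ l, (lineDeg Z l : ℝ) ≤ z) : (Z.card : ℝ) ≤ n * z := by
  have h1 := Finset.card_eq_sum_card_fiberwise (f := Prod.fst) (s := Z) (t := Finset.univ)
    (by simp [Set.MapsTo])
  rw [h1]
  push_cast
  calc _ ≤ ∑ r : Fin n, z := Finset.sum_le_sum fun r _ => by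
        simpa [lineDeg] using h (Sum.inl r)
    _ = _ := by simp

end Counting

/-- Every array above `X` without an empty shaft has a proper coloring. -/
def RobustlyColorable {n b : ℕ} (X : Fin n × Fin n → Fin n ⊕ Fin b → Bool) : Prop :=
  ∀ X' : Fin n × Fin n → Fin n ⊕ Fin b → Bool, (∀ e c, X e c = true → X' e c = true) →
    (∀ e, ∃ c, X' e c = true) → HasProperColoring X'

section Exposure

variable {n b : ℕ}

/-- The array whose entries in the last `b` layers are given by `x.1`, and whose entries in the
first `n` layers are given by `x.2.1` on the thin cells of `x.1` and by `x.2.2` elsewhere. -/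
def assemble (ℓ : ℝ) (x : (Fin n × Fin n → Fin b → Bool) × (Fin n × Fin n → Fin n → Bool) ×
    (Fin n → Fin n × Fin n → Bool)) : Fin n × Fin n → Fin n ⊕ Fin b → Bool := fun e =>
  Sum.elim (fun k => if e ∈ thinSet ℓ x.1 then x.2.1 e k else x.2.2 k e) (x.1 e)

/-- The weights with which the three parts of an array are exposed. -/
def exposureWeight (n b : ℕ) (p : ℝ) : (Fin n × Fin n → Fin b → Bool) ×
    (Fin n × Fin n → Fin n → Bool) × (Fin n → Fin n × Fin n → Bool) → ℝ :=
  prodWeight (powWeight (Fin n × Fin n) (powWeight (Fin b) (bern p)))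
    (prodWeight (powWeight (Fin n × Fin n) (powWeight (Fin n) (bern p)))
      (powWeight (Fin n) (powWeight (Fin n × Fin n) (bern p))))

theorem wPr_assemble {p : ℝ} (hp0 : 0 ≤ p) (hp1 : p ≤ 1) (ℓ : ℝ)
    (Q : (Fin n × Fin n → Fin n ⊕ Fin b → Bool) → Prop) :
    wPr (powWeight (Fin n × Fin n) (powWeight (Fin n ⊕ Fin b) (bern p))) Q
      = wPr (exposureWeight n b p) fun x => Q (assemble ℓ x) := by
  have hw := isWeight_bern hp0 hp1
  rw [wPr, wExp_powWeight_sum, wPr, exposureWeight, wExp_prodWeight]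
  congr 1
  ext ω
  rw [wExp_prodWeight, wExp_powWeight_piecewise hw.powWeight (thinSet ℓ ω)]
  congr 1
  ext α
  rw [wExp_powWeight_swap]
  congr 1
  ext β
  congr 1
  have : (fun i => Sum.elim ((if i ∈ thinSet ℓ ω then α i else fun k => β k i)) (ω i))
      = assemble ℓ (ω, α, β) := by
    ext i (k | k)
    · by_cases h : i ∈ thinSet ℓ ω <;> simp [assemble, h]
    · simp [assemble]
  rw [this]

end Exposure

theorem wPr_powWeight_single {X ι : Type*} [Fintype X] [Fintype ι] [DecidableEq ι] {μ : X → ℝ}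
    (hμ : IsWeight μ) (i : ι) (Q : X → Prop) :
    wPr (powWeight ι μ) (fun ω => Q (ω i)) = wPr μ Q :=
  wExp_powWeight_single hμ i fun x => if Q x then 1 else 0

theorem wPr_bern (p : ℝ) : wPr (bern p) (fun x => x = true) = p := by
  rw [wPr, wExp_bern]; simp

section Events

variable {n b : ℕ} {p ℓ : ℝ}

/-- The cells that are thin both in `ω` and in `α`. -/
def bothThin {ι κ κ' : Type*} [Fintype ι] [Fintype κ] [Fintype κ'] (ℓ : ℝ) (ω : ι → κ → Bool)
    (α : ι → κ' → Bool) : Finset ι :=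
  (thinSet ℓ ω).filter fun e => IsThin ℓ (α e)

theorem mem_bothThin {ι κ κ' : Type*} [Fintype ι] [Fintype κ] [Fintype κ'] {ω : ι → κ → Bool}
    {α : ι → κ' → Bool} {e : ι} : e ∈ bothThin ℓ ω α ↔ IsThin ℓ (ω e) ∧ IsThin ℓ (α e) := by
  simp [bothThin, thinSet]

theorem wPr_lineDeg_thinSet_le (hp0 : 0 ≤ p) (hp1 : p ≤ 1) {qB z : ℝ}
    (hqB : wPr (powWeight (Fin b) (bern p)) (IsThin ℓ) ≤ qB) :
    wPr (exposureWeight n b p) (fun x => ∃ l, z < lineDeg (thinSet ℓ x.1) l)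
      ≤ 2 * n * Real.exp (qB * Real.exp 1 * n - z) := by
  have hw := isWeight_bern hp0 hp1
  have hq0 : 0 ≤ qB := (wPr_nonneg hw.powWeight _).trans hqB
  refine wPr_prodWeight_le' (hw.powWeight.powWeight.prodWeight hw.powWeight.powWeight) fun y => ?_
  refine (wPr_exists_le hw.powWeight.powWeight _).trans ?_
  have h : ∀ l : Fin n ⊕ Fin n, wPr (powWeight (Fin n × Fin n) (powWeight (Fin b) (bern p)))
      (fun ω => z < lineDeg (thinSet ℓ ω) l) ≤ Real.exp (qB * Real.exp 1 * n - z) := fun l => by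
    have hT : (((Finset.univ : Finset (Fin n × Fin n)).filter fun e => OnLine e l).card : ℝ)
        ≤ n := by exact_mod_cast lineDeg_le Finset.univ l
    have h := wPr_lt_card_filter_le (s := z) hw.powWeight
      (Finset.univ.filter fun e : Fin n × Fin n => OnLine e l) (fun _ v => IsThin ℓ v)
      (fun _ _ => hqB) hq0 zero_le_one hT
    rw [mul_one] at h
    refine le_trans (wPr_mono hw.powWeight.powWeight fun ω hω => ?_) h
    rwa [lineDeg, thinSet, Finset.filter_comm] at hω
  refine (Finset.sum_le_card_nsmul _ _ _ fun l _ => h l).trans_eq ?_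
  simp
  ring

theorem wPr_card_filter_thinSet_line_le (hp0 : 0 ≤ p) (hp1 : p ≤ 1) {z d u : ℝ} (hu : 0 ≤ u) :
    wPr (exposureWeight n b p) (fun x => ∃ i : (Fin n ⊕ Fin n) × Fin n,
        (lineDeg (thinSet ℓ x.1) i.1 : ℝ) ≤ z ∧
        d < (((thinSet ℓ x.1).filter fun e => OnLine e i.1 ∧ x.2.1 e i.2 = true).card : ℝ))
      ≤ 2 * n * n * Real.exp (p * Real.exp u * z - d * u) := by
  have hw := isWeight_bern hp0 hp1
  refine wPr_prodWeight_le hw.powWeight.powWeight fun ω =>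
    wPr_prodWeight_le' hw.powWeight.powWeight fun β => ?_
  refine (wPr_exists_le hw.powWeight.powWeight _).trans ?_
  refine (Finset.sum_le_card_nsmul _ _ (Real.exp (p * Real.exp u * z - d * u))
    fun i _ => ?_).trans_eq ?_
  · by_cases hz : (lineDeg (thinSet ℓ ω) i.1 : ℝ) ≤ z
    · have h := wPr_lt_card_filter_le (s := d) (q := p) hw.powWeight
        ((thinSet ℓ ω).filter fun e => OnLine e i.1) (fun _ v => v i.2 = true)
        (fun _ _ =>
          ((wPr_powWeight_single hw i.2 fun x => x = true).trans (wPr_bern p)).le) hp0 hu hz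
      refine le_trans (wPr_mono hw.powWeight.powWeight fun a ha => ?_) h
      rw [Finset.filter_filter]
      convert ha.2
    · refine le_trans (le_of_eq ?_) (Real.exp_nonneg _)
      simp [wPr, hz, wExp_const hw.powWeight.powWeight]
  · simp only [nsmul_eq_mul, Finset.card_univ, Fintype.card_prod, Fintype.card_sum, Fintype.card_fin]
    push_cast
    ring

theorem wPr_card_filter_thinSet_le (hp0 : 0 ≤ p) (hp1 : p ≤ 1) {z f₃ : ℝ} :
    wPr (exposureWeight n b p) (fun x => ∃ k : Fin n, ((thinSet ℓ x.1).card : ℝ) ≤ n * z ∧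
        f₃ < (((thinSet ℓ x.1).filter fun e => x.2.1 e k = true).card : ℝ))
      ≤ n * Real.exp (p * Real.exp 1 * (n * z) - f₃) := by
  have hw := isWeight_bern hp0 hp1
  refine wPr_prodWeight_le hw.powWeight.powWeight fun ω =>
    wPr_prodWeight_le' hw.powWeight.powWeight fun β => ?_
  refine (wPr_exists_le hw.powWeight.powWeight _).trans ?_
  refine (Finset.sum_le_card_nsmul _ _ (Real.exp (p * Real.exp 1 * (n * z) - f₃))
    fun k _ => ?_).trans_eq ?_
  · by_cases hz : ((thinSet ℓ ω).card : ℝ) ≤ n * z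
    · have h := wPr_lt_card_filter_le (s := f₃) (q := p) hw.powWeight
        (thinSet ℓ ω) (fun _ v => v k = true)
        (fun _ _ =>
          ((wPr_powWeight_single hw k fun x => x = true).trans (wPr_bern p)).le) hp0 zero_le_one hz
      rw [mul_one] at h
      refine le_trans (wPr_mono hw.powWeight.powWeight fun a ha => ?_) h
      convert ha.2
    · refine le_trans (le_of_eq ?_) (Real.exp_nonneg _)
      simp [wPr, hz, wExp_const hw.powWeight.powWeight]
  · simp

theorem wPr_exposure_and_le (hp0 : 0 ≤ p) (hp1 : p ≤ 1)
    {Q : (Fin n × Fin n → Fin b → Bool) → Prop} {R : (Fin n × Fin n → Fin n → Bool) → Prop}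
    {qB qA : ℝ} (hQ : wPr (powWeight (Fin n × Fin n) (powWeight (Fin b) (bern p))) Q ≤ qB)
    (hR : wPr (powWeight (Fin n × Fin n) (powWeight (Fin n) (bern p))) R ≤ qA) :
    wPr (exposureWeight n b p) (fun x => Q x.1 ∧ R x.2.1) ≤ qB * qA := by
  have hw := isWeight_bern hp0 hp1
  have h0 := wPr_prodWeight_and (μ := powWeight (Fin n × Fin n) (powWeight (Fin b) (bern p)))
    (ν := prodWeight (powWeight (Fin n × Fin n) (powWeight (Fin n) (bern p)))
      (powWeight (Fin n) (powWeight (Fin n × Fin n) (bern p)))) Q (fun y => R y.1)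
  rw [exposureWeight, h0]
  have h := wPr_prodWeight_le' (μ := powWeight (Fin n × Fin n) (powWeight (Fin n) (bern p)))
    (hw.powWeight (ι := Fin n × Fin n) |>.powWeight (ι := Fin n)) (Q := fun y => R y.1)
    (c := qA) fun _ => hR
  exact mul_le_mul hQ h (wPr_nonneg (hw.powWeight.powWeight.prodWeight hw.powWeight.powWeight) _)
    ((wPr_nonneg hw.powWeight.powWeight _).trans hQ)

theorem wPr_two_mem_bothThin_le (hp0 : 0 ≤ p) (hp1 : p ≤ 1) {qA qB : ℝ}
    (hqB : wPr (powWeight (Fin b) (bern p)) (IsThin ℓ) ≤ qB)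
    (hqA : wPr (powWeight (Fin n) (bern p)) (IsThin ℓ) ≤ qA)
    {e e' : Fin n × Fin n} :
    wPr (exposureWeight n b p)
      (fun x => e ≠ e' ∧ e ∈ bothThin ℓ x.1 x.2.1 ∧ e' ∈ bothThin ℓ x.1 x.2.1)
      ≤ (qB * qA) ^ 2 := by
  have hw := isWeight_bern hp0 hp1
  by_cases h : e = e'
  · simp only [h, ne_eq, not_true_eq_false, false_and]
    refine le_trans (le_of_eq ?_) (sq_nonneg _)
    simp [wPr, wExp]
  · have hB := wPr_powWeight_and (hw.powWeight (ι := Fin b)) h (IsThin ℓ)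
    have hA := wPr_powWeight_and (hw.powWeight (ι := Fin n)) h (IsThin ℓ)
    rw [mul_pow]
    refine le_trans (wPr_mono (hw.powWeight.powWeight.prodWeight
      (hw.powWeight.powWeight.prodWeight hw.powWeight.powWeight)) ?_)
      (wPr_exposure_and_le hp0 hp1 (hB.trans_le (pow_le_pow_left₀ (wPr_nonneg hw.powWeight _) hqB 2))
        (hA.trans_le (pow_le_pow_left₀ (wPr_nonneg hw.powWeight _) hqA 2)))
    rintro x ⟨-, h1, h2⟩
    rw [mem_bothThin] at h1 h2
    exact ⟨⟨h1.1, h2.1⟩, h1.2, h2.2⟩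

theorem wPr_bothThin_collide_le (hp0 : 0 ≤ p) (hp1 : p ≤ 1) {qA qB : ℝ}
    (hqB : wPr (powWeight (Fin b) (bern p)) (IsThin ℓ) ≤ qB)
    (hqA : wPr (powWeight (Fin n) (bern p)) (IsThin ℓ) ≤ qA) :
    wPr (exposureWeight n b p) (fun x => ∃ e ∈ bothThin ℓ x.1 x.2.1,
        ∃ e' ∈ bothThin ℓ x.1 x.2.1, ∃ l, OnLine e l ∧ OnLine e' l ∧ e ≠ e')
      ≤ 2 * n ^ 3 * (qB * qA) ^ 2 := by
  have hw := isWeight_bern hp0 hp1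
  have hW : IsWeight (exposureWeight n b p) := hw.powWeight.powWeight.prodWeight
    (hw.powWeight.powWeight.prodWeight hw.powWeight.powWeight)
  let E : (Fin n × Fin n × Fin n) ⊕ (Fin n × Fin n × Fin n) → (Fin n × Fin n) × (Fin n × Fin n) :=
    Sum.elim (fun t => ((t.1, t.2.1), (t.1, t.2.2))) (fun t => ((t.2.1, t.1), (t.2.2, t.1)))
  calc _ ≤ wPr (exposureWeight n b p) (fun x => ∃ t, (E t).1 ≠ (E t).2 ∧
          (E t).1 ∈ bothThin ℓ x.1 x.2.1 ∧ (E t).2 ∈ bothThin ℓ x.1 x.2.1) := by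
        refine wPr_mono hW ?_
        rintro x ⟨e, he, e', he', l, h1, h2, h3⟩
        rcases l with r | c
        · simp only [onLine_inl] at h1 h2
          refine ⟨Sum.inl (r, e.2, e'.2), ?_⟩
          have e1 : (E (Sum.inl (r, e.2, e'.2))).1 = e := Prod.ext h1.symm rfl
          have e2 : (E (Sum.inl (r, e.2, e'.2))).2 = e' := Prod.ext h2.symm rfl
          rw [e1, e2]
          exact ⟨h3, he, he'⟩
        · simp only [onLine_inr] at h1 h2
          refine ⟨Sum.inr (c, e.1, e'.1), ?_⟩
          have e1 : (E (Sum.inr (c, e.1, e'.1))).1 = e := Prod.ext rfl h1.symm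
          have e2 : (E (Sum.inr (c, e.1, e'.1))).2 = e' := Prod.ext rfl h2.symm
          rw [e1, e2]
          exact ⟨h3, he, he'⟩
    _ ≤ _ := by
        refine (wPr_exists_le hW _).trans ((Finset.sum_le_card_nsmul _ _ _
          fun t _ => wPr_two_mem_bothThin_le hp0 hp1 hqB hqA).trans_eq ?_)
        simp only [nsmul_eq_mul, Finset.card_univ, Fintype.card_prod, Fintype.card_sum,
          Fintype.card_fin]
        push_cast
        ring

theorem wPr_card_bothThin_le (hp0 : 0 ≤ p) (hp1 : p ≤ 1) {qA qB s : ℝ} (hs : 0 < s)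
    (hqB : wPr (powWeight (Fin b) (bern p)) (IsThin ℓ) ≤ qB)
    (hqA : wPr (powWeight (Fin n) (bern p)) (IsThin ℓ) ≤ qA) :
    wPr (exposureWeight n b p) (fun x => s < ((bothThin ℓ x.1 x.2.1).card : ℝ))
      ≤ n ^ 2 * (qB * qA) / s := by
  have hw := isWeight_bern hp0 hp1
  have hW : IsWeight (exposureWeight n b p) := hw.powWeight.powWeight.prodWeight
    (hw.powWeight.powWeight.prodWeight hw.powWeight.powWeight)
  calc _ ≤ wExp (exposureWeight n b p) (fun x => ((bothThin ℓ x.1 x.2.1).card : ℝ) * s⁻¹) :=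
        wPr_le_wExp hW (fun x => by positivity) fun x hx => by
          rw [← div_eq_mul_inv, one_le_div hs]; exact hx.le
    _ = (∑ e : Fin n × Fin n, wPr (exposureWeight n b p)
          (fun x => IsThin ℓ (x.1 e) ∧ IsThin ℓ (x.2.1 e))) * s⁻¹ := by
        rw [wExp_mul_const]
        simp only [wPr]
        rw [← wExp_sum]
        congr 2
        ext x
        simp only [← mem_bothThin]
        simp
    _ ≤ (∑ e : Fin n × Fin n, qB * qA) * s⁻¹ := by
        refine mul_le_mul_of_nonneg_right (Finset.sum_le_sum fun e _ => ?_) (inv_nonneg.2 hs.le)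
        refine wPr_exposure_and_le (Q := fun ω => IsThin ℓ (ω e)) (R := fun ω => IsThin ℓ (ω e))
          hp0 hp1 ?_ ?_
        · exact (wPr_powWeight_single hw.powWeight e _).trans_le hqB
        · exact (wPr_powWeight_single hw.powWeight e _).trans_le hqA
    _ = _ := by
        simp
        ring

end Events

section Assembly

variable {n b : ℕ} {p ℓ : ℝ}

theorem wPr_or3_le {X : Type*} [Fintype X] {μ : X → ℝ} (hμ : IsWeight μ) {Q Q₁ Q₂ Q₃ : X → Prop}
    {c₁ c₂ c₃ : ℝ} (h : ∀ x, Q x → Q₁ x ∨ Q₂ x ∨ Q₃ x) (h₁ : wPr μ Q₁ ≤ c₁) (h₂ : wPr μ Q₂ ≤ c₂)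
    (h₃ : wPr μ Q₃ ≤ c₃) : wPr μ Q ≤ c₁ + c₂ + c₃ := by
  have e1 := wPr_mono hμ h
  have e2 := wPr_or_le hμ Q₁ (fun x => Q₂ x ∨ Q₃ x)
  have e3 := wPr_or_le hμ Q₂ Q₃
  linarith

/-- The number of thin cells, and of their ones, is small on every line and in every layer. -/
def ThinControlled (z d f₃ s : ℝ) (ℓ : ℝ) (ω : Fin n × Fin n → Fin b → Bool)
    (α : Fin n × Fin n → Fin n → Bool) : Prop :=
  (∀ l, (lineDeg (thinSet ℓ ω) l : ℝ) ≤ z) ∧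
  (∀ l k, (((thinSet ℓ ω).filter fun e => OnLine e l ∧ α e k = true).card : ℝ) ≤ d) ∧
  (∀ k, (((thinSet ℓ ω).filter fun e => α e k = true).card : ℝ) ≤ f₃) ∧
  (∀ e ∈ bothThin ℓ ω α, ∀ e' ∈ bothThin ℓ ω α, ∀ l, OnLine e l → OnLine e' l → e = e') ∧
  ((bothThin ℓ ω α).card : ℝ) ≤ s

theorem wPr_not_thinControlled_le (hp0 : 0 ≤ p) (hp1 : p ≤ 1) {z d f₃ s u qA qB : ℝ} (hs : 0 < s)
    (hu : 0 ≤ u) (hqB : wPr (powWeight (Fin b) (bern p)) (IsThin ℓ) ≤ qB)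
    (hqA : wPr (powWeight (Fin n) (bern p)) (IsThin ℓ) ≤ qA) :
    wPr (exposureWeight n b p) (fun x => ¬ ThinControlled z d f₃ s ℓ x.1 x.2.1)
      ≤ 2 * n * Real.exp (qB * Real.exp 1 * n - z)
        + 2 * n * n * Real.exp (p * Real.exp u * z - d * u)
        + (n * Real.exp (p * Real.exp 1 * (n * z) - f₃) + 2 * n ^ 3 * (qB * qA) ^ 2
          + n ^ 2 * (qB * qA) / s) := by
  have hw := isWeight_bern hp0 hp1
  have hW : IsWeight (exposureWeight n b p) := hw.powWeight.powWeight.prodWeight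
    (hw.powWeight.powWeight.prodWeight hw.powWeight.powWeight)
  have h := wPr_or3_le hW (Q := fun x => (∃ k : Fin n, ((thinSet ℓ x.1).card : ℝ) ≤ n * z ∧
        f₃ < (((thinSet ℓ x.1).filter fun e => x.2.1 e k = true).card : ℝ)) ∨
        (∃ e ∈ bothThin ℓ x.1 x.2.1,
          ∃ e' ∈ bothThin ℓ x.1 x.2.1, ∃ l, OnLine e l ∧ OnLine e' l ∧ e ≠ e') ∨
        s < ((bothThin ℓ x.1 x.2.1).card : ℝ)) (fun _ h => h)
    (wPr_card_filter_thinSet_le (ℓ := ℓ) hp0 hp1 (z := z) (f₃ := f₃))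
    (wPr_bothThin_collide_le hp0 hp1 hqB hqA) (wPr_card_bothThin_le hp0 hp1 hs hqB hqA)
  refine wPr_or3_le hW ?_ (wPr_lineDeg_thinSet_le hp0 hp1 hqB)
    (wPr_card_filter_thinSet_line_le (ℓ := ℓ) hp0 hp1 (z := z) (d := d) hu) h
  intro x hx
  contrapose! hx
  obtain ⟨h1, h2, h3, h4, h5⟩ := hx
  have hz := card_le_of_lineDeg_le h1
  exact ⟨h1, fun l k => h2 (l, k) (h1 l), fun k => h3 k hz,
    fun e he e' he' l hl hl' => h4 e he e' he' l hl hl', h5⟩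

theorem robustlyColorable_assemble [Nonempty (Fin b)] {z d f₃ s W : ℝ}
    (hd : 1 ≤ d) (hℓ : 32 * d ≤ ℓ)
    {ω : Fin n × Fin n → Fin b → Bool} {α : Fin n × Fin n → Fin n → Bool}
    {β : Fin n → Fin n × Fin n → Bool} (hT : ThinControlled z d f₃ s ℓ ω α)
    {ψ : Fin n × Fin n → Fin 3 → Fin n}
    (hψ : ∀ e ∈ thinSet ℓ ω \ bothThin ℓ ω α, ∀ i, α e (ψ e i) = true)
    (hψ' : ∀ e ∈ thinSet ℓ ω \ bothThin ℓ ω α, ∀ e' ∈ thinSet ℓ ω \ bothThin ℓ ω α, ∀ i j l,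
      OnLine e l → OnLine e' l → ψ e i = ψ e' j → e = e' ∧ i = j)
    {φ : Fin n × Fin n → Option (Fin n)}
    (hφ : ∀ e k, φ e = some k → e ∈ (thinSet ℓ ω)ᶜ ∧ β k e = true ∧
      ∀ l ∈ reservedLines (thinSet ℓ ω \ bothThin ℓ ω α) ψ k, ¬ OnLine e l)
    (hφ' : ∀ e e' l k, φ e = some k → φ e' = some k → OnLine e l → OnLine e' l → e = e')
    (hφW : ∀ l, (((thinSet ℓ ω)ᶜ.filter fun e => OnLine e l ∧ φ e = none).card : ℝ) ≤ W)
    (hsp : ∀ l k, ((sparseCells (thinSet ℓ ω) (bothThin ℓ ω α) φ l).card : ℝ) ≤ W + s →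
      (((sparseCells (thinSet ℓ ω) (bothThin ℓ ω α) φ l).filter fun e => ω e k = true).card : ℝ)
        ≤ d) :
    RobustlyColorable (assemble ℓ (ω, α, β)) := by
  intro X' hXX' hshaft
  have hZS : ∀ e ∈ thinSet ℓ ω \ bothThin ℓ ω α, e ∈ thinSet ℓ ω := fun e he =>
    (Finset.mem_sdiff.1 he).1
  refine hasProperColoring_of_partial (Z := thinSet ℓ ω) (S := bothThin ℓ ω α)
    (Finset.filter_subset _ _) hXX' hshaft hd hℓ ?_ hT.2.2.2.1 (ψ := ψ) ?_ hψ' (φ := φ) ?_ hφ' ?_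
  · intro e he
    have h : ¬ IsThin ℓ (ω e) := fun h => he (Finset.mem_filter.2 ⟨Finset.mem_univ _, h⟩)
    exact not_lt.1 h
  · intro e he i
    simpa [assemble, hZS e he] using hψ e he i
  · intro e k hk
    obtain ⟨h1, h2, h3⟩ := hφ e k hk
    refine ⟨h1, ?_, h3⟩
    simpa [assemble, Finset.mem_compl.1 h1] using h2
  · intro l k
    refine le_trans (le_of_eq ?_) (hsp l k ?_)
    · simp [assemble]
    · have h1 := card_sparseCells_le (thinSet ℓ ω) (bothThin ℓ ω α) φ l
      have h2 := hφW l
      have h3 := hT.2.2.2.2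
      have h1' : ((sparseCells (thinSet ℓ ω) (bothThin ℓ ω α) φ l).card : ℝ) ≤
        ((thinSet ℓ ω)ᶜ.filter fun e => OnLine e l ∧ φ e = none).card + (bothThin ℓ ω α).card := by
        exact_mod_cast h1
      linarith

/-- The probability that the array cannot be properly colored even though it has no empty shaft. -/
theorem wPr_not_robustlyColorable_le [Nonempty (Fin n)] [Nonempty (Fin b)] (hp0 : 0 < p)
    (hp1 : p ≤ 1) {z d f₃ s f u qA qB η W lam : ℝ} (hs : 0 < s) (hu : 0 ≤ u)
    (hd : 1 ≤ d) (hℓ : 32 * d ≤ ℓ) (hz : 3 * z ≤ f) (hf₃ : 2 * f₃ ≤ f) (hf : 0 ≤ f)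
    (hqB : wPr (powWeight (Fin b) (bern p)) (IsThin ℓ) ≤ qB) (hqB2 : qB ≤ 1 / 2)
    (hqA : wPr (powWeight (Fin n) (bern p)) (IsThin ℓ) ≤ qA)
    (hη0 : 0 < η) (hη1 : 2 * η ≤ 1) (hW : 0 < W) (hlam : 0 ≤ lam)
    (hbig : 2 * (1 + η) * Real.exp (-(W * p * (η ^ 2 / (η + 2)))) ≤ η) :
    wPr (powWeight (Fin n × Fin n) (powWeight (Fin n ⊕ Fin b) (bern p)))
        (fun X => ¬ RobustlyColorable X)
      ≤ 2 * n * Real.exp (qB * Real.exp 1 * n - z)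
        + 2 * n * n * Real.exp (p * Real.exp u * z - d * u)
        + (n * Real.exp (p * Real.exp 1 * (n * z) - f₃) + 2 * n ^ 3 * (qB * qA) ^ 2
          + n ^ 2 * (qB * qA) / s)
        + Real.exp ((lam / W) ^ 2 + lam / W * (2 * η + 2 * f / W)) ^ n *
            (2 * n * Real.exp (lam * ((n + f) / (W + n) - 1)))
        + 2 * n * b * Real.exp (2 * p * Real.exp u * (W + s) - d * u) := by
  have hw := isWeight_bern hp0.le hp1
  have hWt : IsWeight (exposureWeight n b p) := hw.powWeight.powWeight.prodWeight
    (hw.powWeight.powWeight.prodWeight hw.powWeight.powWeight)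
  -- choose the reserved colors and the partial coloring
  have hψex : ∀ (Z Y : Finset (Fin n × Fin n)) (a : Fin n × Fin n → Fin n → Bool),
      (Y ⊆ Z ∧ (∀ e ∈ Y, ¬ IsThin ℓ (a e)) ∧
        ∀ l k, ((Z.filter fun e => OnLine e l ∧ a e k = true).card : ℝ) ≤ d) →
      ∃ ψ : Fin n × Fin n → Fin 3 → Fin n, (∀ e ∈ Y, ∀ i, a e (ψ e i) = true) ∧
        ∀ e ∈ Y, ∀ e' ∈ Y, ∀ i j l, OnLine e l → OnLine e' l → ψ e i = ψ e' j →
          e = e' ∧ i = j := by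
    rintro Z Y a ⟨h1, h2, h3⟩
    exact exists_reserved_colors h1 (ℓ := ℓ) (d := d) (by linarith) (by linarith)
      (fun e he => not_lt.1 (h2 e he)) h3
  choose! ψ hψ using hψex
  have hφex : ∀ (Z : Finset (Fin n × Fin n)) (F : Fin n → Finset (Fin n ⊕ Fin n))
      (β : Fin n → Fin n × Fin n → Bool), PartiallyColorable Zᶜ F β W →
      ∃ φ : Fin n × Fin n → Option (Fin n),
        (∀ e k, φ e = some k → e ∈ Zᶜ ∧ β k e = true ∧ ∀ l ∈ F k, ¬ OnLine e l) ∧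
        (∀ e e' l k, φ e = some k → φ e' = some k → OnLine e l → OnLine e' l → e = e') ∧
        ∀ l, ((Zᶜ.filter fun e => OnLine e l ∧ φ e = none).card : ℝ) ≤ W := fun _ _ _ h => h
  choose! φ hφ using hφex
  let S : Finset (Fin n × Fin n) → (Fin n × Fin n → Fin n → Bool) → Finset (Fin n × Fin n) :=
    fun Z α => Z.filter fun e => IsThin ℓ (α e)
  let F : Finset (Fin n × Fin n) → (Fin n × Fin n → Fin n → Bool) →
      Fin n → Finset (Fin n ⊕ Fin n) := fun Z α => reservedLines (Z \ S Z α) (ψ Z (Z \ S Z α) α)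
  let T : (Fin n × Fin n → Fin n → Bool) → (Fin n → Fin n × Fin n → Bool) →
      (Fin n ⊕ Fin n) × Fin b → Finset (Fin n × Fin n) → Finset (Fin n × Fin n) :=
    fun α β i Z => sparseCells Z (S Z α) (φ Z (F Z α) β) i.1
  have hpart : wPr (exposureWeight n b p) (fun x => ((∀ k, ((F (thinSet ℓ x.1) x.2.1 k).card : ℝ)
        ≤ f) ∧ ∀ l, ((Finset.univ.filter fun k => l ∈ F (thinSet ℓ x.1) x.2.1 k).card : ℝ) ≤ f) ∧
        ¬ PartiallyColorable (thinSet ℓ x.1)ᶜ (F (thinSet ℓ x.1) x.2.1) x.2.2 W)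
      ≤ Real.exp ((lam / W) ^ 2 + lam / W * (2 * η + 2 * f / W)) ^ n *
            (2 * n * Real.exp (lam * ((n + f) / (W + n) - 1))) := by
    refine wPr_prodWeight_le hw.powWeight.powWeight fun ω =>
      wPr_prodWeight_le hw.powWeight.powWeight fun α => ?_
    set F' := F (thinSet ℓ ω) α with hF'
    by_cases hF : (∀ k, ((F' k).card : ℝ) ≤ f) ∧
      ∀ l, ((Finset.univ.filter fun k => l ∈ F' k).card : ℝ) ≤ f
    · have h := wPr_not_partiallyColorable_le (n := n) hp0 hp1 hη0 hη1 hW hf hlam hbig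
        (D := W + n) (K := n) (G := (thinSet ℓ ω)ᶜ) (F := F') (by linarith) hF.1 hF.2
      rw [add_sub_cancel_right] at h
      refine le_trans (wPr_mono hw.powWeight.powWeight fun β hβ => hβ.2)
        (h.trans (mul_le_mul_of_nonneg_left ?_ (by positivity)))
      have hterm : ∀ l, Real.exp (lam * (lineLoad (thinSet ℓ ω)ᶜ F' l / (W + n) - 1))
          ≤ Real.exp (lam * ((n + f) / (W + n) - 1)) := fun l => by
        have hdeg : (lineDeg (thinSet ℓ ω)ᶜ l : ℝ) ≤ n := by
          exact_mod_cast lineDeg_le _ l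
        have := hF.2 l
        rw [lineLoad]
        gcongr
      refine (Finset.sum_le_card_nsmul _ _ _ fun l _ => hterm l).trans_eq ?_
      simp only [nsmul_eq_mul, Finset.card_univ, Fintype.card_sum, Fintype.card_fin]
      push_cast
      ring
    · refine le_trans (le_of_eq ?_) (by positivity : (0 : ℝ) ≤ _)
      have : (fun β => ((∀ k, ((F (thinSet ℓ ω) α k).card : ℝ)
        ≤ f) ∧ ∀ l, ((Finset.univ.filter fun k => l ∈ F (thinSet ℓ ω) α k).card : ℝ) ≤ f) ∧
        ¬ PartiallyColorable (thinSet ℓ ω)ᶜ (F (thinSet ℓ ω) α) β W) = fun _ => False := by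
        ext β
        exact iff_false_intro fun h => hF h.1
      refine (congrArg (wPr _) this).trans ?_
      simp [wPr, wExp]
  have hsparse : wPr (exposureWeight n b p) (fun x => ∃ i : (Fin n ⊕ Fin n) × Fin b,
        ((T x.2.1 x.2.2 i (thinSet ℓ x.1)).card : ℝ) ≤ W + s ∧
        d < (((T x.2.1 x.2.2 i (thinSet ℓ x.1)).filter fun e => x.1 e i.2 = true).card : ℝ))
      ≤ 2 * n * b * Real.exp (2 * p * Real.exp u * (W + s) - d * u) := by
    refine wPr_prodWeight_le' (hw.powWeight.powWeight.prodWeight hw.powWeight.powWeight)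
      fun y => ?_
    have h := wPr_lt_card_filter_adaptive_le (ι := Fin n × Fin n)
      (hw.powWeight (ι := Fin b)) (Q := IsThin ℓ)
      (hqB.trans hqB2) (κ := (Fin n ⊕ Fin n) × Fin b) (fun i v => v i.2 = true) (p := p)
      (fun i => ((wPr_powWeight_single hw i.2 fun x => x = true).trans (wPr_bern p)).le) hp0.le
      (T := T y.1 y.2) (fun i Z e he => (Finset.mem_filter.1 he).2.1) (u := u) (s := d)
      (N := W + s) hu
    refine le_trans (wPr_mono hw.powWeight.powWeight ?_) (h.trans_eq ?_)
    · rintro ω ⟨i, h1, h2⟩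
      refine ⟨i, h1, ?_⟩
      convert h2
      rfl
    · simp only [Fintype.card_prod, Fintype.card_sum, Fintype.card_fin]
      push_cast
      ring
  rw [wPr_assemble hp0.le hp1 ℓ]
  refine wPr_or3_le hWt ?_ (wPr_not_thinControlled_le (z := z) (d := d) (f₃ := f₃) hp0.le hp1 hs hu
    hqB hqA) hpart hsparse
  rintro ⟨ω, α, β⟩ hx
  contrapose! hx
  obtain ⟨h1, h2, h3⟩ := hx
  have hsp := hψ (thinSet ℓ ω) (thinSet ℓ ω \ S (thinSet ℓ ω) α) α ⟨Finset.sdiff_subset, fun e he => by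
    simp only [S, Finset.mem_sdiff, Finset.mem_filter, not_and] at he
    exact he.2 he.1, h1.2.1⟩
  have hP : PartiallyColorable (thinSet ℓ ω)ᶜ (F (thinSet ℓ ω) α) β W := by
    refine h2 ⟨fun k => ?_, fun l => ?_⟩
    · have e1 := card_reservedLines_le hsp.1 k
      have e2 : ((thinSet ℓ ω \ S (thinSet ℓ ω) α).filter fun e => α e k = true).card
          ≤ ((thinSet ℓ ω).filter fun e => α e k = true).card :=
        Finset.card_le_card (Finset.filter_subset_filter _ Finset.sdiff_subset)
      have e3 := h1.2.2.1 k
      have e4 : ((F (thinSet ℓ ω) α k).card : ℝ)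
          ≤ 2 * ((thinSet ℓ ω).filter fun e => α e k = true).card := by
        exact_mod_cast e1.trans (Nat.mul_le_mul_left 2 e2)
      linarith
    · have e1 := card_mem_reservedLines_le (thinSet ℓ ω \ S (thinSet ℓ ω) α)
        (ψ (thinSet ℓ ω) (thinSet ℓ ω \ S (thinSet ℓ ω) α) α) l
      have e2 : ((thinSet ℓ ω \ S (thinSet ℓ ω) α).filter fun e => OnLine e l).card
          ≤ lineDeg (thinSet ℓ ω) l :=
        Finset.card_le_card (Finset.filter_subset_filter _ Finset.sdiff_subset)
      have e3 := h1.1 l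
      have e4 : ((Finset.univ.filter fun k => l ∈ F (thinSet ℓ ω) α k).card : ℝ)
          ≤ 3 * lineDeg (thinSet ℓ ω) l := by
        exact_mod_cast e1.trans (Nat.mul_le_mul_left 3 e2)
      linarith
  obtain ⟨g1, g2, g3⟩ := hφ _ _ _ hP
  exact robustlyColorable_assemble hd hℓ h1 hsp.1 hsp.2 g1 g2 g3 fun l k hk => h3 (l, k) hk

end Assembly

section RandomOrder

theorem exists_equiv_initial_segment {N : ℕ} {P : Type*} [Fintype P] (hN : Fintype.card P = N)
    (M : P → Bool) : ∃ (t : ℕ) (σ : Fin N ≃ P), ∀ x, M x = true ↔ ∃ s : Fin N, (s : ℕ) < t ∧ σ s = x := by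
  have hM : (Finset.univ.filter fun x => M x = true).card ≤ N := by
    rw [← hN]; exact Finset.card_le_univ _
  set t := (Finset.univ.filter fun x => M x = true).card with ht
  let e₀ : Fin N ≃ P := Fintype.equivOfCardEq (by simp [hN])
  have hcard : Fintype.card {x : P // ((e₀.symm x : Fin N) : ℕ) < t}
      = Fintype.card {x : P // M x = true} := by
    rw [Fintype.card_subtype (fun x => M x = true), ← ht]
    rw [Fintype.card_congr (e₀.symm.subtypeEquiv (q := fun s : Fin N => (s : ℕ) < t) fun _ => Iff.rfl)]
    rw [Fintype.card_subtype]
    simp [Fin.card_filter_val_lt, hM]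
  let g := (Fintype.equivOfCardEq hcard).extendSubtype
  refine ⟨t, e₀.trans g, fun x => ⟨fun hx => ?_, ?_⟩⟩
  · refine ⟨e₀.symm (g.symm x), ?_, by simp⟩
    by_contra h
    have := Equiv.extendSubtype_not_mem (Fintype.equivOfCardEq hcard) (g.symm x) h
    exact this (by simpa [g] using hx)
  · rintro ⟨s, hs, rfl⟩
    exact Equiv.extendSubtype_mem (Fintype.equivOfCardEq hcard) (e₀ s) (by simpa using hs)

/-- If all arrays in each process of a family satisfy `Q`, then the proportion of this family is
at most the probability that a binomial random array satisfies `Q`. -/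
theorem card_div_card_le_wPr {N : ℕ} {P : Type*} [Fintype P] [DecidableEq P]
    (hN : Fintype.card P = N) {p : ℝ} (hp0 : 0 ≤ p) (hp1 : p ≤ 1) (bad : Finset (Fin N ≃ P))
    (Q : (P → Bool) → Prop)
    (h : ∀ σ ∈ bad, ∀ t : ℕ, Q fun x => decide (∃ s : Fin N, (s : ℕ) < t ∧ σ s = x)) :
    (bad.card : ℝ) / Fintype.card (Fin N ≃ P) ≤ wPr (powWeight P (bern p)) Q := by
  have hw : IsWeight (powWeight P (bern p)) := (isWeight_bern hp0 hp1).powWeight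
  have hinv : ∀ π : Equiv.Perm P, wPr (powWeight P (bern p)) (fun M => Q (M ∘ π))
      = wPr (powWeight P (bern p)) Q := fun π => by
    refine Fintype.sum_equiv (π.arrowCongr (Equiv.refl Bool)).symm _ _ fun M => ?_
    have h1 : (π.arrowCongr (Equiv.refl Bool)).symm M = M ∘ π := by
      ext x; simp [Equiv.arrowCongr]
    rw [h1]
    congr 1
    simp only [powWeight, Function.comp]
    exact (Equiv.prod_comp π fun x => bern p (M x)).symm
  have hcount : ∀ M : P → Bool, (bad.card : ℝ)
      ≤ ∑ π : Equiv.Perm P, if Q (M ∘ π) then 1 else 0 := fun M => by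
    obtain ⟨t, σ₀, hσ₀⟩ := exists_equiv_initial_segment hN M
    rw [Finset.sum_boole]
    refine Nat.cast_le.2 (Finset.card_le_card_of_injOn (fun σ => σ.symm.trans σ₀)
      (fun σ hσ => ?_) fun σ _ σ' _ hσ => ?_)
    · simp only [Finset.coe_filter, Finset.mem_univ, true_and, Set.mem_ofPred_eq]
      convert h σ hσ t using 1
      ext x
      rw [Bool.eq_iff_iff, decide_eq_true_iff, Function.comp_apply, hσ₀]
      simp [Equiv.eq_symm_apply, eq_comm]
    · ext s
      have h1 := congrArg (fun e : P ≃ P => e.symm (σ₀ s)) hσ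
      simpa using h1
  have hpos : (0 : ℝ) < Fintype.card (Fin N ≃ P) := by
    have : Nonempty (Fin N ≃ P) := ⟨Fintype.equivOfCardEq (by simp [hN])⟩
    exact_mod_cast Fintype.card_pos
  have hcard : Fintype.card (Fin N ≃ P) = Fintype.card (Equiv.Perm P) :=
    Fintype.card_congr ((Fintype.equivOfCardEq (by simp [hN]) : Fin N ≃ P).equivCongr (Equiv.refl P))
  rw [div_le_iff₀ hpos]
  calc (bad.card : ℝ) = wExp (powWeight P (bern p)) fun _ => (bad.card : ℝ) := (wExp_const hw _).symm
    _ ≤ wExp (powWeight P (bern p)) fun M => ∑ π : Equiv.Perm P, if Q (M ∘ π) then 1 else 0 :=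
        wExp_mono hw hcount
    _ = ∑ π : Equiv.Perm P, wPr (powWeight P (bern p)) (fun M => Q (M ∘ π)) := by
        rw [wExp_sum]; rfl
    _ = _ := by
        simp only [hinv]
        rw [Finset.sum_const, nsmul_eq_mul, hcard, Finset.card_univ, mul_comm]

end RandomOrder

section Arrays

variable {n m b : ℕ}

theorem ContainsLatinBox.noEmptyShaft {M : Fin n → Fin n → Fin m → Bool}
    (h : ContainsLatinBox M) : NoEmptyShaft M := by
  obtain ⟨L, ⟨h1, h2, -, -⟩, h3⟩ := h
  have hsum : numOnes L = ∑ e : Fin n × Fin n,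
      (Finset.univ.filter fun c => L e.1 e.2 c = true).card := by
    simp only [numOnes, Finset.card_filter, Fintype.sum_prod_type]
  have hone : ∀ e : Fin n × Fin n, (Finset.univ.filter fun c => L e.1 e.2 c = true).card = 1 := by
    have := (Finset.sum_eq_sum_iff_of_le (s := Finset.univ)
      (f := fun e : Fin n × Fin n => (Finset.univ.filter fun c => L e.1 e.2 c = true).card)
      (g := fun _ => 1) fun e _ => h2 e.1 e.2).1 (by rw [← hsum, h1]; simp)
    exact fun e => this e (Finset.mem_univ e)
  intro r c
  obtain ⟨v, hv⟩ := Finset.card_pos.1 (by rw [hone (r, c)]; exact one_pos)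
  exact ⟨v, h3 _ _ _ (Finset.mem_filter.1 hv).2⟩

/-- The array with the entries of `X`. -/
def toArray (κ : Fin m ≃ Fin n ⊕ Fin b) (X : Fin n × Fin n → Fin n ⊕ Fin b → Bool) :
    Fin n → Fin n → Fin m → Bool := fun i j k => X (i, j) (κ k)

theorem HasProperColoring.containsLatinBox (κ : Fin m ≃ Fin n ⊕ Fin b)
    {X : Fin n × Fin n → Fin n ⊕ Fin b → Bool} (h : HasProperColoring X) :
    ContainsLatinBox (toArray κ X) := by
  obtain ⟨χ, h1, h2⟩ := h
  refine ⟨fun i j k => decide (χ (i, j) = κ k), ⟨?_, fun i j => ?_, fun i k => ?_, fun j k => ?_⟩,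
    fun i j k hk => ?_⟩
  · have : (Finset.univ.filter fun x : Fin n × Fin n × Fin m =>
        decide (χ (x.1, x.2.1) = κ x.2.2) = true)
        = Finset.univ.image fun e : Fin n × Fin n => (e.1, e.2, κ.symm (χ e)) := by
      ext ⟨i, j, k⟩
      simp only [decide_eq_true_eq, Finset.mem_filter, Finset.mem_univ, true_and, Finset.mem_image,
        Prod.mk.injEq]
      constructor
      · intro h
        exact ⟨(i, j), rfl, rfl, by rw [h]; simp⟩
      · rintro ⟨e, rfl, rfl, rfl⟩
        simp
    rw [numOnes, this, Finset.card_image_of_injective]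
    · simp
    · intro e e' h
      simp only [Prod.mk.injEq] at h
      exact Prod.ext h.1 h.2.1
  · rw [Finset.card_le_one]
    intro k hk k' hk'
    simp only [decide_eq_true_eq, Finset.mem_filter, Finset.mem_univ, true_and] at hk hk'
    exact κ.injective (hk.symm.trans hk')
  · rw [Finset.card_le_one]
    intro j hj j' hj'
    simp only [decide_eq_true_eq, Finset.mem_filter, Finset.mem_univ, true_and] at hj hj'
    exact congrArg Prod.snd (h2 (i, j) (i, j') (Sum.inl i) (by simp) (by simp) (hj.trans hj'.symm))
  · rw [Finset.card_le_one]
    intro i hi i' hi'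
    simp only [decide_eq_true_eq, Finset.mem_filter, Finset.mem_univ, true_and] at hi hi'
    exact congrArg Prod.fst (h2 (i, j) (i', j) (Sum.inr j) (by simp) (by simp) (hi.trans hi'.symm))
  · rw [decide_eq_true_eq] at hk
    rw [toArray, ← hk]
    exact h1 _

theorem procArr_mono {σ : Fin (n * n * m) ≃ (Fin n × Fin n × Fin m)} {s t : ℕ} (h : s ≤ t)
    {i j : Fin n} {c : Fin m} (hs : procArr n m σ s i j c = true) :
    procArr n m σ t i j c = true := by
  simp only [procArr, decide_eq_true_eq] at hs ⊢
  obtain ⟨x, h1, h2⟩ := hs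
  exact ⟨x, h1.trans_le h, h2⟩

/-- If the hitting times differ, then no array of the process is both robustly colorable and
has an empty shaft. -/
theorem hittingTime_eq_of_robustlyColorable (hm : 0 < m) (κ : Fin m ≃ Fin n ⊕ Fin b)
    {σ : Fin (n * n * m) ≃ (Fin n × Fin n × Fin m)} {t : ℕ}
    (h1 : RobustlyColorable fun (e : Fin n × Fin n) c => procArr n m σ t e.1 e.2 (κ.symm c))
    (h2 : ¬ NoEmptyShaft (procArr n m σ t)) :
    hittingTime n m σ NoEmptyShaft = hittingTime n m σ ContainsLatinBox := by
  have hne : {t | NoEmptyShaft (procArr n m σ t)}.Nonempty := by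
    refine ⟨n * n * m, fun r c => ⟨⟨0, hm⟩, ?_⟩⟩
    simp only [procArr, decide_eq_true_eq]
    exact ⟨σ.symm (r, c, ⟨0, hm⟩), Fin.is_lt _, by simp⟩
  have hτ : NoEmptyShaft (procArr n m σ (hittingTime n m σ NoEmptyShaft)) := Nat.sInf_mem hne
  set τ := hittingTime n m σ NoEmptyShaft with hτ_def
  have htτ : t ≤ τ := by
    by_contra! h
    exact h2 fun r c => (hτ r c).imp fun v hv => procArr_mono h.le hv
  have hbox : ContainsLatinBox (procArr n m σ τ) := by
    have := (h1 (fun e c => procArr n m σ τ e.1 e.2 (κ.symm c))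
      (fun e c hc => procArr_mono htτ hc) fun e => by
        obtain ⟨v, hv⟩ := hτ e.1 e.2
        exact ⟨κ v, by simpa using hv⟩).containsLatinBox κ
    have e : toArray κ (fun (e : Fin n × Fin n) c => procArr n m σ τ e.1 e.2 (κ.symm c))
        = procArr n m σ τ := by
      funext i j k
      simp only [toArray, Equiv.symm_apply_apply]
    rwa [e] at this
  refine le_antisymm ?_ (Nat.sInf_le hbox)
  exact Nat.sInf_le (Nat.sInf_mem (s := {t | ContainsLatinBox (procArr n m σ t)})
    ⟨τ, hbox⟩).noEmptyShaft

theorem wPr_arrays {p : ℝ} (κ : Fin m ≃ Fin n ⊕ Fin b)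
    (Q : (Fin n × Fin n × Fin m → Bool) → Prop) :
    wPr (powWeight (Fin n × Fin n × Fin m) (bern p)) Q
      = wPr (powWeight (Fin n × Fin n) (powWeight (Fin n ⊕ Fin b) (bern p)))
          (fun X => Q fun x => X (x.1, x.2.1) (κ x.2.2)) := by
  let E : (Fin n × Fin n × Fin m → Bool) ≃ (Fin n × Fin n → Fin n ⊕ Fin b → Bool) :=
    { toFun := fun M e c => M (e.1, e.2, κ.symm c)
      invFun := fun X x => X (x.1, x.2.1) (κ x.2.2)
      left_inv := fun M => by ext ⟨i, j, k⟩; simp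
      right_inv := fun X => by ext ⟨i, j⟩ c; simp }
  refine Fintype.sum_equiv E _ _ fun M => ?_
  have h1 : (fun x : Fin n × Fin n × Fin m => E M (x.1, x.2.1) (κ x.2.2)) = M := E.left_inv M
  have h2 : powWeight (Fin n × Fin n × Fin m) (bern p) M
      = powWeight (Fin n × Fin n) (powWeight (Fin n ⊕ Fin b) (bern p)) (E M) := by
    simp only [powWeight, E, Equiv.coe_fn_mk, Fintype.prod_prod_type]
    refine Finset.prod_congr rfl fun i _ => Finset.prod_congr rfl fun j _ => ?_
    exact (Equiv.prod_comp κ.symm fun k => bern p (M (i, j, k))).symm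
  change _ * (if Q M then (1 : ℝ) else 0)
    = _ * (if Q (fun x => E M (x.1, x.2.1) (κ x.2.2)) then (1 : ℝ) else 0)
  rw [h1, h2]

theorem wPr_powWeight_forall {X ι : Type*} [Fintype X] [Fintype ι] [DecidableEq ι] (μ : X → ℝ)
    (Q : X → Prop) :
    wPr (powWeight ι μ) (fun ω => ∀ i, Q (ω i)) = wPr μ Q ^ Fintype.card ι := by
  have h := wExp_powWeight_prod (ι := ι) (μ := μ) (fun _ x => if Q x then 1 else 0)
  simp only [Finset.prod_boole, Finset.prod_const, Finset.card_univ] at h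
  rw [wPr, wPr, ← h]
  congr 1
  ext ω
  simp

theorem wPr_noEmptyShaft_le {p : ℝ} (hp0 : 0 ≤ p) (hp1 : p ≤ 1) :
    wPr (powWeight (Fin n × Fin n) (powWeight (Fin n ⊕ Fin b) (bern p)))
        (fun X => ∀ e, ∃ c, X e c = true)
      ≤ Real.exp (-(n ^ 2 * (1 - p) ^ (n + b))) := by
  have hw := isWeight_bern hp0 hp1
  have h1 : wPr (powWeight (Fin n ⊕ Fin b) (bern p)) (fun v => ∃ c, v c = true)
      = 1 - (1 - p) ^ (n + b) := by
    have h := wPr_not (hw.powWeight (ι := Fin n ⊕ Fin b)) (fun v => ∀ c, ¬ v c = true)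
    rw [wPr_powWeight_forall (bern p) (fun x => ¬ x = true), wPr_not hw, wPr_bern] at h
    simp only [not_forall, not_not, Fintype.card_sum, Fintype.card_fin] at h
    exact h
  have h4 : wPr (powWeight (Fin n × Fin n) (powWeight (Fin n ⊕ Fin b) (bern p)))
      (fun X => ∀ e, ∃ c, X e c = true) = (1 - (1 - p) ^ (n + b)) ^ (n ^ 2) := by
    rw [wPr_powWeight_forall _ (fun v : Fin n ⊕ Fin b → Bool => ∃ c, v c = true), h1]
    simp [sq]
  rw [h4]
  have h5 : 1 - (1 - p) ^ (n + b) ≤ Real.exp (-(1 - p) ^ (n + b)) := by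
    have := Real.add_one_le_exp (-(1 - p) ^ (n + b)); linarith
  have h6 : 0 ≤ 1 - (1 - p) ^ (n + b) := sub_nonneg.2 (pow_le_one₀ (by linarith) (by linarith))
  refine (pow_le_pow_left₀ h6 h5 _).trans_eq ?_
  rw [← Real.exp_nat_mul]
  congr 1
  push_cast
  ring

/-- The hitting times differ with probability at most that of an event in the binomial model. -/
theorem card_hittingTime_ne_le {p : ℝ} (hp0 : 0 ≤ p) (hp1 : p ≤ 1) (hm : 0 < m)
    (hmb : m = n + b) :
    ((Finset.univ.filter fun σ : Fin (n * n * m) ≃ (Fin n × Fin n × Fin m) =>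
        ¬ hittingTime n m σ NoEmptyShaft = hittingTime n m σ ContainsLatinBox).card : ℝ)
        / Fintype.card (Fin (n * n * m) ≃ (Fin n × Fin n × Fin m))
      ≤ wPr (powWeight (Fin n × Fin n) (powWeight (Fin n ⊕ Fin b) (bern p)))
          (fun X => ¬ RobustlyColorable X) + Real.exp (-(n ^ 2 * (1 - p) ^ (n + b))) := by
  have hw := isWeight_bern hp0 hp1
  have κ : Fin m ≃ Fin n ⊕ Fin b := Fintype.equivOfCardEq (by simp [hmb])
  refine (card_div_card_le_wPr (by simp [mul_assoc]) hp0 hp1 _ (fun M =>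
    ¬ RobustlyColorable (fun (e : Fin n × Fin n) c => M (e.1, e.2, κ.symm c)) ∨
      ∀ e : Fin n × Fin n, ∃ c, M (e.1, e.2, κ.symm c) = true) fun σ hσ t => ?_).trans ?_
  · by_contra! h
    refine (Finset.mem_filter.1 hσ).2 (hittingTime_eq_of_robustlyColorable hm κ (t := t) h.1 ?_)
    intro h'
    obtain ⟨e, he⟩ := h.2
    obtain ⟨v, hv⟩ := h' e.1 e.2
    refine he (κ v) ?_
    simpa [procArr] using hv
  · rw [wPr_arrays κ]
    simp only [Equiv.apply_symm_apply]
    exact (wPr_or_le hw.powWeight.powWeight _ _).trans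
      (add_le_add_right (wPr_noEmptyShaft_le hp0 hp1) _)

end Arrays

section Asymptotics

theorem wPr_isThin_le {ι : Type*} [Fintype ι] [DecidableEq ι] {p : ℝ} (hp0 : 0 ≤ p) (hp1 : p ≤ 1)
    (ℓ : ℝ) :
    wPr (powWeight ι (bern p)) (IsThin ℓ)
      ≤ Real.exp (4 * ℓ - 49 / 50 * p * Fintype.card ι) := by
  have hw := (isWeight_bern hp0 hp1).powWeight (ι := ι)
  have h50 : Real.exp (-4) ≤ 1 / 50 := by
    have h1 : (50 : ℝ) ≤ Real.exp 4 := by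
      have h := pow_le_pow_left₀ (by norm_num) Real.exp_one_gt_d9.le 4
      rw [← Real.exp_nat_mul] at h
      norm_num at h
      linarith
    rw [Real.exp_neg, inv_eq_one_div]
    exact one_div_le_one_div_of_le (by norm_num) h1
  calc wPr (powWeight ι (bern p)) (IsThin ℓ)
      ≤ wExp (powWeight ι (bern p)) (fun ω => Real.exp (4 * ℓ) *
          Real.exp (-4) ^ (Finset.univ.filter fun i => ω i = true).card) := by
        refine wPr_le_wExp hw (fun ω => by positivity) fun ω hω => ?_
        rw [← Real.exp_nat_mul, ← Real.exp_add]
        refine Real.one_le_exp ?_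
        have := le_of_lt hω
        linarith
    _ ≤ Real.exp (4 * ℓ) * Real.exp (-(p * (1 - Real.exp (-4)) * Fintype.card ι)) := by
        rw [wExp_const_mul]
        exact mul_le_mul_of_nonneg_left (wExp_pow_card_true hp0 hp1 (Real.exp_pos _).le)
          (Real.exp_pos _).le
    _ ≤ _ := by
        rw [← Real.exp_add, Real.exp_le_exp]
        have : 49 / 50 * (p * Fintype.card ι) ≤ (1 - Real.exp (-4)) * (p * Fintype.card ι) :=
          mul_le_mul_of_nonneg_right (by linarith) (by positivity)
        linarith

theorem exp_neg_div_one_sub_le {p : ℝ} (hp1 : p < 1) : Real.exp (-(p / (1 - p))) ≤ 1 - p := by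
  have h : 0 < 1 - p := by linarith
  rw [Real.exp_neg]
  refine inv_le_of_inv_le₀ h ?_
  have := Real.add_one_le_exp (p / (1 - p))
  have h2 : p / (1 - p) + 1 = (1 - p)⁻¹ := by field_simp; ring
  linarith

/-- The smallness conditions on `1 / x` needed for the estimates with `x = log n`. -/
structure LargeParam (r δ u θ κ c x : ℝ) : Prop where
  pos : 1 ≤ x
  degree : 1 ≤ δ * x
  thin : 2 * Real.exp 1 * (x ^ 2 * Real.exp (-(r * x))) ≤ 1
  half : Real.exp (-(r * x)) ≤ 1 / 2
  sq : 7 / 4 * Real.exp u ≤ x ^ 2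
  lin : 7 * Real.exp 1 ≤ κ * x
  defect : 3 ≤ κ * x ^ 2
  cube : 4 * x ^ 3 ≤ Real.exp x
  defect_exp : 8 * x ≤ κ * Real.exp x
  colour_exp : 256 * x ≤ θ ^ 4 * Real.exp x
  small : 27 * x ≤ Real.exp x
  root : x ≤ Real.exp (x / 8)
  regular : 3 * Real.exp (-(c * x)) ≤ θ ^ 2 / 64

theorem eventually_mul_pow_le_exp {C : ℝ} (k : ℕ) {a : ℝ} (ha : 0 < a) :
    ∀ᶠ x in Filter.atTop, C * x ^ k ≤ Real.exp (a * x) := by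
  have h : (fun x : ℝ => x ^ k) =o[Filter.atTop] fun x => Real.exp (a * x) :=
    isLittleO_pow_exp_pos_mul_atTop k ha
  have h2 : (fun x : ℝ => C * x ^ k) =o[Filter.atTop] fun x => Real.exp (a * x) :=
    h.const_mul_left C
  filter_upwards [h2.bound one_pos] with x hx
  rw [one_mul, Real.norm_eq_abs, Real.norm_eq_abs, abs_of_pos (Real.exp_pos _)] at hx
  exact (le_abs_self _).trans hx

theorem eventually_largeParam {r δ u θ κ c : ℝ} (hr : 0 < r) (hδ : 0 < δ) (hθ : 0 < θ)
    (hκ : 0 < κ) (hc : 0 < c) : ∀ᶠ x in Filter.atTop, LargeParam r δ u θ κ c x := by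
  have hinv : ∀ {a b : ℝ}, a ≤ Real.exp b → a * Real.exp (-b) ≤ 1 := fun {a b} h => by
    rw [Real.exp_neg, ← div_eq_mul_inv, div_le_one (Real.exp_pos _)]; exact h
  filter_upwards [Filter.eventually_ge_atTop 1, Filter.eventually_ge_atTop (1 / δ),
    eventually_mul_pow_le_exp (C := 2 * Real.exp 1) 2 hr,
    eventually_mul_pow_le_exp (C := 2) 0 hr,
    Filter.eventually_ge_atTop (7 / 4 * Real.exp u), Filter.eventually_ge_atTop (7 * Real.exp 1 / κ),
    Filter.eventually_ge_atTop (3 / κ), eventually_mul_pow_le_exp (C := 4) 3 one_pos,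
    eventually_mul_pow_le_exp (C := 8 / κ) 1 one_pos,
    eventually_mul_pow_le_exp (C := 256 / θ ^ 4) 1 one_pos,
    eventually_mul_pow_le_exp (C := 27) 1 one_pos,
    eventually_mul_pow_le_exp (C := 1) 1 (show (0 : ℝ) < 1 / 8 by norm_num),
    eventually_mul_pow_le_exp (C := 3 * 64 / θ ^ 2) 0 hc]
    with x h1 h2 h3 h4 h5 h6 h7 h8 h9 h10 h11 h12 h13
  rw [div_le_iff₀ hδ] at h2
  rw [div_le_iff₀ hκ] at h6 h7
  have hx2 : x ≤ x ^ 2 := by nlinarith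
  simp only [one_mul, pow_one] at h8 h9 h10 h11 h12
  refine ⟨h1, by linarith, ?_, ?_, by linarith, by linarith, by nlinarith, h8, ?_, ?_, h11, ?_, ?_⟩
  · rw [← mul_assoc]; exact hinv h3
  · have := hinv h4
    rw [pow_zero, mul_one] at this
    linarith
  · rw [div_mul_eq_mul_div, div_le_iff₀ hκ] at h9; linarith
  · rw [div_mul_eq_mul_div, div_le_iff₀ (by positivity)] at h10; linarith
  · convert h12 using 2; ring
  · have := hinv h13
    rw [pow_zero, mul_one, div_mul_eq_mul_div, div_le_one (by positivity)] at this
    linarith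

end Asymptotics

section Main

set_option maxHeartbeats 1000000 in
/-- The hitting times differ with probability at most a constant times `n ^ (-2 / 5)`. -/
theorem card_hittingTime_ne_le_exp {ε δ u θ κ x : ℝ} (hε : 0 < ε)
    (hδ : δ = ε / (2 + ε) / 20000) (hu : u = 6 / δ) (hθ : θ = Real.exp (-u) / 4)
    (hκ : κ = θ ^ 3 / 64) {n m b : ℕ} (hmb : m = n + b) (hm : (1 + ε) * n ≤ m)
    (hm2 : m ≤ (2 + ε) * n) (hx : Real.exp x = n)
    (H : LargeParam (ε / (2 + ε)) δ u θ κ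
      (θ * (7 / 4 / (2 + ε)) * ((θ ^ 2 / 64) ^ 2 / (θ ^ 2 / 64 + 2))) x) :
    ((Finset.univ.filter fun σ : Fin (n * n * m) ≃ (Fin n × Fin n × Fin m) =>
        ¬ hittingTime n m σ NoEmptyShaft = hittingTime n m σ ContainsLatinBox).card : ℝ)
        / Fintype.card (Fin (n * n * m) ≃ (Fin n × Fin n × Fin m))
      ≤ (14 + 2 * ε + 2 / κ) * Real.exp (-(2 / 5 * x)) := by
  have hx1 := H.pos
  have hn0 : (0 : ℝ) < n := hx ▸ Real.exp_pos x
  have hr0 : 0 < ε / (2 + ε) := by positivity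
  have hr1 : ε / (2 + ε) ≤ 1 := by rw [div_le_one (by linarith)]; linarith
  have hδ0 : 0 < δ := by rw [hδ]; positivity
  have hu0 : 0 ≤ u := by rw [hu]; positivity
  have hθ0 : 0 < θ := by rw [hθ]; positivity
  have hθ1 : θ ≤ 1 / 4 := by
    rw [hθ]
    have : Real.exp (-u) ≤ 1 := Real.exp_le_one_iff.2 (by linarith)
    linarith
  have huθ : Real.exp u * θ = 1 / 4 := by
    rw [hθ, mul_div_assoc', ← Real.exp_add]; simp
  have hκ0 : 0 < κ := by rw [hκ]; positivity
  have hθ2 : θ ^ 2 ≤ 1 := by nlinarith only [hθ0, hθ1]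
  have hκθ : κ ≤ θ / 64 := by
    rw [hκ]; linarith only [mul_le_mul_of_nonneg_left hθ2 hθ0.le]
  have hmR : (m : ℝ) = n + b := by exact_mod_cast hmb
  have hnm : (n : ℝ) ≤ m := by nlinarith
  have hm0 : (0 : ℝ) < m := hn0.trans_le hnm
  have hbn : ε * n ≤ b := by linarith
  have hb0 : (0 : ℝ) < b := lt_of_lt_of_le (by positivity) hbn
  have : Nonempty (Fin n) := ⟨⟨0, by exact_mod_cast hn0⟩⟩
  have : Nonempty (Fin b) := ⟨⟨0, by exact_mod_cast hb0⟩⟩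
  obtain ⟨p, hp⟩ : ∃ p, p = 7 / 4 * x / m := ⟨_, rfl⟩
  have hp0 : 0 < p := by rw [hp]; positivity
  have hpm : p * m = 7 / 4 * x := by rw [hp]; field_simp
  have hpn : p * n ≤ 7 / 4 * x := hpm ▸ mul_le_mul_of_nonneg_left hnm hp0.le
  have hpn2 : 7 / 4 / (2 + ε) * x ≤ p * n := by
    rw [div_mul_eq_mul_div, ← hpm, div_le_iff₀ (by linarith)]
    linarith only [mul_le_mul_of_nonneg_left hm2 hp0.le]
  have hpb : 7 / 4 * (ε / (2 + ε)) * x ≤ p * b := by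
    have := mul_le_mul_of_nonneg_left hbn hp0.le
    have := mul_le_mul_of_nonneg_left hpn2 hε.le
    calc _ = ε * (7 / 4 / (2 + ε) * x) := by ring
      _ ≤ _ := by linarith
  have hp15 : p ≤ 1 / 15 := by
    have h1 := H.small
    rw [hx] at h1
    rw [hp, div_le_iff₀ hm0]
    linarith
  have hp1 : p ≤ 1 := by linarith
  have hexp : ∀ {a b : ℝ}, a ≤ b → Real.exp a ≤ Real.exp b := fun h => Real.exp_le_exp.2 h
  obtain ⟨ℓ, hℓ⟩ : ∃ ℓ, ℓ = 32 * (δ * x) := ⟨_, rfl⟩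
  have hδr : 128 * (δ * x) ≤ 7 / 1000 * (ε / (2 + ε)) * x := by
    have : 0 ≤ ε / (2 + ε) * x := by positivity
    calc 128 * (δ * x) = 128 / 20000 * (ε / (2 + ε) * x) := by rw [hδ]; ring
      _ ≤ _ := by linarith
  have hrx : ε / (2 + ε) * x ≤ x := mul_le_of_le_one_left (by linarith) hr1
  obtain ⟨qA, hqA⟩ : ∃ qA, qA = Real.exp (4 * ℓ - 49 / 50 * p * n) := ⟨_, rfl⟩
  obtain ⟨qB, hqB⟩ : ∃ qB, qB = Real.exp (4 * ℓ - 49 / 50 * p * b) := ⟨_, rfl⟩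
  have hqB0 : 0 < qB := hqB ▸ Real.exp_pos _
  have hqBr : qB ≤ Real.exp (-(ε / (2 + ε) * x)) := by
    rw [hqB]
    refine hexp ?_
    have : 0 ≤ ε / (2 + ε) * x := by positivity
    linarith
  have hqBA : qB * qA ≤ Real.exp (-(17 / 10 * x)) := by
    rw [hqB, hqA, ← Real.exp_add]
    refine hexp ?_
    have : p * n + p * b = 7 / 4 * x := by rw [← hpm, hmR]; ring
    linarith
  have hqBA0 : 0 ≤ qB * qA := by rw [hqB, hqA]; positivity
  have hpow : ∀ (k : ℕ), (n : ℝ) ^ k = Real.exp (k * x) := fun k => by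
    rw [← hx, Real.exp_nat_mul]
  have hzx : p * (n / x ^ 2) ≤ 7 / 4 / x := by
    calc _ = p * n / x ^ 2 := by ring
      _ ≤ 7 / 4 * x / x ^ 2 := div_le_div_of_nonneg_right hpn (by positivity)
      _ = _ := by field_simp
  have hdu : δ * x * u = 6 * x := by rw [hu]; field_simp
  have hE : ∀ {a : ℝ}, a ≤ -(2 / 5 * x) → Real.exp a ≤ Real.exp (-(2 / 5 * x)) := hexp
  have t1 : 2 * n * Real.exp (qB * Real.exp 1 * n - n / x ^ 2) ≤ 2 * Real.exp (-(2 / 5 * x)) := by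
    have h1 : qB * Real.exp 1 * n ≤ n / x ^ 2 / 2 := by
      rw [div_div, le_div_iff₀ (by positivity)]
      have h2 : 2 * Real.exp 1 * x ^ 2 * qB ≤ 1 := by
        have := mul_le_mul_of_nonneg_left hqBr (show 0 ≤ 2 * Real.exp 1 * x ^ 2 by positivity)
        linarith only [H.thin, this]
      linarith only [mul_le_mul_of_nonneg_right h2 hn0.le]
    have h2 : 2 * x ≤ n / x ^ 2 / 2 := by
      rw [div_div, le_div_iff₀ (by positivity), ← hx]
      linarith only [H.cube]
    calc _ ≤ 2 * Real.exp x * Real.exp (-(2 * x)) := by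
          rw [hx]
          exact mul_le_mul_of_nonneg_left (hexp (by linarith only [h1, h2])) (by positivity)
      _ = 2 * Real.exp (x + -(2 * x)) := by rw [Real.exp_add]; ring
      _ ≤ _ := mul_le_mul_of_nonneg_left (hE (by linarith only [hx1])) (by norm_num)
  have t2 : 2 * n * n * Real.exp (p * Real.exp u * (n / x ^ 2) - δ * x * u)
      ≤ 2 * Real.exp (-(2 / 5 * x)) := by
    have h1 : p * Real.exp u * (n / x ^ 2) ≤ x := by
      calc _ = Real.exp u * (p * (n / x ^ 2)) := by ring
        _ ≤ Real.exp u * (7 / 4 / x) := mul_le_mul_of_nonneg_left hzx (Real.exp_pos _).le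
        _ ≤ x := by
          rw [mul_div_assoc', div_le_iff₀ (by linarith)]
          nlinarith only [H.sq, hx1]
    calc _ ≤ 2 * n * n * Real.exp (-(5 * x)) :=
          mul_le_mul_of_nonneg_left (hexp (by linarith only [h1, hdu])) (by positivity)
      _ = 2 * Real.exp (x + x + -(5 * x)) := by rw [Real.exp_add, Real.exp_add, hx]; ring
      _ ≤ _ := mul_le_mul_of_nonneg_left (hE (by linarith only [hx1])) (by norm_num)
  have t3 : n * Real.exp (p * Real.exp 1 * (n * (n / x ^ 2)) - κ * n / 2)
      ≤ Real.exp (-(2 / 5 * x)) := by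
    have h1 : p * Real.exp 1 * (n * (n / x ^ 2)) ≤ κ * n / 4 := by
      calc _ = Real.exp 1 * n * (p * (n / x ^ 2)) := by ring
        _ ≤ Real.exp 1 * n * (7 / 4 / x) := mul_le_mul_of_nonneg_left hzx (by positivity)
        _ ≤ κ * n / 4 := by
          rw [mul_div_assoc', div_le_iff₀ (by linarith)]
          linarith only [mul_le_mul_of_nonneg_right H.lin hn0.le]
    have h2 : 2 * x ≤ κ * n / 4 := by
      have := H.defect_exp
      rw [hx] at this
      linarith only [this]
    calc _ ≤ n * Real.exp (-(2 * x)) :=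
          mul_le_mul_of_nonneg_left (hexp (by linarith only [h1, h2])) hn0.le
      _ = Real.exp (x + -(2 * x)) := by rw [Real.exp_add, hx]
      _ ≤ _ := hE (by linarith only [hx1])
  have t4 : 2 * (n : ℝ) ^ 3 * (qB * qA) ^ 2 ≤ 2 * Real.exp (-(2 / 5 * x)) := by
    calc _ ≤ 2 * (n : ℝ) ^ 3 * Real.exp (-(17 / 10 * x)) ^ 2 :=
          mul_le_mul_of_nonneg_left (pow_le_pow_left₀ hqBA0 hqBA 2) (by positivity)
      _ = 2 * Real.exp ((3 : ℕ) * x + (2 : ℕ) * -(17 / 10 * x)) := by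
          rw [Real.exp_add, Real.exp_nat_mul _ 2, hpow]; ring
      _ ≤ _ := mul_le_mul_of_nonneg_left (hE (by push_cast; linarith only [hx1])) (by norm_num)
  have t5 : (n : ℝ) ^ 2 * (qB * qA) / (κ * n / 2) ≤ 2 / κ * Real.exp (-(2 / 5 * x)) := by
    calc _ = 2 / κ * (n * (qB * qA)) := by field_simp
      _ ≤ 2 / κ * (n * Real.exp (-(17 / 10 * x))) := by gcongr
      _ = 2 / κ * Real.exp (x + -(17 / 10 * x)) := by rw [Real.exp_add, hx]
      _ ≤ _ := mul_le_mul_of_nonneg_left (hE (by linarith only [hx1])) (by positivity)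
  have t6 : Real.exp ((θ ^ 3 / 16 * n / (θ * n)) ^ 2 + θ ^ 3 / 16 * n / (θ * n) *
      (2 * (θ ^ 2 / 64) + 2 * (κ * n) / (θ * n))) ^ n *
      (2 * n * Real.exp (θ ^ 3 / 16 * n * ((n + κ * n) / (θ * n + n) - 1)))
      ≤ 2 * Real.exp (-(2 / 5 * x)) := by
    have h1 : θ ^ 3 / 16 * n / (θ * n) = θ ^ 2 / 16 := by field_simp
    have h2 : 2 * (κ * n) / (θ * n) = θ ^ 2 / 32 := by rw [hκ]; field_simp; norm_num
    have h3 : (n + κ * n) / (θ * n + n) - 1 ≤ -(θ / 4) := by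
      rw [sub_le_iff_le_add, div_le_iff₀ (by positivity)]
      have : 1 + κ ≤ (-(θ / 4) + 1) * (θ + 1) := by nlinarith only [hθ0, hθ1, hκθ]
      linarith only [mul_le_mul_of_nonneg_right this hn0.le]
    have h4 : 2 * x ≤ θ ^ 4 / 128 * n := by
      have := H.colour_exp
      rw [hx] at this
      linarith only [this]
    rw [h1, h2, ← Real.exp_nat_mul]
    have h5 := mul_le_mul_of_nonneg_left h3 (show 0 ≤ θ ^ 3 / 16 * n by positivity)
    calc _ = 2 * Real.exp (n * ((θ ^ 2 / 16) ^ 2 + θ ^ 2 / 16 * (2 * (θ ^ 2 / 64) + θ ^ 2 / 32))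
            + x + θ ^ 3 / 16 * n * ((n + κ * n) / (θ * n + n) - 1)) := by
          rw [Real.exp_add, Real.exp_add, hx]; ring
      _ ≤ _ := mul_le_mul_of_nonneg_left (hE (by linarith only [h4, h5, hx1])) (by norm_num)
  have t7 : 2 * n * b * Real.exp (2 * p * Real.exp u * (θ * n + κ * n / 2) - δ * x * u)
      ≤ 2 * (2 + ε) * Real.exp (-(2 / 5 * x)) := by
    have h1 : 2 * p * Real.exp u * (θ * n + κ * n / 2) ≤ x := by
      calc _ = 2 * (Real.exp u * (θ + κ / 2)) * (p * n) := by ring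
        _ ≤ 2 * (Real.exp u * (θ + θ / 128)) * (7 / 4 * x) := by
          refine mul_le_mul (mul_le_mul_of_nonneg_left (mul_le_mul_of_nonneg_left ?_
            (Real.exp_pos _).le) zero_le_two) hpn (by positivity) (by positivity)
          linarith only [hκθ]
        _ = 2 * (Real.exp u * θ) * (1 + 1 / 128) * (7 / 4 * x) := by ring
        _ ≤ x := by rw [huθ]; linarith only [hx1]
    have hbn : (b : ℝ) ≤ (2 + ε) * n := by linarith
    calc _ ≤ 2 * n * ((2 + ε) * n) * Real.exp (-(5 * x)) := by
          gcongr
          linarith only [h1, hdu]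
      _ = 2 * (2 + ε) * Real.exp (x + x + -(5 * x)) := by rw [Real.exp_add, Real.exp_add, hx]; ring
      _ ≤ _ := mul_le_mul_of_nonneg_left (hE (by linarith only [hx1])) (by positivity)
  have t8 : Real.exp (-(n ^ 2 * (1 - p) ^ (n + b))) ≤ Real.exp (-(2 / 5 * x)) := by
    refine hE (neg_le_neg ?_)
    have h1 : 15 / 8 * x ≥ p / (1 - p) * m := by
      rw [ge_iff_le, div_mul_eq_mul_div, hpm, div_le_iff₀ (by linarith)]
      nlinarith only [hp15, hx1]
    have h2 : Real.exp (-(15 / 8 * x)) ≤ (1 - p) ^ (n + b) := by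
      calc _ ≤ Real.exp (m * -(p / (1 - p))) := hexp (by linarith only [h1])
        _ = Real.exp (-(p / (1 - p))) ^ (n + b) := by rw [Real.exp_nat_mul, hmb]
        _ ≤ _ := pow_le_pow_left₀ (Real.exp_pos _).le (exp_neg_div_one_sub_le (by linarith)) _
    calc 2 / 5 * x ≤ Real.exp (x / 8) := by linarith only [H.root, hx1]
      _ = (n : ℝ) ^ 2 * Real.exp (-(15 / 8 * x)) := by
          rw [hpow, ← Real.exp_add]; congr 1; push_cast; ring
      _ ≤ _ := mul_le_mul_of_nonneg_left h2 (by positivity)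
  have main := wPr_not_robustlyColorable_le (n := n) (b := b) hp0 hp1 (z := n / x ^ 2) (d := δ * x)
    (f₃ := κ * n / 2) (s := κ * n / 2) (f := κ * n) (u := u) (qA := qA) (qB := qB)
    (η := θ ^ 2 / 64) (W := θ * n) (lam := θ ^ 3 / 16 * n) (ℓ := ℓ) (by positivity) hu0
    H.degree hℓ.ge (by
      have := mul_le_mul_of_nonneg_right H.defect hn0.le
      rw [mul_div_assoc', div_le_iff₀ (by positivity)]
      linarith) (by linarith) (by positivity)
    (by rw [hqB]; simpa using wPr_isThin_le (ι := Fin b) hp0.le hp1 ℓ)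
    (hqBr.trans H.half)
    (by rw [hqA]; simpa using wPr_isThin_le (ι := Fin n) hp0.le hp1 ℓ)
    (by positivity) (by linarith) (by positivity) (by positivity) (by
      refine le_trans ?_ H.regular
      refine mul_le_mul (by linarith) (hexp (neg_le_neg ?_)) (Real.exp_pos _).le (by norm_num)
      have h1 : 0 ≤ θ * ((θ ^ 2 / 64) ^ 2 / (θ ^ 2 / 64 + 2)) := by positivity
      have := mul_le_mul_of_nonneg_left hpn2 h1
      linarith)
  have hlast := card_hittingTime_ne_le (n := n) (b := b) hp0.le hp1 (by exact_mod_cast hm0) hmb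
  refine hlast.trans ((add_le_add_left main _).trans ?_)
  exact (add_le_add (add_le_add (add_le_add (add_le_add (add_le_add t1 t2)
    (add_le_add (add_le_add t3 t4) t5)) t6) t7) t8).trans_eq (by ring)

end Main

/-- For `ε > 0` and `m = ⌈(1+ε)n⌉`, w.h.p. in the uniformly random `(n,n,m)`-array
process the hitting time of having no empty shaft equals the hitting time of supporting
a Latin box. -/
theorem stmt7 (ε : ℝ) (hε : 0 < ε) :
    Filter.Tendsto (fun n : ℕ =>
      ((Finset.univ.filter
          (fun σ : Fin (n * n * ⌈(1 + ε) * (n : ℝ)⌉₊) ≃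
              (Fin n × Fin n × Fin ⌈(1 + ε) * (n : ℝ)⌉₊) =>
            hittingTime n ⌈(1 + ε) * (n : ℝ)⌉₊ σ NoEmptyShaft
              = hittingTime n ⌈(1 + ε) * (n : ℝ)⌉₊ σ ContainsLatinBox)).card : ℝ)
        / (Fintype.card (Fin (n * n * ⌈(1 + ε) * (n : ℝ)⌉₊) ≃
            (Fin n × Fin n × Fin ⌈(1 + ε) * (n : ℝ)⌉₊)) : ℝ))
      Filter.atTop (nhds 1) := by
  obtain ⟨δ, hδ⟩ : ∃ δ, δ = ε / (2 + ε) / 20000 := ⟨_, rfl⟩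
  obtain ⟨u, hu⟩ : ∃ u, u = 6 / δ := ⟨_, rfl⟩
  obtain ⟨θ, hθ⟩ : ∃ θ, θ = Real.exp (-u) / 4 := ⟨_, rfl⟩
  obtain ⟨κ, hκ⟩ : ∃ κ, κ = θ ^ 3 / 64 := ⟨_, rfl⟩
  have hδ0 : 0 < δ := by rw [hδ]; positivity
  have hθ0 : 0 < θ := by rw [hθ]; positivity
  have hκ0 : 0 < κ := by rw [hκ]; positivity
  have hlog : Filter.Tendsto (fun n : ℕ => Real.log n) Filter.atTop Filter.atTop :=
    Real.tendsto_log_atTop.comp tendsto_natCast_atTop_atTop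
  have hlarge := hlog.eventually (eventually_largeParam (r := ε / (2 + ε)) (u := u)
    (c := θ * (7 / 4 / (2 + ε)) * ((θ ^ 2 / 64) ^ 2 / (θ ^ 2 / 64 + 2)))
    (by positivity) hδ0 hθ0 hκ0 (by positivity))
  have hlim : Filter.Tendsto (fun n : ℕ => 1 - (14 + 2 * ε + 2 / κ) *
      Real.exp (-(2 / 5 * Real.log n))) Filter.atTop (nhds 1) := by
    have h1 : Filter.Tendsto (fun n : ℕ => Real.exp (-(2 / 5 * Real.log n))) Filter.atTop
        (nhds 0) :=
      Real.tendsto_exp_neg_atTop_nhds_zero.comp (hlog.const_mul_atTop (by norm_num))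
    simpa using (h1.const_mul (14 + 2 * ε + 2 / κ)).const_sub 1
  refine tendsto_of_tendsto_of_tendsto_of_le_of_le' hlim tendsto_const_nhds ?_ ?_
  · filter_upwards [hlarge, Filter.eventually_ge_atTop 1] with n H hn
    have hn1 : (1 : ℝ) ≤ n := by exact_mod_cast hn
    have hm := Nat.le_ceil ((1 + ε) * (n : ℝ))
    have hm2 := Nat.ceil_lt_add_one (show 0 ≤ (1 + ε) * (n : ℝ) by positivity)
    generalize ⌈(1 + ε) * (n : ℝ)⌉₊ = m at *
    have hnm : n ≤ m := by
      have : (n : ℝ) ≤ m := by nlinarith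
      exact_mod_cast this
    have h := card_hittingTime_ne_le_exp hε hδ hu hθ hκ (b := m - n) (Nat.add_sub_of_le hnm).symm
      hm (by linarith) (Real.exp_log (by linarith)) H
    have hpos : (0 : ℝ) < Fintype.card (Fin (n * n * m) ≃ (Fin n × Fin n × Fin m)) := by
      have : Nonempty (Fin (n * n * m) ≃ (Fin n × Fin n × Fin m)) :=
        ⟨Fintype.equivOfCardEq (by simp [mul_assoc])⟩
      exact_mod_cast Fintype.card_pos
    have hsum := Finset.card_filter_add_card_filter_not
      (s := (Finset.univ : Finset (Fin (n * n * m) ≃ (Fin n × Fin n × Fin m))))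
      (fun σ => hittingTime n m σ NoEmptyShaft = hittingTime n m σ ContainsLatinBox)
    rw [Finset.card_univ] at hsum
    rw [← hsum] at h hpos ⊢
    push_cast at h hpos ⊢
    rw [div_le_iff₀ hpos] at h
    rw [le_div_iff₀ hpos]
    linarith
  · refine Filter.Eventually.of_forall fun n => div_le_one_of_le₀ ?_ (by positivity)
    exact_mod_cast Finset.card_le_univ _

end
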